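/- For any natural number n and any interval I in ℝ of positive finite length, dim(⋂_{k=1}^n 𝓑_k ∩ I) = dim(⋂_{k=1}^n (𝓦_k* ∩ 𝓑_k* ∩ I)) = 1. In particular, each 𝓑_n contains a transcendental real number, and so does each 𝓦_n* ∩ 𝓑_n*, settling Bugeaud's Problems 24 and 25. -/

import Mathlib

open MeasureTheory

/-- The (naive) height of an integer polynomial: the maximum of the absolute
values of its coefficients. -/
def polyHeight (P : Polynomial ℤ) : ℕ := P.support.sup fun i => (P.coeff i).natAbs

/-- `α : ℝ` is a real algebraic number of degree at most `n`. -/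
def IsAlgDegLe (n : ℕ) (α : ℝ) : Prop :=
  ∃ P : Polynomial ℤ, P ≠ 0 ∧ Polynomial.aeval α P = 0 ∧ P.natDegree ≤ n

/-- The (naive) height of a real algebraic number: the minimum of `polyHeight P`
over all nonzero integer polynomials `P` vanishing at `α`. -/
noncomputable def algHeight (α : ℝ) : ℕ :=
  sInf {h | ∃ P : Polynomial ℤ, P ≠ 0 ∧ Polynomial.aeval α P = 0 ∧ polyHeight P = h}

/-- The set `𝓑_n` of reals badly approximable by integer polynomials of degree `≤ n`. -/
def BsetB (n : ℕ) : Set ℝ :=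
  {ξ | ∃ c : ℝ, 0 < c ∧ ∀ P : Polynomial ℤ, P ≠ 0 → P.natDegree ≤ n →
    c / (polyHeight P : ℝ) ^ n ≤ |Polynomial.aeval ξ P|}

/-- The set `𝓦_n*` of reals very well approximable by algebraic numbers of degree `≤ n`. -/
def WstarSet (n : ℕ) : Set ℝ :=
  {ξ | ∃ c : ℝ, 0 < c ∧
    {α : ℝ | IsAlgDegLe n α ∧ |ξ - α| < c / (algHeight α : ℝ) ^ (n + 1)}.Infinite}

/-- The set `𝓑_n*` of reals badly approximable by algebraic numbers of degree `≤ n`. -/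
def BstarSet (n : ℕ) : Set ℝ :=
  {ξ | ∃ c : ℝ, 0 < c ∧ ∀ α : ℝ, IsAlgDegLe n α →
    c / (algHeight α : ℝ) ^ (n + 1) ≤ |ξ - α|}

namespace BB

lemma exists_spread (d : ℕ) (t : ℝ) (ht : 0 < t) : ∀ (S : Set ℝ), BddBelow S →
    ENNReal.ofReal (d * t) < volume S →
    ∃ x : ℕ → ℝ, (∀ i ≤ d, x i ∈ S) ∧ ∀ i j, i < j → j ≤ d → x i + t ≤ x j := by
  induction d with
  | zero =>
    intro S _ h
    have : S.Nonempty := by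
      rw [Set.nonempty_iff_ne_empty]; rintro rfl; simp at h
    obtain ⟨s, hs⟩ := this
    exact ⟨fun _ => s, fun _ _ => hs, fun i j h1 h2 => by omega⟩
  | succ d ih =>
    intro S hb h
    have hne : S.Nonempty := by
      rw [Set.nonempty_iff_ne_empty]; rintro rfl; simp at h
    obtain ⟨η, hη, h'⟩ : ∃ η : ℝ, 0 < η ∧ ENNReal.ofReal ((d+1 : ℕ) * t + η) < volume S := by
      obtain ⟨u, hu1, hu2⟩ := exists_between h
      have hut : u ≠ ⊤ := ne_top_of_lt hu2
      refine ⟨u.toReal - (d+1:ℕ)*t, ?_, ?_⟩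
      · have := (ENNReal.ofReal_lt_iff_lt_toReal (by positivity) hut).1 hu1
        linarith
      · rw [add_sub_cancel, ENNReal.ofReal_toReal hut]; exact hu2
    obtain ⟨x0, hx0, hx0'⟩ := exists_lt_of_csInf_lt hne (lt_add_of_pos_right (sInf S) hη)
    have hsub : S ⊆ Set.Ico (sInf S) (x0 + t) ∪ (S ∩ Set.Ici (x0 + t)) := by
      intro z hz
      by_cases hzz : z < x0 + t
      · exact Or.inl ⟨csInf_le hb hz, hzz⟩
      · exact Or.inr ⟨hz, not_lt.1 hzz⟩
    have h2 : ENNReal.ofReal (d * t) < volume (S ∩ Set.Ici (x0 + t)) := by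
      by_contra hcon
      push Not at hcon
      have h3 : volume S ≤ ENNReal.ofReal (t + η) + ENNReal.ofReal (d*t) := by
        refine (measure_mono hsub).trans ((measure_union_le _ _).trans (add_le_add ?_ hcon))
        rw [Real.volume_Ico]
        exact ENNReal.ofReal_le_ofReal (by linarith)
      rw [← ENNReal.ofReal_add (by positivity) (by positivity)] at h3
      have := h'.trans_le h3
      push_cast at this
      ring_nf at this
      exact lt_irrefl _ this
    obtain ⟨x, hx1, hx2⟩ := ih _ (hb.mono Set.inter_subset_left) h2
    refine ⟨fun i => if i = 0 then x0 else x (i-1), ?_, ?_⟩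
    · intro i hi
      by_cases h0 : i = 0
      · simp [h0, hx0]
      · simp only [h0, if_false]
        exact (hx1 (i-1) (by omega)).1
    · intro i j hij hj
      have hj0 : j ≠ 0 := by omega
      by_cases h0 : i = 0
      · simp only [h0, hj0, if_true, if_false]
        exact (hx1 (j-1) (by omega)).2
      · simp only [h0, hj0, if_false]
        exact hx2 _ _ (by omega) (by omega)

lemma remez (d : ℕ) (p : Polynomial ℝ) (hp : p.natDegree ≤ d) (a b y ρ ε ω : ℝ)
    (hy : y ∈ Set.Ico a b) (hρ : ρ ≤ |p.eval y|) (hω : 0 < ω) (hε : 0 ≤ ε)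
    (h : (d+1) * ε < ρ * ω^d) :
    volume {x ∈ Set.Ico a b | |p.eval x| < ε} ≤ ENNReal.ofReal (d * ω * (b-a)) := by
  by_contra hcon
  push Not at hcon
  have hab : 0 < b - a := by have := hy.1.trans_lt hy.2; linarith
  rw [mul_assoc] at hcon
  obtain ⟨x, hx1, hx2⟩ := exists_spread d (ω * (b-a)) (by positivity) _
    ⟨a, fun z hz => hz.1.1⟩ hcon
  have ht : 0 < ω * (b-a) := by positivity
  have hinj : Set.InjOn x (Finset.range (d+1) : Finset ℕ) := by
    intro i hi j hj hij
    simp only [Finset.coe_range, Set.mem_Iio] at hi hj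
    rcases lt_trichotomy i j with hl | hl | hl
    · have := hx2 i j hl (by omega); linarith
    · exact hl
    · have := hx2 j i hl (by omega); linarith
  have hdeg : p.degree < (Finset.range (d+1)).card := by
    rw [Finset.card_range]
    exact lt_of_le_of_lt Polynomial.degree_le_natDegree (by exact_mod_cast Nat.lt_succ_of_le hp)
  have heq := Lagrange.eq_interpolate hinj hdeg
  have hev : p.eval y = ∑ i ∈ Finset.range (d+1), p.eval (x i) *
      ∏ j ∈ (Finset.range (d+1)).erase i, ((x i - x j)⁻¹ * (y - x j)) := by
    conv_lhs => rw [heq]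
    rw [Lagrange.interpolate_apply, Polynomial.eval_finsetSum]
    refine Finset.sum_congr rfl fun i hi => ?_
    rw [Polynomial.eval_mul, Polynomial.eval_C, Lagrange.basis, Polynomial.eval_prod]
    congr 1
    refine Finset.prod_congr rfl fun j hj => ?_
    simp [Lagrange.basisDivisor]
  have hfac : ∀ i ∈ Finset.range (d+1), ∀ j ∈ (Finset.range (d+1)).erase i,
      |(x i - x j)⁻¹ * (y - x j)| ≤ ω⁻¹ := by
    intro i hi j hj
    rw [Finset.mem_erase, Finset.mem_range] at hj
    rw [Finset.mem_range] at hi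
    have h1 : ω * (b-a) ≤ |x i - x j| := by
      rcases lt_or_gt_of_ne hj.1 with hl | hl
      · have := hx2 j i hl (by omega)
        exact le_trans (by linarith) (le_abs_self _)
      · have := hx2 i j hl (by omega)
        exact le_trans (by linarith) (neg_le_abs _)
    have h2 : |y - x j| ≤ b - a := by
      have := (hx1 j (by omega)).1
      rw [abs_le]; constructor <;> linarith [this.1, this.2, hy.1, hy.2]
    rw [abs_mul, abs_inv]
    calc |x i - x j|⁻¹ * |y - x j| ≤ (ω * (b-a))⁻¹ * (b-a) := by gcongr
      _ = ω⁻¹ := by field_simp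
  have : |p.eval y| ≤ ∑ i ∈ Finset.range (d+1), ε * (ω⁻¹)^d := by
    rw [hev]
    refine (Finset.abs_sum_le_sum_abs _ _).trans (Finset.sum_le_sum fun i hi => ?_)
    rw [abs_mul, Finset.abs_prod]
    refine mul_le_mul (hx1 i (by simpa [Nat.lt_succ_iff] using hi)).2.le ?_ (by positivity) hε
    refine (Finset.prod_le_prod (fun _ _ => abs_nonneg _) (hfac i hi)).trans ?_
    rw [Finset.prod_const, Finset.card_erase_of_mem hi, Finset.card_range]; simp
  rw [Finset.sum_const, Finset.card_range, nsmul_eq_mul] at this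
  have h5 : |p.eval y| * ω^d ≤ (d+1) * ε := by
    calc _ ≤ (((d+1:ℕ):ℝ) * (ε * (ω⁻¹)^d)) * ω^d := by gcongr
      _ = _ := by rw [inv_pow]; push_cast; field_simp
  have h6 : ρ * ω^d ≤ |p.eval y| * ω^d := by gcongr
  linarith

end BB

namespace BB

lemma bisect (B : Set ℝ) (Stop : ℝ → ℝ → Prop) (C : ℝ) (hC : 0 ≤ C)
    (h1 : ∀ a b, a < b → ¬ Stop a b →
      (Stop a ((a+b)/2) → volume (B ∩ Set.Ico a ((a+b)/2)) ≤ ENNReal.ofReal (C * ((a+b)/2 - a))) ∧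
      (Stop ((a+b)/2) b → volume (B ∩ Set.Ico ((a+b)/2) b) ≤ ENNReal.ofReal (C * (b - (a+b)/2))))
    (a b : ℝ) (hab : a < b) (hs : ¬ Stop a b)
    (h2 : ∀ x ∈ B, ∃ δ : ℝ, 0 < δ ∧ ∀ a b, x ∈ Set.Ico a b → b - a < δ → Stop a b) :
    volume (B ∩ Set.Ico a b) ≤ ENNReal.ofReal (C * (b - a)) := by
  let Bd : ℝ → Set ℝ := fun δ => {x ∈ B | ∀ a b, x ∈ Set.Ico a b → b - a < δ → Stop a b}
  have key : ∀ δ : ℝ, 0 < δ → ∀ m : ℕ, ∀ a b, a < b → ¬ Stop a b → b - a < 2^m * δ →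
      volume (Bd δ ∩ Set.Ico a b) ≤ ENNReal.ofReal (C * (b - a)) := by
    intro δ hδ m
    induction m with
    | zero =>
      intro a b hab hs hl
      have : Bd δ ∩ Set.Ico a b = ∅ := by
        rw [Set.eq_empty_iff_forall_notMem]
        rintro x ⟨hx, hx2⟩
        exact hs (hx.2 a b hx2 (by simpa using hl))
      rw [this]; simp
    | succ m ih =>
      intro a b hab hs hl
      have hc1 : a < (a+b)/2 := by linarith
      have hc2 : (a+b)/2 < b := by linarith
      rw [pow_succ] at hl
      have hsub : Bd δ ⊆ B := fun x hx => hx.1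
      have e1 : volume (Bd δ ∩ Set.Ico a ((a+b)/2)) ≤ ENNReal.ofReal (C * ((a+b)/2 - a)) := by
        by_cases hst : Stop a ((a+b)/2)
        · exact (measure_mono (Set.inter_subset_inter_left _ hsub)).trans ((h1 a b hab hs).1 hst)
        · exact ih _ _ hc1 hst (by linarith)
      have e2 : volume (Bd δ ∩ Set.Ico ((a+b)/2) b) ≤ ENNReal.ofReal (C * (b - (a+b)/2)) := by
        by_cases hst : Stop ((a+b)/2) b
        · exact (measure_mono (Set.inter_subset_inter_left _ hsub)).trans ((h1 a b hab hs).2 hst)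
        · exact ih _ _ hc2 hst (by linarith)
      rw [← Set.Ico_union_Ico_eq_Ico hc1.le hc2.le, Set.inter_union_distrib_left]
      refine (measure_union_le _ _).trans ((add_le_add e1 e2).trans ?_)
      rw [← ENNReal.ofReal_add (by apply mul_nonneg hC; linarith) (by apply mul_nonneg hC; linarith)]
      apply ENNReal.ofReal_le_ofReal
      linarith
  have hun : B ∩ Set.Ico a b = ⋃ k : ℕ, (Bd (1/(k+1:ℝ)) ∩ Set.Ico a b) := by
    ext x
    simp only [Set.mem_inter_iff, Set.mem_iUnion]
    constructor
    · rintro ⟨hx, hx2⟩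
      obtain ⟨δ, hδ, h⟩ := h2 x hx
      obtain ⟨k, hk⟩ := exists_nat_one_div_lt hδ
      exact ⟨k, ⟨hx, fun a b h3 h4 => h a b h3 (h4.trans hk)⟩, hx2⟩
    · rintro ⟨k, hx, hx2⟩
      exact ⟨hx.1, hx2⟩
  rw [hun]
  have hmono : Monotone (fun k : ℕ => Bd (1/(k+1:ℝ)) ∩ Set.Ico a b) := by
    intro i j hij x hx
    refine ⟨⟨hx.1.1, fun a b h3 h4 => hx.1.2 a b h3 (h4.trans_le ?_)⟩, hx.2⟩
    apply one_div_le_one_div_of_le (by positivity)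
    have : (i:ℝ) ≤ j := by exact_mod_cast hij
    linarith
  rw [hmono.measure_iUnion]
  refine iSup_le fun k => ?_
  have hδ : (0:ℝ) < 1/(k+1:ℝ) := by positivity
  obtain ⟨m, hm⟩ := pow_unbounded_of_one_lt ((b-a)/(1/(k+1:ℝ))) (one_lt_two)
  exact key _ hδ m a b hab hs (by rwa [div_lt_iff₀ hδ] at hm)

lemma chain_card {N : ℕ} (F : Finset (Submodule ℝ (Fin N → ℝ))) (h0 : ∀ V ∈ F, V ≠ ⊥)
    (hc : IsChain (· ≤ ·) (F : Set (Submodule ℝ (Fin N → ℝ)))) : F.card ≤ N := by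
  have h : F.card ≤ (Finset.Icc 1 N).card := by
    apply Finset.card_le_card_of_injOn (fun V : Submodule ℝ (Fin N → ℝ) => Module.finrank ℝ V)
    · intro V hV
      simp only [Finset.coe_Icc, Set.mem_Icc]
      refine ⟨?_, ?_⟩
      · rw [Nat.one_le_iff_ne_zero]
        intro h
        exact h0 V hV (Submodule.finrank_eq_zero.1 h)
      · simpa using Submodule.finrank_le V
    · intro V hV W hW h
      rcases hc.total hV hW with h3 | h3
      · exact Submodule.eq_of_le_of_finrank_eq h3 h
      · exact (Submodule.eq_of_le_of_finrank_eq h3 h.symm).symm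
  simpa using h

def Adbl (d : ℕ) : ℝ := 2 * (d+1) * (4*(d+1))^d

lemma one_le_Adbl (d : ℕ) : 1 ≤ Adbl d := by
  unfold Adbl
  have : (1:ℝ) ≤ (4*(d+1))^d := one_le_pow₀ (by linarith [(Nat.cast_nonneg d : (0:ℝ) ≤ d)])
  nlinarith [(Nat.cast_nonneg d : (0:ℝ) ≤ d)]

open Classical in
lemma qnd_abs {N : ℕ} (d : ℕ) (hd : 1 ≤ d) (K0 : ℝ) (hK0 : 1 ≤ K0)
    (Rat : Submodule ℝ (Fin N → ℝ) → Prop) (ψ : Submodule ℝ (Fin N → ℝ) → ℝ → ℝ)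
    (φ : (Fin N → ℤ) → ℝ → ℝ) (hφ : ∀ v x, 0 ≤ φ v x)
    (hcont : ∀ V, Rat V → Continuous (ψ V))
    (hrem : ∀ V, Rat V → ∀ a b y ρ ε ω, y ∈ Set.Ico a b → ρ ≤ ψ V y → 0 < ω → 0 ≤ ε →
      (d+1) * ε < ρ * ω^d →
      volume {x ∈ Set.Ico a b | ψ V x < ε} ≤ ENNReal.ofReal (d * ω * (b-a)))
    (hbot : Rat ⊥) (hbot1 : ∀ x, ψ ⊥ x = 1)
    (hstep : ∀ V, Rat V → ∀ v : Fin N → ℤ, (fun i => (v i : ℝ)) ∉ V →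
      Rat (V ⊔ Submodule.span ℝ {fun i => (v i : ℝ)}) ∧
      ∀ x, ψ (V ⊔ Submodule.span ℝ {fun i => (v i : ℝ)}) x ≤ K0 * ψ V x * φ v x)
    (ε ω : ℝ) (hε : 0 < ε) (hω : 0 < ω) (hω1 : ω ≤ 1) (k : ℕ) :
    ∀ F : Finset (Submodule ℝ (Fin N → ℝ)), (∀ V ∈ F, V ≠ ⊥ ∧ Rat V) →
      IsChain (· ≤ ·) (F : Set (Submodule ℝ (Fin N → ℝ))) → N < F.card + k →
      ∀ a b ρ, a < b → 0 < ρ → ρ ≤ 1 → (d+1) * (K0 * ε) * Adbl d ^ k < ρ * ω^d →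
      (∀ V, V ≠ ⊥ → Rat V → V ∉ F →
        IsChain (· ≤ ·) ((insert V F : Finset _) : Set (Submodule ℝ (Fin N → ℝ))) →
        ∃ x ∈ Set.Ico a b, ρ ≤ ψ V x) →
      volume {x ∈ Set.Ico a b | (∃ v : Fin N → ℤ, v ≠ 0 ∧ φ v x < ε) ∧
        ∀ V ∈ F, K0 * ε ≤ ψ V x ∧ ψ V x ≤ 1} ≤ ENNReal.ofReal (k * (d * ω) * (b-a)) := by
  induction k with
  | zero =>
    intro F hF hc hN
    exact absurd (chain_card F (fun V hV => (hF V hV).1) hc) (by omega)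
  | succ k ih =>
    intro F hF hc hN a b ρ hab hρ hρ1 hsmall hsup
    have hA := one_le_Adbl d
    have hd0 : (0:ℝ) ≤ d := Nat.cast_nonneg d
    have hK0ε : 0 < K0 * ε := by positivity
    set Bad : Set ℝ := {x | (∃ v : Fin N → ℤ, v ≠ 0 ∧ φ v x < ε) ∧
        ∀ V ∈ F, K0 * ε ≤ ψ V x ∧ ψ V x ≤ 1} with hBad
    let Stop : ℝ → ℝ → Prop := fun a b => ∃ V, V ≠ ⊥ ∧ Rat V ∧ V ∉ F ∧
        IsChain (· ≤ ·) ((insert V F : Finset _) : Set (Submodule ℝ (Fin N → ℝ))) ∧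
        ∀ x ∈ Set.Ico a b, ψ V x < ρ
    have hset : {x ∈ Set.Ico a b | (∃ v : Fin N → ℤ, v ≠ 0 ∧ φ v x < ε) ∧
        ∀ V ∈ F, K0 * ε ≤ ψ V x ∧ ψ V x ≤ 1} = Bad ∩ Set.Ico a b := by
      ext x; simp only [hBad, Set.mem_ofPred_eq, Set.mem_inter_iff]; tauto
    rw [hset]
    have hs : ¬ Stop a b := by
      rintro ⟨V, h1, h2, h3, h4, h5⟩
      obtain ⟨x, hx, hx2⟩ := hsup V h1 h2 h3 h4
      linarith [h5 x hx]
    have hAk : 1 ≤ Adbl d ^ k := one_le_pow₀ hA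
    have hAk1 : 1 ≤ Adbl d ^ (k+1) := one_le_pow₀ hA
    have hωd : ω ^ d ≤ 1 := pow_le_one₀ hω.le hω1
    have hερ : K0 * ε < ρ := by
      have h1 : K0 * ε ≤ (d+1) * (K0 * ε) * Adbl d ^ (k+1) := by
        calc K0 * ε = 1 * (K0*ε) * 1 := by ring
          _ ≤ _ := by gcongr; linarith
      have h2 : ρ * ω^d ≤ ρ := by nlinarith
      linarith
    have hsmall' : (d+1) * (K0 * ε) * Adbl d ^ k < (ρ / Adbl d) * ω^d := by
      rw [pow_succ] at hsmall
      rw [div_mul_eq_mul_div, lt_div_iff₀ (by linarith)]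
      linarith
    -- half of a non-stopped interval
    have half : ∀ a b, a < b → ¬ Stop a b → ∀ a' b', a ≤ a' → b' ≤ b → b' - a' = (b-a)/2 →
        Stop a' b' → volume (Bad ∩ Set.Ico a' b') ≤
          ENNReal.ofReal ((((k+1:ℕ):ℝ) * (d * ω)) * (b' - a')) := by
      intro a b hab hns a' b' ha' hb' hlen hst
      have hab' : a' < b' := by linarith
      have dbl : ∀ V, V ≠ ⊥ → Rat V → V ∉ F →
          IsChain (· ≤ ·) ((insert V F : Finset _) : Set (Submodule ℝ (Fin N → ℝ))) →
          ∃ x ∈ Set.Ico a' b', ρ / Adbl d ≤ ψ V x := by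
        intro V h1 h2 h3 h4
        by_contra hcon
        push Not at hcon
        obtain ⟨y, hy, hy2⟩ : ∃ y ∈ Set.Ico a b, ρ ≤ ψ V y := by
          by_contra hc2
          push Not at hc2
          exact hns ⟨V, h1, h2, h3, h4, hc2⟩
        have hr := hrem V h2 a b y ρ (ρ / Adbl d) (1/(4*(d+1))) hy hy2 (by positivity)
          (by positivity) (by
            have hq : Adbl d * (1/(4*((d:ℝ)+1)))^d = 2 * (d+1) := by
              unfold Adbl; rw [mul_assoc, ← mul_pow, mul_one_div_cancel (by positivity)]; simp
            rw [mul_div_assoc', div_lt_iff₀ (by linarith), mul_assoc ρ, mul_comm _ (Adbl d), hq]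
            nlinarith)
        have hsub : Set.Ico a' b' ⊆ {x ∈ Set.Ico a b | ψ V x < ρ / Adbl d} :=
          fun x hx => ⟨⟨ha'.trans hx.1, hx.2.trans_le hb'⟩, hcon x hx⟩
        have hm := (measure_mono hsub).trans hr
        rw [Real.volume_Ico, hlen, ENNReal.ofReal_le_ofReal_iff (by
          apply mul_nonneg (by positivity); linarith)] at hm
        have : (d:ℝ) * (1/(4*(d+1))) ≤ 1/4 := by
          rw [mul_one_div, div_le_div_iff₀ (by positivity) (by positivity)]; linarith
        nlinarith
      obtain ⟨V, h1, h2, h3, h4, h5⟩ := hst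
      have hcov : Bad ∩ Set.Ico a' b' ⊆ {x ∈ Set.Ico a' b' | ψ V x < K0 * ε} ∪
          {x ∈ Set.Ico a' b' | (∃ v : Fin N → ℤ, v ≠ 0 ∧ φ v x < ε) ∧
            ∀ W ∈ insert V F, K0 * ε ≤ ψ W x ∧ ψ W x ≤ 1} := by
        rintro x ⟨hx, hx2⟩
        by_cases hlt : ψ V x < K0 * ε
        · exact Or.inl ⟨hx2, hlt⟩
        · refine Or.inr ⟨hx2, hx.1, fun W hW => ?_⟩
          rcases Finset.mem_insert.1 hW with rfl | hW
          · exact ⟨not_lt.1 hlt, (h5 x hx2).le.trans hρ1⟩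
          · exact hx.2 W hW
      obtain ⟨y, hy, hy2⟩ := dbl V h1 h2 h3 h4
      have e1 := hrem V h2 a' b' y (ρ / Adbl d) (K0*ε) ω hy hy2 hω hK0ε.le (by
        refine lt_of_le_of_lt ?_ hsmall'
        exact le_mul_of_one_le_right (by positivity) hAk)
      have e2 := ih (insert V F) (by
          intro W hW
          rcases Finset.mem_insert.1 hW with rfl | hW
          · exact ⟨h1, h2⟩
          · exact hF W hW) h4 (by rw [Finset.card_insert_of_notMem h3]; omega) a' b' (ρ / Adbl d) hab'
          (by positivity) ((div_le_self hρ.le hA).trans hρ1) hsmall' (by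
            intro W hW1 hW2 hW3 hW4
            refine dbl W hW1 hW2 (fun h => hW3 (Finset.mem_insert_of_mem h)) (hW4.mono ?_)
            intro z hz
            simp only [Finset.coe_insert, Set.mem_insert_iff, Finset.mem_coe] at hz ⊢
            tauto)
      refine (measure_mono hcov).trans ((measure_union_le _ _).trans ((add_le_add e1 e2).trans ?_))
      rw [← ENNReal.ofReal_add (by apply mul_nonneg (by positivity); linarith)
        (by apply mul_nonneg (by positivity); linarith)]
      apply ENNReal.ofReal_le_ofReal
      push_cast
      linarith
    refine bisect Bad Stop _ (by positivity) ?_ a b hab hs ?_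
    · intro a b hab hns
      refine ⟨half a b hab hns _ _ le_rfl (by linarith) (by ring),
        half a b hab hns _ _ (by linarith) le_rfl (by ring)⟩
    · rintro x ⟨⟨v, hv0, hv⟩, hxF⟩
      -- largest element not containing v
      have hv0' : (fun i => (v i : ℝ)) ∉ (⊥ : Submodule ℝ (Fin N → ℝ)) := by
        intro h
        apply hv0
        have := (Submodule.mem_bot ℝ).1 h
        ext i
        have := congrFun this i
        simpa using this
      let G := (insert ⊥ F).filter (fun W => (fun i => (v i : ℝ)) ∉ W)
      have hGne : G.Nonempty := ⟨⊥, by simp [G, -Submodule.mem_bot]; exact hv0'⟩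
      obtain ⟨W, hWG, hWmax⟩ := G.exists_max_image (fun W => Module.finrank ℝ W) hGne
      have hWG' := (Finset.mem_filter.1 hWG)
      have hWrat : Rat W := by
        rcases Finset.mem_insert.1 hWG'.1 with h | h
        · rw [h]; exact hbot
        · exact (hF W h).2
      have hWle : ψ W x ≤ 1 := by
        rcases Finset.mem_insert.1 hWG'.1 with h | h
        · rw [h, hbot1]
        · exact (hxF W h).2
      obtain ⟨hr1, hr2⟩ := hstep W hWrat v hWG'.2
      set V := W ⊔ Submodule.span ℝ {fun i => (v i : ℝ)} with hV
      have hvV : (fun i => (v i : ℝ)) ∈ V :=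
        Submodule.mem_sup_right (Submodule.mem_span_singleton_self _)
      have hψV : ψ V x < K0 * ε := by
        refine (hr2 x).trans_lt ?_
        have : K0 * ψ W x * φ v x ≤ K0 * 1 * φ v x :=
          mul_le_mul_of_nonneg_right (mul_le_mul_of_nonneg_left hWle (by linarith)) (hφ v x)
        refine this.trans_lt ?_
        rw [mul_one]
        exact mul_lt_mul_of_pos_left hv (by linarith)
      have hVF : V ∉ F := fun h => by linarith [(hxF V h).1]
      have hVbot : V ≠ ⊥ := fun h => hv0' (h ▸ hvV)
      have hch : IsChain (· ≤ ·) ((insert V F : Finset _) : Set (Submodule ℝ (Fin N → ℝ))) := by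
        rw [Finset.coe_insert]
        refine hc.insert fun Z hZ _ => ?_
        by_cases hZv : (fun i => (v i : ℝ)) ∈ Z
        · left
          refine sup_le ?_ ((Submodule.span_singleton_le_iff_mem _ _).2 hZv)
          rcases Finset.mem_insert.1 hWG'.1 with h | h
          · rw [h]; exact bot_le
          · rcases hc.total h hZ with h' | h'
            · exact h'
            · exact absurd (h' hZv) hWG'.2
        · right
          have hZG : Z ∈ G := Finset.mem_filter.2 ⟨Finset.mem_insert_of_mem hZ, hZv⟩
          have hdim := hWmax Z hZG
          refine le_trans ?_ le_sup_left
          rcases Finset.mem_insert.1 hWG'.1 with h | h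
          · rw [h] at hdim
            simp only [finrank_bot, nonpos_iff_eq_zero] at hdim
            rw [Submodule.finrank_eq_zero.1 hdim]; exact bot_le
          · rcases hc.total hZ h with h' | h'
            · exact h'
            · exact (Submodule.eq_of_le_of_finrank_le h' hdim).ge
      have hcontV := (hcont V hr1).continuousAt (x := x)
      have hev : ∀ᶠ z in nhds x, ψ V z < ρ := hcontV.eventually_lt_const (hψV.trans hερ)
      obtain ⟨δ, hδ, hball⟩ := Metric.eventually_nhds_iff.1 hev
      refine ⟨δ, hδ, fun a b hx hl => ⟨V, hVbot, hr1, hVF, hch, fun z hz => hball ?_⟩⟩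
      rw [Real.dist_eq, abs_lt]
      constructor <;> linarith [hx.1, hx.2, hz.1, hz.2]

end BB

namespace BB

/-- maximal absolute value of the maximal minors -/
noncomputable def mn {N r : ℕ} (A : Matrix (Fin N) (Fin r) ℝ) : ℝ :=
  ‖fun f : Fin r → Fin N => (A.submatrix f id).det‖

lemma mn_nonneg {N r : ℕ} (A : Matrix (Fin N) (Fin r) ℝ) : 0 ≤ mn A := norm_nonneg _

lemma abs_det_le_mn {N r : ℕ} (A : Matrix (Fin N) (Fin r) ℝ) (f : Fin r → Fin N) :
    |(A.submatrix f id).det| ≤ mn A :=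
  norm_le_pi_norm (fun f : Fin r → Fin N => (A.submatrix f id).det) f

lemma mn_le {N r : ℕ} (A : Matrix (Fin N) (Fin r) ℝ) (c : ℝ) (hc : 0 ≤ c)
    (h : ∀ f : Fin r → Fin N, |(A.submatrix f id).det| ≤ c) : mn A ≤ c :=
  (pi_norm_le_iff_of_nonneg hc).2 h

lemma mn_lt_iff {N r : ℕ} (A : Matrix (Fin N) (Fin r) ℝ) (c : ℝ) (hc : 0 < c) :
    mn A < c ↔ ∀ f : Fin r → Fin N, |(A.submatrix f id).det| < c :=
  pi_norm_lt_iff hc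

lemma mn_mul {N r : ℕ} (A : Matrix (Fin N) (Fin r) ℝ) (C : Matrix (Fin r) (Fin r) ℝ) :
    mn (A * C) = mn A * |C.det| := by
  have : (fun f : Fin r → Fin N => ((A * C).submatrix f id).det)
      = C.det • (fun f : Fin r → Fin N => (A.submatrix f id).det) := by
    ext f
    have : (A * C).submatrix f id = A.submatrix f id * C := by
      ext i j; simp [Matrix.mul_apply]
    rw [this, Matrix.det_mul, Pi.smul_apply, smul_eq_mul, mul_comm]
  rw [mn, this, norm_smul, mul_comm]; rfl

lemma det_mul_expand {N r M : ℕ} (B : Matrix (Fin M) (Fin N) ℝ) (A : Matrix (Fin N) (Fin r) ℝ)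
    (f : Fin r → Fin M) : ((B * A).submatrix f id).det =
      ∑ g : Fin r → Fin N, (∏ i, B (f i) (g i)) * (A.submatrix g id).det := by
  have h1 : (B * A).submatrix f id = (fun i : Fin r => ∑ k : Fin N, B (f i) k • A k) := by
    ext i j; simp [Matrix.mul_apply, Finset.sum_apply]
  have h2 := (Matrix.detRowAlternating (R := ℝ) (n := Fin r)).toMultilinearMap.map_sum
    (fun (i : Fin r) (k : Fin N) => B (f i) k • A k)
  rw [h1]
  refine h2.trans (Finset.sum_congr rfl fun g _ => ?_)
  exact (Matrix.detRowAlternating (R := ℝ) (n := Fin r)).toMultilinearMap.map_smul_univ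
    (fun i => B (f i) (g i)) (fun i => A (g i))

lemma mn_mul_le {N r M : ℕ} (B : Matrix (Fin M) (Fin N) ℝ) (A : Matrix (Fin N) (Fin r) ℝ)
    (b : ℝ) (hb : 0 ≤ b) (hB : ∀ i j, |B i j| ≤ b) : mn (B * A) ≤ (N * b)^r * mn A := by
  refine mn_le _ _ (mul_nonneg (by positivity) (mn_nonneg _)) fun f => ?_
  rw [det_mul_expand]
  refine (Finset.abs_sum_le_sum_abs _ _).trans ?_
  calc _ ≤ ∑ g : Fin r → Fin N, b^r * mn A := by
        refine Finset.sum_le_sum fun g _ => ?_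
        rw [abs_mul, Finset.abs_prod]
        refine mul_le_mul ?_ (abs_det_le_mn _ _) (abs_nonneg _) (by positivity)
        refine (Finset.prod_le_prod (fun _ _ => abs_nonneg _) (fun i _ => hB _ _)).trans ?_
        simp
    _ = _ := by
        rw [Finset.sum_const, Finset.card_univ, nsmul_eq_mul]
        simp; ring

lemma det_diag_mul {N r : ℕ} (b : Fin N → ℝ) (A : Matrix (Fin N) (Fin r) ℝ)
    (f : Fin r → Fin N) : ((Matrix.diagonal b * A).submatrix f id).det =
      (∏ i, b (f i)) * (A.submatrix f id).det := by
  have : (Matrix.diagonal b * A).submatrix f id = Matrix.diagonal (b ∘ f) * A.submatrix f id := by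
    ext i j; simp [Matrix.diagonal_mul]
  rw [this, Matrix.det_mul, Matrix.det_diagonal]; rfl

lemma det_submatrix_eq_zero {N r : ℕ} (A : Matrix (Fin N) (Fin r) ℝ) (f : Fin r → Fin N)
    (hf : ¬ Function.Injective f) : (A.submatrix f id).det = 0 := by
  simp only [Function.Injective, not_forall] at hf
  obtain ⟨i, j, h, hij⟩ := hf
  exact Matrix.det_zero_of_row_eq hij (by ext k; simp [h])

/-- prepend a column -/
def consCol {N r : ℕ} {R : Type*} (v : Fin N → R) (A : Matrix (Fin N) (Fin r) R) :
    Matrix (Fin N) (Fin (r+1)) R := Matrix.of fun i => Fin.cons (v i) (A i)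

lemma mul_consCol {N M r : ℕ} (H : Matrix (Fin M) (Fin N) ℝ) (v : Fin N → ℝ)
    (A : Matrix (Fin N) (Fin r) ℝ) : H * consCol v A = consCol (H.mulVec v) (H * A) := by
  ext i j
  refine Fin.cases ?_ (fun j => ?_) j
  · simp [consCol, Matrix.mul_apply, Matrix.mulVec, dotProduct]
  · simp [consCol, Matrix.mul_apply]

lemma consCol_mulVec {N r : ℕ} (v : Fin N → ℝ) (A : Matrix (Fin N) (Fin r) ℝ)
    (c : Fin (r+1) → ℝ) :
    (consCol v A).mulVec c = c 0 • v + A.mulVec (fun i => c i.succ) := by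
  ext i
  simp [consCol, Matrix.mulVec, dotProduct, Fin.sum_univ_succ, mul_comm]

lemma mn_consCol {N r : ℕ} (v : Fin N → ℝ) (A : Matrix (Fin N) (Fin r) ℝ) :
    mn (consCol v A) ≤ (r+1) * mn A * ‖v‖ := by
  refine mn_le _ _ (mul_nonneg (mul_nonneg (by positivity) (mn_nonneg _)) (norm_nonneg _)) fun f => ?_
  rw [Matrix.det_succ_column_zero]
  refine (Finset.abs_sum_le_sum_abs _ _).trans ?_
  calc _ ≤ ∑ i : Fin (r+1), ‖v‖ * mn A := by
        refine Finset.sum_le_sum fun i _ => ?_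
        rw [abs_mul, abs_mul, abs_pow, abs_neg, abs_one, one_pow, one_mul]
        refine mul_le_mul ?_ ?_ (abs_nonneg _) (norm_nonneg _)
        · simpa [consCol] using norm_le_pi_norm v (f i)
        · have : ((consCol v A).submatrix f id).submatrix i.succAbove Fin.succ
              = A.submatrix (fun k => f (i.succAbove k)) id := by
            ext k j; simp [consCol]
          rw [this]; exact abs_det_le_mn _ _
    _ = _ := by simp; ring

lemma exists_left_inv {N r : ℕ} (A : Matrix (Fin N) (Fin r) ℝ) (hA : Function.Injective A.mulVec) :
    ∃ B : Matrix (Fin r) (Fin N) ℝ, B * A = 1 := by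
  have hk : LinearMap.ker A.mulVecLin = ⊥ := LinearMap.ker_eq_bot.2 hA
  obtain ⟨g, hg⟩ := LinearMap.exists_leftInverse_of_injective _ hk
  refine ⟨LinearMap.toMatrix' g, ?_⟩
  have := congrArg LinearMap.toMatrix' hg
  rw [LinearMap.toMatrix'_comp, LinearMap.toMatrix'_id] at this
  convert this
  rw [← Matrix.toLin'_apply', LinearMap.toMatrix'_toLin']

lemma mn_pos {N r : ℕ} (A : Matrix (Fin N) (Fin r) ℝ) (hA : Function.Injective A.mulVec) :
    0 < mn A := by
  obtain ⟨B, hB⟩ := exists_left_inv A hA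
  by_contra h
  have h0 : mn A = 0 := le_antisymm (not_lt.1 h) (mn_nonneg _)
  have h1 := det_mul_expand B A id
  rw [hB] at h1
  simp only [Matrix.submatrix_id_id, Matrix.det_one] at h1
  rw [Finset.sum_eq_zero] at h1
  · exact one_ne_zero h1
  · intro g _
    have := abs_det_le_mn A g
    rw [h0] at this
    rw [abs_eq_zero.1 (le_antisymm this (abs_nonneg _)), mul_zero]

lemma exists_mn_eq {N r : ℕ} (A : Matrix (Fin N) (Fin r) ℝ) (hA : 0 < mn A) :
    ∃ f : Fin r → Fin N, |(A.submatrix f id).det| = mn A := by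
  by_contra hcon
  push Not at hcon
  exact lt_irrefl _ ((mn_lt_iff A _ hA).2 fun f => lt_of_le_of_ne (abs_det_le_mn A f) (hcon f))

/-- integer matrix as a real matrix -/
abbrev rl {N r : ℕ} (E : Matrix (Fin N) (Fin r) ℤ) : Matrix (Fin N) (Fin r) ℝ :=
  E.map (Int.cast : ℤ → ℝ)

abbrev vr {N : ℕ} (v : Fin N → ℤ) : Fin N → ℝ := fun i => (v i : ℝ)

lemma one_le_mn {N r : ℕ} (E : Matrix (Fin N) (Fin r) ℤ) (hE : Function.Injective (rl E).mulVec) :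
    1 ≤ mn (rl E) := by
  obtain ⟨f, hf⟩ := exists_mn_eq _ (mn_pos _ hE)
  have h1 : ((rl E).submatrix f id).det = (((E.submatrix f id).det : ℤ) : ℝ) := by
    rw [Int.cast_det]; rfl
  have h2 : (E.submatrix f id).det ≠ 0 := by
    intro h
    have := mn_pos _ hE
    rw [← hf, h1, h] at this; simp at this
  rw [← hf, h1]
  exact_mod_cast Int.one_le_abs h2

lemma mn_comp {N r M : ℕ} (H : Matrix (Fin M) (Fin N) ℝ) (E E' : Matrix (Fin N) (Fin r) ℝ)
    (hE' : Function.Injective E'.mulVec)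
    (hR : LinearMap.range E.mulVecLin = LinearMap.range E'.mulVecLin)
    (h2 : mn E ≤ 2 * mn E') : mn (H * E) ≤ 2 * mn (H * E') := by
  have hC : ∃ C : Matrix (Fin r) (Fin r) ℝ, E' = E * C := by
    have : ∀ j : Fin r, ∃ c : Fin r → ℝ, E.mulVec c = E'.mulVec (Pi.single j 1) := by
      intro j
      have : E'.mulVecLin (Pi.single j 1) ∈ LinearMap.range E.mulVecLin := by
        rw [hR]; exact LinearMap.mem_range_self _ _
      obtain ⟨c, hc⟩ := this
      exact ⟨c, hc⟩
    choose c hc using this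
    refine ⟨Matrix.of fun i j => c j i, ?_⟩
    ext i j
    have := congrFun (hc j) i
    rw [Matrix.mulVec_single_one] at this
    simp only [Matrix.col_apply] at this
    rw [← this]
    simp [Matrix.mul_apply, Matrix.mulVec, dotProduct]
  obtain ⟨C, rfl⟩ := hC
  have hpos := mn_pos _ hE'
  rw [← Matrix.mul_assoc, mn_mul]
  rw [mn_mul] at hpos h2
  have hE : 0 < mn E := pos_of_mul_pos_left hpos (abs_nonneg _)
  have : 1 ≤ 2 * |C.det| := by
    by_contra hcon
    push Not at hcon
    nlinarith
  nlinarith [mn_nonneg (H * E)]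

end BB

namespace BB

def Rep {N : ℕ} (V : Submodule ℝ (Fin N → ℝ)) (r : ℕ) (E : Matrix (Fin N) (Fin r) ℤ) : Prop :=
  Function.Injective (rl E).mulVec ∧ LinearMap.range (rl E).mulVecLin = V

lemma Rep.finrank {N r : ℕ} {V : Submodule ℝ (Fin N → ℝ)} {E : Matrix (Fin N) (Fin r) ℤ}
    (h : Rep V r E) : Module.finrank ℝ V = r := by
  rw [← h.2, LinearMap.finrank_range_of_inj h.1]; simp

lemma Rep.le {N r : ℕ} {V : Submodule ℝ (Fin N → ℝ)} {E : Matrix (Fin N) (Fin r) ℤ}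
    (h : Rep V r E) : r ≤ N := by
  rw [← h.finrank]; simpa using Submodule.finrank_le V

lemma exists_best {N : ℕ} (V : Submodule ℝ (Fin N → ℝ)) (h : ∃ r E, Rep V r E) :
    ∃ r E, Rep V r E ∧ ∀ r' E', Rep V r' E' → mn (rl E) ≤ 2 * mn (rl E') := by
  let S : Set ℝ := {y | ∃ r E, Rep V r E ∧ y = mn (rl E)}
  have hne : S.Nonempty := by
    obtain ⟨r, E, hE⟩ := h
    exact ⟨_, r, E, hE, rfl⟩
  have hlb : ∀ y ∈ S, 1 ≤ y := by
    rintro y ⟨r, E, hE, rfl⟩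
    exact one_le_mn E hE.1
  have h1 : 1 ≤ sInf S := le_csInf hne hlb
  obtain ⟨y, ⟨r, E, hE, rfl⟩, hy⟩ := exists_lt_of_csInf_lt hne (show sInf S < 2 * sInf S by linarith)
  refine ⟨r, E, hE, fun r' E' hE' => ?_⟩
  have : sInf S ≤ mn (rl E') := csInf_le ⟨1, hlb⟩ ⟨r', E', hE', rfl⟩
  linarith

lemma natDegree_det_le {r d : ℕ} (A : Matrix (Fin r) (Fin r) (Polynomial ℝ))
    (h : ∀ i j, (A i j).natDegree ≤ d) : A.det.natDegree ≤ r * d := by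
  rw [Matrix.det_apply]
  refine Polynomial.natDegree_sum_le_of_forall_le _ _ fun σ _ => ?_
  refine (Polynomial.natDegree_smul_le _ _).trans ?_
  refine (Polynomial.natDegree_prod_le _ _).trans ?_
  refine (Finset.sum_le_sum fun i _ => h _ _).trans ?_
  simp

/-- evaluation of a polynomial matrix -/
noncomputable def ev {N M : ℕ} (Hp : Matrix (Fin N) (Fin M) (Polynomial ℝ)) (x : ℝ) :
    Matrix (Fin N) (Fin M) ℝ := Hp.map (Polynomial.eval x)

lemma minor_poly {N r d0 : ℕ} (Hp : Matrix (Fin N) (Fin N) (Polynomial ℝ))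
    (h : ∀ i j, (Hp i j).natDegree ≤ d0) (E : Matrix (Fin N) (Fin r) ℝ) (f : Fin r → Fin N) :
    ∃ p : Polynomial ℝ, p.natDegree ≤ r * d0 ∧
      ∀ x, p.eval x = ((ev Hp x * E).submatrix f id).det := by
  refine ⟨((Hp * E.map Polynomial.C).submatrix f id).det, ?_, ?_⟩
  · refine natDegree_det_le _ fun i j => ?_
    simp only [Matrix.submatrix_apply, Matrix.mul_apply]
    refine Polynomial.natDegree_sum_le_of_forall_le _ _ fun k _ => ?_
    refine (Polynomial.natDegree_mul_C_le _ _).trans (h _ _)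
  · intro x
    have := RingHom.map_det (Polynomial.evalRingHom x) ((Hp * E.map Polynomial.C).submatrix f id)
    simp only [Polynomial.coe_evalRingHom] at this
    rw [this]
    congr 1
    ext i j
    simp [ev, Matrix.mul_apply, Polynomial.eval_finsetSum]

lemma qnd (N d0 : ℕ) (hN : 1 ≤ N) (hd0 : 1 ≤ d0) : ∃ K : ℝ, 1 ≤ K ∧
    ∀ Hp : Matrix (Fin N) (Fin N) (Polynomial ℝ), (∀ i j, (Hp i j).natDegree ≤ d0) →
    ∀ a b ρ ε ω : ℝ, a < b → 0 < ρ → ρ ≤ 1 → 0 < ε → 0 < ω →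
    (∀ r, 1 ≤ r → ∀ E : Matrix (Fin N) (Fin r) ℤ, Function.Injective (rl E).mulVec →
      ∃ x ∈ Set.Ico a b, ρ ≤ mn (ev Hp x * rl E)) →
    K * ε < ρ * ω ^ (N * d0) →
    volume {x ∈ Set.Ico a b | ∃ v : Fin N → ℤ, v ≠ 0 ∧ ‖(ev Hp x).mulVec (vr v)‖ < ε} ≤
      ENNReal.ofReal (K * ω * (b - a)) := by
  classical
  set d := N * d0 with hd
  have hd1 : 1 ≤ d := Nat.mul_pos hN hd0
  set K0 : ℝ := 2 * (N + 1) with hK0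
  have hK01 : 1 ≤ K0 := by rw [hK0]; linarith [(Nat.cast_nonneg N : (0:ℝ) ≤ N)]
  have hA := one_le_Adbl d
  set K1 : ℝ := (d+1) * K0 * Adbl d ^ (N+1) with hK1
  set K2 : ℝ := ((N+1:ℕ):ℝ) * d with hK2
  have hK1p : 0 ≤ K1 := by positivity
  have hK2p : 0 ≤ K2 := by positivity
  refine ⟨1 + K1 + K2, by linarith, ?_⟩
  intro Hp hHp a b ρ ε ω hab hρ hρ1 hε hω hsup hsmall
  rcases lt_or_ge 1 ω with hω1 | hω1
  · refine (measure_mono (Set.sep_subset _ _)).trans ?_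
    rw [Real.volume_Ico]
    apply ENNReal.ofReal_le_ofReal
    have : 1 ≤ (1 + K1 + K2) * ω := by nlinarith
    nlinarith
  let Rat : Submodule ℝ (Fin N → ℝ) → Prop := fun V => ∃ r E, Rep V r E
  have hbest : ∀ V, Rat V → ∃ r E, Rep V r E ∧ ∀ r' E', Rep V r' E' → mn (rl E) ≤ 2 * mn (rl E') :=
    fun V h => exists_best V h
  choose br bE hb1 hb2 using hbest
  let ψ : Submodule ℝ (Fin N → ℝ) → ℝ → ℝ := fun V x =>
    if h : Rat V then mn (ev Hp x * rl (bE V h)) else 1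
  have hψ : ∀ V (h : Rat V) x, ψ V x = mn (ev Hp x * rl (bE V h)) := fun V h x => by
    simp only [ψ, h, dif_pos]
  let φ : (Fin N → ℤ) → ℝ → ℝ := fun v x => ‖(ev Hp x).mulVec (vr v)‖
  have hbotrep : Rat ⊥ := by
    refine ⟨0, 0, ?_, ?_⟩
    · intro x y _; exact Subsingleton.elim _ _
    · rw [LinearMap.range_eq_bot]; ext x; exact x.elim0
  have main := qnd_abs (N := N) d hd1 K0 hK01 Rat ψ φ (fun v x => norm_nonneg _) ?_ ?_ hbotrep ?_ ?_
    ε ω hε hω hω1 (N+1) ∅ (by simp) (by simp) (by simp) a b ρ hab hρ hρ1 ?_ ?_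
  · refine le_trans (measure_mono ?_) (main.trans ?_)
    · rintro x ⟨hx, h⟩
      exact ⟨hx, h, by simp⟩
    · apply ENNReal.ofReal_le_ofReal
      have : ((N+1:ℕ):ℝ) * (d * ω) = K2 * ω := by rw [hK2]; ring
      rw [this]
      have h3 : K2 * ω ≤ (1 + K1 + K2) * ω := by apply mul_le_mul_of_nonneg_right _ hω.le; linarith
      exact mul_le_mul_of_nonneg_right h3 (by linarith)
  · intro V hV
    have : ψ V = fun x => mn (ev Hp x * rl (bE V hV)) := funext fun x => hψ V hV x
    rw [this]
    unfold mn
    refine Continuous.norm (continuous_pi fun f => ?_)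
    obtain ⟨p, _, hp⟩ := minor_poly Hp hHp (rl (bE V hV)) f
    simp_rw [← hp]
    exact p.continuous
  · intro V hV a b y ρ ε ω hy hρ hω hε h
    have hρ0 : 0 < ρ := by
      have : 0 ≤ (d+1) * ε := by positivity
      exact pos_of_mul_pos_left (this.trans_lt h) (by positivity)
    rw [hψ V hV] at hρ
    obtain ⟨f, hf⟩ := exists_mn_eq _ (hρ0.trans_le hρ)
    obtain ⟨p, hp1, hp⟩ := minor_poly Hp hHp (rl (bE V hV)) f
    have hpd : p.natDegree ≤ d := hp1.trans (Nat.mul_le_mul_right _ (hb1 V hV).le)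
    refine le_trans (measure_mono ?_) (remez d p hpd a b y ρ ε ω hy (by rw [hp, hf]; exact hρ) hω hε h)
    rintro x ⟨hx, hx2⟩
    refine ⟨hx, ?_⟩
    rw [hψ V hV] at hx2
    rw [hp]
    exact (abs_det_le_mn _ f).trans_lt hx2
  · intro x
    rw [hψ ⊥ hbotrep]
    have hr : br ⊥ hbotrep = 0 := by
      rw [← (hb1 ⊥ hbotrep).finrank]; simp
    generalize bE ⊥ hbotrep = E
    revert E
    rw [hr]
    intro E
    unfold mn
    simp only [Matrix.det_fin_zero]
    rw [pi_norm_const]; simp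
  · intro V hV v hv
    set E' : Matrix (Fin N) (Fin (br V hV + 1)) ℤ := consCol v (bE V hV) with hE'
    have hrl : rl E' = consCol (vr v) (rl (bE V hV)) := by
      ext i j
      refine Fin.cases ?_ (fun j => ?_) j
      · simp [hE', consCol]
      · simp [hE', consCol]
    have hrep : Rep (V ⊔ Submodule.span ℝ {vr v}) _ E' := by
      constructor
      · rw [← Matrix.coe_mulVecLin]
        rw [← LinearMap.ker_eq_bot, LinearMap.ker_eq_bot']
        intro c hc
        rw [Matrix.mulVecLin_apply, hrl, consCol_mulVec] at hc
        have hc0 : c 0 = 0 := by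
          by_contra h0
          apply hv
          have : vr v = (rl (bE V hV)).mulVec (-(c 0)⁻¹ • (fun i => c i.succ)) := by
            rw [Matrix.mulVec_smul, eq_neg_of_add_eq_zero_right hc, smul_neg, smul_smul]
            simp [h0]
          have hm : vr v ∈ LinearMap.range (rl (bE V hV)).mulVecLin := ⟨_, this.symm⟩
          rw [(hb1 V hV).2] at hm
          exact hm
        rw [hc0, zero_smul, zero_add] at hc
        have := (hb1 V hV).1 (hc.trans (Matrix.mulVec_zero _).symm)
        ext i
        refine Fin.cases hc0 (fun i => ?_) i
        exact congrFun this i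
      · apply le_antisymm
        · rintro _ ⟨c, rfl⟩
          rw [Matrix.mulVecLin_apply, hrl, consCol_mulVec, add_comm]
          refine Submodule.add_mem_sup ?_ (Submodule.smul_mem _ _ (Submodule.mem_span_singleton_self _))
          exact (hb1 V hV).2.le ⟨_, rfl⟩
        · refine sup_le ?_ ((Submodule.span_singleton_le_iff_mem _ _).2 ?_)
          · refine (hb1 V hV).2.ge.trans ?_
            rintro _ ⟨c, rfl⟩
            refine ⟨Fin.cons 0 c, ?_⟩
            rw [Matrix.mulVecLin_apply, hrl, consCol_mulVec]
            simp
          · refine ⟨Fin.cons 1 0, ?_⟩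
            rw [Matrix.mulVecLin_apply, hrl, consCol_mulVec]
            simp
            exact Matrix.mulVec_zero _
    have hR : Rat (V ⊔ Submodule.span ℝ {vr v}) := ⟨_, E', hrep⟩
    refine ⟨hR, fun x => ?_⟩
    have e1 : ψ (V ⊔ Submodule.span ℝ {vr v}) x ≤ 2 * mn (ev Hp x * rl E') := by
      rw [hψ _ hR]
      have hb1' := hb1 _ hR
      have hb2' := hb2 _ hR
      have hreq : br _ hR = br V hV + 1 := by rw [← hb1'.finrank, hrep.finrank]
      revert hb1' hb2'
      generalize bE _ hR = E2
      revert E2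
      rw [hreq]
      intro E2 h1 h2
      exact mn_comp _ _ _ hrep.1 (h1.2.trans hrep.2.symm) (h2 _ E' hrep)
    refine e1.trans ?_
    rw [hrl, mul_consCol, hψ V hV]
    have e2 := mn_consCol ((ev Hp x).mulVec (vr v)) (ev Hp x * rl (bE V hV))
    have e3 : ((br V hV : ℕ) : ℝ) + 1 ≤ N + 1 := by
      have : ((br V hV : ℕ) : ℝ) ≤ N := by exact_mod_cast (hb1 V hV).le
      linarith
    have hm0 := mn_nonneg (ev Hp x * rl (bE V hV))
    calc _ ≤ 2 * ((((br V hV : ℕ) : ℝ) + 1) * mn (ev Hp x * rl (bE V hV)) * ‖(ev Hp x).mulVec (vr v)‖) := by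
          linarith
      _ ≤ 2 * ((N + 1) * mn (ev Hp x * rl (bE V hV)) * ‖(ev Hp x).mulVec (vr v)‖) := by gcongr
      _ = _ := by rw [hK0]; ring
  · refine lt_of_le_of_lt ?_ hsmall
    have : (d+1) * (K0 * ε) * Adbl d ^ (N+1) = K1 * ε := by rw [hK1]; ring
    rw [this]
    exact mul_le_mul_of_nonneg_right (by linarith) hε.le
  · intro V hV hR _ _
    obtain ⟨x, hx, hx2⟩ := hsup (br V hR) (by
      rw [Nat.one_le_iff_ne_zero, ← (hb1 V hR).finrank]
      intro h0
      exact hV (Submodule.finrank_eq_zero.1 h0)) (bE V hR) (hb1 V hR).1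
    exact ⟨x, hx, by rw [hψ V hR]; exact hx2⟩

end BB

namespace BB

lemma minkowski_base {r : ℕ} (A : Matrix (Fin r) (Fin r) ℝ) (hA : A.det ≠ 0) (h1 : |A.det| < 1) :
    ∃ c : Fin r → ℤ, c ≠ 0 ∧ ‖A.mulVec (vr c)‖ < 1 := by
  have hL : LinearMap.det A.mulVecLin = A.det := by
    rw [← Matrix.toLin'_apply', LinearMap.det_toLin']
  have hvol : volume (A.mulVecLin ⁻¹' Metric.ball 0 1) = ENNReal.ofReal |A.det|⁻¹ * 2^r := by
    rw [MeasureTheory.Measure.addHaar_preimage_linearMap _ (by rw [hL]; exact hA), hL, abs_inv,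
      Real.volume_pi_ball _ one_pos]
    simp [ENNReal.ofReal_pow]
  let b := Pi.basisFun ℝ (Fin r)
  have hsymm : ∀ x ∈ A.mulVecLin ⁻¹' Metric.ball 0 1, -x ∈ A.mulVecLin ⁻¹' Metric.ball 0 1 := by
    intro x hx
    simp only [Set.mem_preimage, mem_ball_zero_iff, map_neg, norm_neg] at hx ⊢
    exact hx
  have hconv : Convex ℝ (A.mulVecLin ⁻¹' Metric.ball 0 1) :=
    (convex_ball _ _).linear_preimage _
  have hfund := ZSpan.isAddFundamentalDomain b volume
  have hfv : volume (ZSpan.fundamentalDomain b) = 1 := by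
    rw [ZSpan.volume_fundamentalDomain]
    have : (Matrix.of b : Matrix (Fin r) (Fin r) ℝ) = 1 := by
      ext i j
      rw [Matrix.of_apply, Pi.basisFun_apply, Matrix.one_apply, Pi.single_apply]
      simp [eq_comm]
    rw [this]; simp
  have hdet : 0 < |A.det| := abs_pos.2 hA
  have : Countable (Submodule.span ℤ (Set.range b)).toAddSubgroup :=
    inferInstanceAs (Countable (Submodule.span ℤ (Set.range b)))
  obtain ⟨x, hx0, hx⟩ := exists_ne_zero_mem_lattice_of_measure_mul_two_pow_lt_measure
    (L := (Submodule.span ℤ (Set.range b)).toAddSubgroup) (μ := volume) hfund hsymm hconv (by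
      rw [hfv, hvol]
      simp only [Module.finrank_fin_fun]
      refine ENNReal.mul_lt_mul_left (by simp) (by finiteness) ?_
      rw [← ENNReal.ofReal_one]
      exact (ENNReal.ofReal_lt_ofReal_iff (by positivity)).2 ((one_lt_inv₀ hdet).2 h1))
  have hxm : (x : Fin r → ℝ) ∈ Submodule.span ℤ (Set.range b) := x.2
  have hrepr := (b.mem_span_iff_repr_mem ℤ (x : Fin r → ℝ)).1 hxm
  have hi : ∀ i, ∃ c : ℤ, (c : ℝ) = (x : Fin r → ℝ) i := by
    intro i
    obtain ⟨c, hc⟩ := hrepr i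
    exact ⟨c, by simpa [b] using hc⟩
  choose c hc using hi
  have hvc : vr c = (x : Fin r → ℝ) := funext hc
  refine ⟨c, ?_, ?_⟩
  · rintro rfl
    apply hx0
    ext i
    rw [← hc i]; simp
  · rw [hvc]
    simpa using hx

lemma cramer_rep {N r : ℕ} (Y : Matrix (Fin N) (Fin r) ℝ) (f : Fin r → Fin N)
    (hf : (Y.submatrix f id).det ≠ 0) :
    Y = (Matrix.of fun k i => (Y.submatrix (Function.update f i k) id).det / (Y.submatrix f id).det)
      * Y.submatrix f id := by
  ext k j
  have h := Matrix.mulVec_cramer (Y.submatrix f id).transpose (Y k)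
  have h2 := congrFun h j
  simp only [Matrix.mulVec, dotProduct, Matrix.transpose_apply, Matrix.det_transpose,
    Matrix.cramer_transpose_apply, Pi.smul_apply, smul_eq_mul] at h2
  rw [Matrix.mul_apply]
  rw [← mul_right_inj' hf, ← h2, Finset.mul_sum]
  refine Finset.sum_congr rfl fun i _ => ?_
  have : (Y.submatrix f id).updateRow i (Y k) = Y.submatrix (Function.update f i k) id := by
    ext a b
    by_cases hab : a = i
    · subst hab; simp
    · simp [hab, Matrix.updateRow_apply]
  rw [this]
  simp only [Matrix.of_apply]
  field_simp

lemma minkowski_mn {N r : ℕ} (hr : 1 ≤ r) (Y : Matrix (Fin N) (Fin r) ℝ)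
    (hY : Function.Injective Y.mulVec) (lam : ℝ) (hl : 0 < lam)
    (h : ∀ c : Fin r → ℤ, c ≠ 0 → lam ≤ ‖Y.mulVec (vr c)‖) : (lam / r)^r ≤ mn Y := by
  obtain ⟨f, hf⟩ := exists_mn_eq Y (mn_pos Y hY)
  have hpos := mn_pos Y hY
  have hr0 : (0:ℝ) < r := by exact_mod_cast hr
  have hdet : (Y.submatrix f id).det ≠ 0 := by
    intro h0; rw [h0] at hf; simp at hf; linarith
  by_contra hcon
  push Not at hcon
  have hd : (((r:ℝ)/lam) • Y.submatrix f id).det = ((r:ℝ)/lam)^r * (Y.submatrix f id).det := by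
    rw [Matrix.det_smul]; simp
  obtain ⟨c, hc0, hc⟩ := minkowski_base (((r:ℝ)/lam) • Y.submatrix f id) (by
      rw [hd]; positivity) (by
      rw [hd, abs_mul, abs_of_nonneg (by positivity), hf]
      calc ((r:ℝ)/lam)^r * mn Y < ((r:ℝ)/lam)^r * (lam / r)^r := by gcongr
        _ = 1 := by rw [← mul_pow]; field_simp; simp)
  rw [Matrix.smul_mulVec, norm_smul, Real.norm_of_nonneg (by positivity), div_mul_eq_mul_div,
    div_lt_one hl] at hc
  have hle := h c hc0
  have : ‖Y.mulVec (vr c)‖ ≤ r * ‖(Y.submatrix f id).mulVec (vr c)‖ := by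
    rw [pi_norm_le_iff_of_nonneg (by positivity)]
    intro k
    conv_lhs => rw [cramer_rep Y f hdet, ← Matrix.mulVec_mulVec]
    rw [Matrix.mulVec, dotProduct, Real.norm_eq_abs]
    refine (Finset.abs_sum_le_sum_abs _ _).trans ?_
    calc _ ≤ ∑ i : Fin r, ‖(Y.submatrix f id).mulVec (vr c)‖ := by
          refine Finset.sum_le_sum fun i _ => ?_
          rw [abs_mul]
          have h1 : |(Matrix.of fun k i => (Y.submatrix (Function.update f i k) id).det /
              (Y.submatrix f id).det) k i| ≤ 1 := by
            rw [Matrix.of_apply, abs_div, hf]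
            exact div_le_one_of_le₀ (abs_det_le_mn _ _) hpos.le
          have h2 := norm_le_pi_norm ((Y.submatrix f id).mulVec (vr c)) i
          rw [Real.norm_eq_abs] at h2
          calc _ ≤ 1 * ‖(Y.submatrix f id).mulVec (vr c)‖ := by gcongr
            _ = _ := one_mul _
      _ = _ := by simp
  linarith

end BB

namespace BB

/-- Taylor matrix -/
noncomputable def U (N : ℕ) (x : ℝ) : Matrix (Fin N) (Fin N) ℝ :=
  Matrix.of fun i j => ((j : ℕ).choose (i : ℕ) : ℝ) * x ^ ((j : ℕ) - (i : ℕ))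

lemma U_apply {N : ℕ} (x : ℝ) (i j : Fin N) :
    U N x i j = (Polynomial.taylor x (Polynomial.X ^ (j : ℕ))).coeff i := by
  rw [Polynomial.taylor_X_pow, Polynomial.coeff_X_add_C_pow]
  simp [U, mul_comm]

lemma taylor_coeff_eq {N : ℕ} (x : ℝ) (P : Polynomial ℝ) (hP : P.natDegree < N) (i : Fin N) :
    (Polynomial.taylor x P).coeff i = ∑ k : Fin N, U N x i k * P.coeff k := by
  conv_lhs => rw [P.as_sum_range' N hP]
  rw [map_sum, Polynomial.finsetSum_coeff, Finset.sum_range]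
  refine Finset.sum_congr rfl fun k _ => ?_
  rw [U_apply, ← Polynomial.C_mul_X_pow_eq_monomial, ← Polynomial.smul_eq_C_mul, map_smul,
    Polynomial.coeff_smul, smul_eq_mul, mul_comm]

lemma U_add {N : ℕ} (x y : ℝ) : U N (x + y) = U N y * U N x := by
  ext i j
  rw [Matrix.mul_apply, U_apply, add_comm x y, ← Polynomial.taylor_taylor, taylor_coeff_eq (N := N)]
  · refine Finset.sum_congr rfl fun k _ => ?_
    rw [U_apply x]
  · rw [Polynomial.natDegree_taylor, Polynomial.natDegree_X_pow]; exact j.2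

lemma U_zero {N : ℕ} : U N 0 = 1 := by
  ext i j
  rw [U, Matrix.of_apply, Matrix.one_apply]
  by_cases h : i = j
  · simp [h]
  · rw [if_neg h]
    rcases lt_or_gt_of_ne (fun h' => h (Fin.ext h') : (i:ℕ) ≠ j) with h1 | h1
    · rw [zero_pow (by omega), mul_zero]
    · rw [Nat.choose_eq_zero_of_lt h1]; simp

lemma U_det {N : ℕ} (x : ℝ) : (U N x).det = 1 := by
  rw [Matrix.det_of_isUpperTriangular]
  · simp [U]
  · intro i j hij
    simp only [id] at hij
    simp [U, Nat.choose_eq_zero_of_lt (show (j:ℕ) < i from hij)]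

lemma U_inj {N : ℕ} (x : ℝ) : Function.Injective (U N x).mulVec := by
  have h : U N (-x) * U N x = 1 := by rw [← U_add]; simp [U_zero]
  intro v w hvw
  have := congrArg (U N (-x)).mulVec hvw
  simpa [Matrix.mulVec_mulVec, h] using this

lemma mn_smul {N r : ℕ} (c : ℝ) (A : Matrix (Fin N) (Fin r) ℝ) : mn (c • A) = |c|^r * mn A := by
  have : (fun f : Fin r → Fin N => ((c • A).submatrix f id).det)
      = (c^r) • (fun f : Fin r → Fin N => (A.submatrix f id).det) := by
    ext f
    have : (c • A).submatrix f id = c • A.submatrix f id := rfl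
    rw [this, Matrix.det_smul]; simp
  rw [mn, this, norm_smul, norm_pow]; rfl

lemma inj_mul {N M r : ℕ} (A : Matrix (Fin M) (Fin N) ℝ) (B : Matrix (Fin N) (Fin r) ℝ)
    (hA : Function.Injective A.mulVec) (hB : Function.Injective B.mulVec) :
    Function.Injective (A * B).mulVec := by
  intro v w h
  rw [← Matrix.mulVec_mulVec, ← Matrix.mulVec_mulVec] at h
  exact hB (hA h)

lemma rank_le_of_inj {N r : ℕ} (A : Matrix (Fin N) (Fin r) ℝ) (hA : Function.Injective A.mulVec) :
    r ≤ N := by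
  have := LinearMap.finrank_le_finrank_of_injective (f := A.mulVecLin) hA
  simpa using this

lemma global_sup_aux (n : ℕ) (a b : ℝ) (hab : a < b) (hab1 : b - a ≤ 1) :
    ∃ c : ℝ, 0 < c ∧ c ≤ 1 ∧ ∀ r, 1 ≤ r → ∀ E : Matrix (Fin (n+1)) (Fin r) ℤ,
      Function.Injective (rl E).mulVec → ∃ x ∈ Set.Ico a b, ∃ f : Fin r → Fin (n+1),
        (∃ i, f i = 0) ∧ c ≤ |((U (n+1) x * rl E).submatrix f id).det| := by
  obtain ⟨Δ, hΔ⟩ := exists_nat_gt ((n+3 : ℝ) / (b-a))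
  have hba : 0 < b - a := by linarith
  rw [div_lt_iff₀ hba] at hΔ
  have hΔ0 : (0:ℝ) < Δ := by
    by_contra h
    have : (Δ:ℝ) * (b-a) ≤ 0 := mul_nonpos_of_nonpos_of_nonneg (not_lt.1 h) hba.le
    have : (0:ℝ) ≤ n := Nat.cast_nonneg n
    linarith
  have hΔ1 : (1:ℝ) ≤ Δ := by
    have : 0 < Δ := by exact_mod_cast hΔ0
    exact_mod_cast this
  set p : Fin (n+1) → ℤ := fun j => ⌈a * Δ⌉ + (j : ℕ) with hp
  set X : Fin (n+1) → ℝ := fun j => (p j : ℝ) / Δ with hX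
  have hXinj : Function.Injective X := by
    intro i j hij
    have h1 : (p i : ℝ) = p j := by
      simp only [hX] at hij
      field_simp at hij
      exact hij
    have h2 : p i = p j := by exact_mod_cast h1
    simp only [hp] at h2
    ext; omega
  have hXmem : ∀ j, X j ∈ Set.Ico a b := by
    intro j
    have h1 := Int.le_ceil (a * Δ)
    have h2 := Int.ceil_lt_add_one (a * Δ)
    have hj : ((j:ℕ):ℝ) ≤ n := by exact_mod_cast Nat.lt_succ_iff.1 j.2
    have hj0 : (0:ℝ) ≤ ((j:ℕ):ℝ) := Nat.cast_nonneg _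
    simp only [hX, hp, Set.mem_Ico]
    rw [le_div_iff₀ hΔ0, div_lt_iff₀ hΔ0]
    push_cast
    constructor <;> nlinarith
  refine ⟨(((Δ:ℝ)^n)^(n+1) * (n+1)^(n+1))⁻¹, by positivity, ?_, ?_⟩
  · apply inv_le_one_of_one_le₀
    have h1 : (1:ℝ) ≤ ((Δ:ℝ)^n)^(n+1) := one_le_pow₀ (one_le_pow₀ hΔ1)
    have h2 : (1:ℝ) ≤ (n+1)^(n+1) := one_le_pow₀ (by linarith [(Nat.cast_nonneg n : (0:ℝ) ≤ n)])
    nlinarith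
  intro r hr E hE
  have hrN : r ≤ n+1 := rank_le_of_inj _ hE
  obtain ⟨r', rfl⟩ : ∃ r', r = r' + 1 := ⟨r-1, by omega⟩
  set W : Matrix (Fin (n+1)) (Fin (n+1)) ℝ := Matrix.vandermonde X with hW
  have hWinj : Function.Injective W.mulVec := by
    apply Matrix.mulVec_injective_of_isUnit
    rw [Matrix.isUnit_iff_isUnit_det, isUnit_iff_ne_zero]
    exact Matrix.det_vandermonde_ne_zero_iff.2 hXinj
  set Wz : Matrix (Fin (n+1)) (Fin (n+1)) ℤ := Matrix.of fun j k => p j ^ (k:ℕ) * (Δ:ℤ)^(n - k) with hWz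
  have hscale : rl (Wz * E) = ((Δ:ℝ)^n) • (W * rl E) := by
    have h1 : rl Wz = ((Δ:ℝ)^n) • W := by
      ext j k
      have hk : (k:ℕ) ≤ n := Nat.lt_succ_iff.1 k.2
      simp only [hWz, hW, Matrix.map_apply, Matrix.of_apply, Matrix.smul_apply, Matrix.vandermonde_apply, hX]
      push_cast
      rw [smul_eq_mul, div_pow]
      have : (Δ:ℝ)^n = (Δ:ℝ)^(n-k) * (Δ:ℝ)^(k:ℕ) := by rw [← pow_add]; congr 1; omega
      rw [this]
      field_simp
    rw [← Matrix.smul_mul, ← h1]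
    ext i j
    simp [Matrix.mul_apply]
  have hGinj : Function.Injective (W * rl E).mulVec := inj_mul _ _ hWinj hE
  have hone : 1 ≤ mn (rl (Wz * E)) := by
    apply one_le_mn
    rw [hscale]
    intro v w h
    rw [Matrix.smul_mulVec, Matrix.smul_mulVec] at h
    exact hGinj (smul_right_injective _ (by positivity : (Δ:ℝ)^n ≠ 0) h)
  rw [hscale, mn_smul, abs_of_nonneg (by positivity)] at hone
  obtain ⟨f, hf⟩ := exists_mn_eq _ (mn_pos _ hGinj)
  set x := X (f 0) with hx
  set Bm : Matrix (Fin (n+1)) (Fin (n+1)) ℝ := Matrix.of fun j i => U (n+1) (X j - x) 0 i with hBm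
  have hfac : W * rl E = Bm * (U (n+1) x * rl E) := by
    rw [← Matrix.mul_assoc]
    congr 1
    ext j k
    have := congrFun (congrFun (U_add (N := n+1) x (X j - x)) 0) k
    rw [Matrix.mul_apply] at this ⊢
    simp only [hBm, Matrix.of_apply]
    rw [← this]
    simp [U, hW, Matrix.vandermonde_apply]
  have hB1 : ∀ j i, |Bm j i| ≤ 1 := by
    intro j i
    simp only [hBm, Matrix.of_apply, U]
    simp only [Fin.val_zero, Nat.choose_zero_right, Nat.cast_one, one_mul, Nat.sub_zero, abs_pow]
    apply pow_le_one₀ (abs_nonneg _)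
    have h1 := hXmem j
    have h2 := hXmem (f 0)
    rw [abs_le]; constructor <;> linarith [h1.1, h1.2, h2.1, h2.2]
  have hB0 : ∀ i, i ≠ 0 → Bm (f 0) i = 0 := by
    intro i hi
    have hi' : (i:ℕ) ≠ 0 := fun h => hi (Fin.ext h)
    simp [hBm, U, hx, hi']
  refine ⟨x, hXmem _, ?_⟩
  by_contra hcon
  push Not at hcon
  set c := (((Δ:ℝ)^n)^(n+1) * (n+1)^(n+1))⁻¹ with hc
  have hcpos : 0 < c := by positivity
  have hlt : |((W * rl E).submatrix f id).det| < (n+1)^(r'+1) * c := by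
    rw [hfac, det_mul_expand]
    refine (Finset.abs_sum_le_sum_abs _ _).trans_lt ?_
    calc _ < ∑ g : Fin (r'+1) → Fin (n+1), c := by
          refine Finset.sum_lt_sum_of_nonempty ⟨f, Finset.mem_univ _⟩ fun g _ => ?_
          by_cases hg : g 0 = 0
          · rw [abs_mul, Finset.abs_prod]
            have h1 : ∏ i, |Bm (f i) (g i)| ≤ 1 :=
              Finset.prod_le_one (fun _ _ => abs_nonneg _) (fun _ _ => hB1 _ _)
            have h2 := hcon g ⟨0, hg⟩
            calc _ ≤ 1 * |((U (n+1) x * rl E).submatrix g id).det| := by gcongr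
              _ < c := by rw [one_mul]; exact h2
          · rw [Finset.prod_eq_zero (Finset.mem_univ (0 : Fin (r'+1))) (hB0 (g 0) hg)]
            simpa using hcpos
      _ = _ := by simp
  rw [hf] at hlt
  have h3 : 1 < ((Δ:ℝ)^n)^(r'+1) * ((n+1)^(r'+1) * c) :=
    hone.trans_lt (by gcongr)
  have h4 : ((Δ:ℝ)^n)^(r'+1) * ((n+1)^(r'+1) * c) ≤ ((Δ:ℝ)^n)^(n+1) * ((n+1)^(n+1) * c) := by
    gcongr
    · exact one_le_pow₀ hΔ1
    · linarith [(Nat.cast_nonneg n : (0:ℝ) ≤ n)]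
  have h5 : ((Δ:ℝ)^n)^(n+1) * ((n+1)^(n+1) * c) = 1 := by
    rw [hc, ← mul_assoc]; apply mul_inv_cancel₀; positivity
  linarith

end BB

namespace BB

open Classical in
lemma prod_ind {N r : ℕ} (f : Fin r → Fin N) (hf : Function.Injective f) (k : Fin N) (u : ℝ) :
    (∏ i, if f i = k then u else 1) = if ∃ i, f i = k then u else 1 := by
  split_ifs with h
  · obtain ⟨i0, hi0⟩ := h
    rw [Finset.prod_eq_single i0]
    · simp [hi0]
    · intro b _ hb
      rw [if_neg]
      intro h; exact hb (hf (h.trans hi0.symm))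
    · simp
  · push Not at h
    exact Finset.prod_eq_one fun i _ => by simp [h i]

/-- weights: `w0` at 0, `w1` at 1, `t` elsewhere -/
noncomputable def wt {n : ℕ} (w0 w1 t : ℝ) : Fin (n+2) → ℝ :=
  fun k => if k = 0 then w0 else if k = 1 then w1 else t

open Classical in
lemma prod_wt {n r : ℕ} (w0 w1 t : ℝ) (ht : t ≠ 0) (f : Fin r → Fin (n+2))
    (hf : Function.Injective f) :
    (∏ i, wt w0 w1 t (f i)) = t^r * (if ∃ i, f i = 0 then w0/t else 1) *
      (if ∃ i, f i = 1 then w1/t else 1) := by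
  rw [← prod_ind f hf 0, ← prod_ind f hf 1]
  have : t^r = ∏ i : Fin r, t := by simp
  rw [this, ← Finset.prod_mul_distrib, ← Finset.prod_mul_distrib]
  refine Finset.prod_congr rfl fun i _ => ?_
  unfold wt
  by_cases h0 : f i = 0
  · simp [h0]; field_simp
  · by_cases h1 : f i = 1
    · simp [h1]; field_simp
    · simp [h0, h1]

lemma plucker {n r : ℕ} (Y : Matrix (Fin (n+2)) (Fin r) ℝ) (fs : Fin r → Fin (n+2)) (β : ℝ)
    (hpos : 0 < mn Y) (hmax : |(Y.submatrix fs id).det| = mn Y) (hfs : ∀ i, fs i ≠ 0 ∧ fs i ≠ 1)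
    (_hβ0 : 0 ≤ β)
    (h0 : ∀ f : Fin r → Fin (n+2), (∃ i, f i = 0) → (∀ i, f i ≠ 1) → |(Y.submatrix f id).det| ≤ β)
    (h1 : ∀ f : Fin r → Fin (n+2), (∃ i, f i = 1) → (∀ i, f i ≠ 0) → |(Y.submatrix f id).det| ≤ β)
    (f : Fin r → Fin (n+2)) (hf0 : ∃ i, f i = 0) (hf1 : ∃ i, f i = 1) :
    |(Y.submatrix f id).det| ≤ r.factorial * β^2 / mn Y := by
  by_cases hf : Function.Injective f
  swap
  · rw [det_submatrix_eq_zero Y f hf]; simp; positivity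
  have hdet : (Y.submatrix fs id).det ≠ 0 := by
    intro h; rw [h] at hmax; simp at hmax; linarith
  set C : Matrix (Fin (n+2)) (Fin r) ℝ := Matrix.of fun k i =>
    (Y.submatrix (Function.update fs i k) id).det / (Y.submatrix fs id).det with hC
  have hYC : Y = C * Y.submatrix fs id := cramer_rep Y fs hdet
  have hCb : ∀ k i, |C k i| ≤ wt (β / mn Y) (β / mn Y) 1 k := by
    intro k i
    simp only [hC, Matrix.of_apply, abs_div, hmax]
    have h01 : (0 : Fin (n+2)) ≠ 1 := by simp
    unfold wt
    by_cases hk0 : k = 0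
    · simp only [hk0, if_true]
      gcongr
      refine h0 _ ⟨i, by simp⟩ fun j => ?_
      by_cases hj : j = i
      · subst hj; simp
      · rw [Function.update_of_ne hj]; exact (hfs j).2
    · by_cases hk1 : k = 1
      · simp only [hk1, h01.symm, if_true, if_false]
        gcongr
        refine h1 _ ⟨i, by simp⟩ fun j => ?_
        by_cases hj : j = i
        · subst hj; simp
        · rw [Function.update_of_ne hj]; exact (hfs j).1
      · simp only [hk0, hk1, if_false]
        exact div_le_one_of_le₀ (abs_det_le_mn _ _) hpos.le
  have hYf : Y.submatrix f id = C.submatrix f id * Y.submatrix fs id := by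
    conv_lhs => rw [hYC]
    ext i j; simp [Matrix.mul_apply]
  have hCf : |(C.submatrix f id).det| ≤ r.factorial * (β / mn Y)^2 := by
    rw [Matrix.det_apply]
    refine (Finset.abs_sum_le_sum_abs _ _).trans ?_
    calc _ ≤ ∑ σ : Equiv.Perm (Fin r), (β / mn Y)^2 := by
          refine Finset.sum_le_sum fun σ _ => ?_
          have hs : |(Equiv.Perm.sign σ) • ∏ i, (C.submatrix f id) (σ i) i|
              = |∏ i, (C.submatrix f id) (σ i) i| := by
            rcases Int.units_eq_one_or (Equiv.Perm.sign σ) with h | h <;> simp [h]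
          rw [hs, Finset.abs_prod]
          calc _ ≤ ∏ i, wt (β / mn Y) (β / mn Y) 1 (f (σ i)) :=
                Finset.prod_le_prod (fun _ _ => abs_nonneg _) fun i _ => hCb _ _
            _ = ∏ i, wt (β / mn Y) (β / mn Y) 1 (f i) := Equiv.prod_comp σ fun i =>
                  wt (β / mn Y) (β / mn Y) 1 (f i)
            _ = _ := by
                rw [prod_wt _ _ _ one_ne_zero f hf, if_pos hf0, if_pos hf1]; simp [pow_two]
      _ = _ := by simp [Fintype.card_perm]
  rw [hYf, Matrix.det_mul, abs_mul, hmax]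
  calc _ ≤ r.factorial * (β / mn Y)^2 * mn Y := by gcongr
    _ = _ := by field_simp

lemma class1_bound {n r : ℕ} (Y Y' : Matrix (Fin (n+2)) (Fin r) ℝ)
    (Gi : Matrix (Fin (n+2)) (Fin (n+2)) ℝ) (G0 : Fin (n+2) → ℝ) (s η b μ α : ℝ)
    (hGi : Y = Gi * Y') (hG0 : Y' 0 = ∑ k, G0 k • Y k) (hG00 : G0 0 = 1) (hG01 : G0 1 = s)
    (hs : 0 < s) (hη : 0 ≤ η) (hb : 1 ≤ b) (hμ : 0 ≤ μ) (hα : 0 ≤ α)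
    (hGk : ∀ k, k ≠ 0 → k ≠ 1 → |G0 k| ≤ s * η)
    (hGib : ∀ k j, k ≠ 0 → k ≠ 1 → |Gi k j| ≤ b)
    (h0 : ∀ f : Fin r → Fin (n+2), (∃ i, f i = 0) → |(Y.submatrix f id).det| ≤ μ)
    (h0' : ∀ f : Fin r → Fin (n+2), (∃ i, f i = 0) → |(Y'.submatrix f id).det| ≤ μ)
    (hn : ∀ f : Fin r → Fin (n+2), (∀ i, f i ≠ 0 ∧ f i ≠ 1) → |(Y.submatrix f id).det| ≤ α)
    (f : Fin r → Fin (n+2)) (hf1 : ∃ i, f i = 1) (hf0 : ∀ i, f i ≠ 0) :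
    |(Y.submatrix f id).det| ≤ (((n+2 : ℕ) * b)^r * μ + μ) / s + (n+2 : ℕ) * (η * α) := by
  by_cases hf : Function.Injective f
  swap
  · rw [det_submatrix_eq_zero Y f hf]; simp only [abs_zero]; positivity
  obtain ⟨i0, hi0⟩ := hf1
  have hrest : ∀ i, i ≠ i0 → f i ≠ 0 ∧ f i ≠ 1 := fun i hi =>
    ⟨hf0 i, fun h => hi (hf (h.trans hi0.symm))⟩
  set φ : (Fin r → ℝ) → ℝ := fun u => ((Y.submatrix f id).updateRow i0 u).det with hφ
  have hφY : ∀ k, φ (Y k) = (Y.submatrix (Function.update f i0 k) id).det := by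
    intro k
    simp only [hφ]
    congr 1
    ext a b
    by_cases hab : a = i0
    · subst hab; simp
    · simp [hab, Matrix.updateRow_apply]
  have hφ1 : φ (Y 1) = (Y.submatrix f id).det := by
    rw [hφY, ← hi0, Function.update_eq_self]
  have hsum : φ (Y' 0) = ∑ k, G0 k * φ (Y k) := by
    rw [hG0]
    have h := (Matrix.detRowAlternating (R := ℝ) (n := Fin r)).toMultilinearMap.map_update_sum
      Finset.univ i0 (fun k => G0 k • Y k) (Y.submatrix f id)
    have h3 : ∀ u, φ u = (Matrix.detRowAlternating (R := ℝ) (n := Fin r)).toMultilinearMap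
      (Function.update (Y.submatrix f id) i0 u) := fun u => rfl
    rw [h3, h]
    refine Finset.sum_congr rfl fun k _ => ?_
    refine ((Matrix.detRowAlternating (R := ℝ) (n := Fin r)).toMultilinearMap.map_update_smul
      (Y.submatrix f id) i0 (G0 k) (Y k)).trans ?_
    rw [smul_eq_mul]; rfl
  -- bound φ (Y' 0)
  have hb0 : |φ (Y' 0)| ≤ ((n+2 : ℕ) * b)^r * μ := by
    set L : Matrix (Fin r) (Fin (n+2)) ℝ := (Gi.submatrix f id).updateRow i0 (Pi.single 0 1) with hL
    have hLY : (Y.submatrix f id).updateRow i0 (Y' 0) = (L * Y').submatrix id id := by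
      ext i j
      by_cases hi : i = i0
      · subst hi
        simp [hL, Matrix.mul_apply, Pi.single_apply]
      · rw [Matrix.updateRow_ne hi]
        conv_lhs => rw [hGi]
        simp [hL, Matrix.mul_apply, Matrix.updateRow_ne hi]
    simp only [hφ]
    rw [hLY, det_mul_expand]
    refine (Finset.abs_sum_le_sum_abs _ _).trans ?_
    calc _ ≤ ∑ g : Fin r → Fin (n+2), b^r * μ := by
          refine Finset.sum_le_sum fun g _ => ?_
          by_cases hg : g i0 = 0
          · rw [abs_mul, Finset.abs_prod]
            refine mul_le_mul ?_ (h0' g ⟨i0, hg⟩) (abs_nonneg _) (by positivity)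
            calc _ ≤ ∏ i : Fin r, b := by
                  refine Finset.prod_le_prod (fun _ _ => abs_nonneg _) fun i _ => ?_
                  by_cases hi : i = i0
                  · subst hi
                    simp [hL, hg, hb]
                  · simp only [hL, id, Matrix.updateRow_ne hi, Matrix.submatrix_apply]
                    exact hGib _ _ (hrest i hi).1 (hrest i hi).2
              _ = _ := by simp
          · rw [Finset.prod_eq_zero (Finset.mem_univ i0)]
            · simp; positivity
            · simp [hL, hg]
      _ = _ := by
          rw [Finset.sum_const, nsmul_eq_mul, Finset.card_univ, Fintype.card_fun, Fintype.card_fin,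
            Fintype.card_fin, mul_pow, ← mul_assoc]
          push_cast; ring
  have h01 : (0 : Fin (n+2)) ≠ 1 := by simp
  have hsplit : ∑ k, G0 k * φ (Y k) = φ (Y 0) + s * φ (Y 1) +
      ∑ k ∈ (Finset.univ.erase 0).erase 1, G0 k * φ (Y k) := by
    rw [← Finset.add_sum_erase Finset.univ _ (Finset.mem_univ (0 : Fin (n+2))),
      ← Finset.add_sum_erase (Finset.univ.erase 0) _
        (Finset.mem_erase.2 ⟨h01.symm, Finset.mem_univ (1 : Fin (n+2))⟩), hG00, hG01]
    ring
  have hR : |∑ k ∈ (Finset.univ.erase 0).erase 1, G0 k * φ (Y k)| ≤ (n+2:ℕ) * (s * η * α) := by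
    refine (Finset.abs_sum_le_sum_abs _ _).trans ?_
    calc _ ≤ ∑ k ∈ ((Finset.univ : Finset (Fin (n+2))).erase 0).erase 1, s * η * α := by
          refine Finset.sum_le_sum fun k hk => ?_
          rw [Finset.mem_erase, Finset.mem_erase] at hk
          rw [abs_mul]
          refine mul_le_mul (hGk k hk.2.1 hk.1) ?_ (abs_nonneg _) (by positivity)
          rw [hφY]
          refine hn _ fun j => ?_
          by_cases hj : j = i0
          · subst hj; simp [hk.1, hk.2.1]
          · rw [Function.update_of_ne hj]; exact hrest j hj
      _ ≤ _ := by
          rw [Finset.sum_const, nsmul_eq_mul]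
          gcongr
          refine (Finset.card_le_univ _).trans ?_
          simp
  have hb00 : |φ (Y 0)| ≤ μ := by
    rw [hφY]; exact h0 _ ⟨i0, by simp⟩
  have heq : s * (Y.submatrix f id).det = φ (Y' 0) - φ (Y 0) -
      ∑ k ∈ (Finset.univ.erase 0).erase 1, G0 k * φ (Y k) := by
    rw [hsum, hsplit, hφ1]; ring
  have h4 : s * |(Y.submatrix f id).det| ≤ ((n+2 : ℕ) * b)^r * μ + μ + (n+2:ℕ) * (s * η * α) := by
    rw [← abs_of_pos hs, ← abs_mul, heq, abs_of_pos hs]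
    refine (abs_sub _ _).trans ?_
    linarith [abs_sub (φ (Y' 0)) (φ (Y 0))]
  rw [← mul_le_mul_iff_right₀ hs]
  refine h4.trans (le_of_eq ?_)
  field_simp

end BB

namespace BB

def mE (n : ℕ) : ℕ := 6*n+23
def dE (n : ℕ) : ℕ := 6*n+26
def bE (n : ℕ) : ℕ := (2*n+1)*(3*n+13)

/-- the diagonal weights `b_{T,S}` -/
noncomputable def bw (n : ℕ) (T S : ℝ) : Fin (n+2) → ℝ :=
  wt (T^(n+1)) (S^(bE n)/T) (1/(T*S^(dE n)))

noncomputable def Hm (n : ℕ) (T S x : ℝ) : Matrix (Fin (n+2)) (Fin (n+2)) ℝ :=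
  Matrix.diagonal (bw n T S) * U (n+2) x

lemma wt_pos {n : ℕ} {w0 w1 t : ℝ} (h0 : 0 < w0) (h1 : 0 < w1) (ht : 0 < t) (k : Fin (n+2)) :
    0 < wt w0 w1 t k := by
  unfold wt; split_ifs <;> assumption

lemma bw_pos {n : ℕ} {T S : ℝ} (hT : 0 < T) (hS : 0 < S) (k : Fin (n+2)) : 0 < bw n T S k :=
  wt_pos (by positivity) (by positivity) (by positivity) k

lemma diag_inj {N : ℕ} (w : Fin N → ℝ) (hw : ∀ k, w k ≠ 0) :
    Function.Injective (Matrix.diagonal w).mulVec := by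
  intro u v h
  ext k
  have := congrFun h k
  rw [Matrix.mulVec_diagonal, Matrix.mulVec_diagonal] at this
  exact mul_left_cancel₀ (hw k) this

lemma Hm_inj {n : ℕ} {T S x : ℝ} (hT : 0 < T) (hS : 0 < S) :
    Function.Injective (Hm n T S x).mulVec :=
  inj_mul _ _ (diag_inj _ fun k => (bw_pos hT hS k).ne') (U_inj x)

lemma bE_ge (n : ℕ) : n * dE n ≤ bE n := by unfold bE dE; nlinarith

lemma prod_bw_full (n : ℕ) {T S : ℝ} (hT : 0 < T) (hS : 1 ≤ S) : 1 ≤ ∏ k, bw n T S k := by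
  have hS0 : 0 < S := by linarith
  have h := prod_wt (n := n) (T^(n+1)) (S^(bE n)/T) (1/(T*S^(dE n))) (by positivity) id
    Function.injective_id
  rw [if_pos ⟨0, rfl⟩, if_pos ⟨1, rfl⟩] at h
  simp only [id] at h
  unfold bw
  rw [h]
  have : (1 / (T * S ^ dE n)) ^ (n + 2) * (T ^ (n + 1) / (1 / (T * S ^ dE n))) *
      (S ^ bE n / T / (1 / (T * S ^ dE n))) = S^(bE n) / S^(n * dE n) := by
    rw [mul_comm n, pow_mul, div_pow, one_pow, mul_pow]
    have hp : 0 < S^dE n := by positivity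
    generalize S^dE n = p at hp
    field_simp
    ring
  rw [this, one_le_div (by positivity)]
  exact pow_le_pow_right₀ hS (bE_ge n)

lemma full_sup (n : ℕ) {T S x : ℝ} (hT : 0 < T) (hS : 1 ≤ S) (E : Matrix (Fin (n+2)) (Fin (n+2)) ℤ)
    (hE : Function.Injective (rl E).mulVec) : 1 ≤ mn (Hm n T S x * rl E) := by
  refine le_trans ?_ (abs_det_le_mn _ id)
  rw [Matrix.submatrix_id_id, Matrix.det_mul, Hm, Matrix.det_mul, Matrix.det_diagonal, U_det, mul_one,
    abs_mul]
  have h1 := prod_bw_full n hT hS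
  have h2 : 1 ≤ |(rl E).det| := by
    have hd : (rl E).det = ((E.det : ℤ) : ℝ) := by rw [Int.cast_det]
    have : (rl E).det ≠ 0 := by
      obtain ⟨B, hB⟩ := exists_left_inv _ hE
      intro h0
      have := congrArg Matrix.det hB
      rw [Matrix.det_mul, h0] at this; simp at this
    rw [hd] at this ⊢
    exact_mod_cast Int.one_le_abs (by exact_mod_cast this)
  have h3 := le_abs_self (∏ k, bw n T S k)
  nlinarith

lemma global_sup (n : ℕ) (a b : ℝ) (hab : a < b) (hab1 : b - a ≤ 1) :
    ∃ c : ℝ, 0 < c ∧ c ≤ 1 ∧ ∀ T S : ℝ, 1 ≤ T → 1 ≤ S → S^(dE n * n) ≤ T →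
      ∀ r, 1 ≤ r → ∀ E : Matrix (Fin (n+2)) (Fin r) ℤ,
      Function.Injective (rl E).mulVec → ∃ x ∈ Set.Ico a b, c ≤ mn (Hm n T S x * rl E) := by
  obtain ⟨c, hc, hc1, h⟩ := global_sup_aux (n+1) a b hab hab1
  refine ⟨c, hc, hc1, ?_⟩
  intro T S hT hS hST r hr E hE
  have hT0 : 0 < T := by linarith
  have hS0 : 0 < S := by linarith
  rcases (rank_le_of_inj _ hE).eq_or_lt with hrN | hrN
  · subst hrN
    exact ⟨a, ⟨le_rfl, hab⟩, hc1.trans (full_sup n hT0 hS E hE)⟩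
  obtain ⟨x, hx, f, hf0, hf⟩ := h r hr E hE
  refine ⟨x, hx, ?_⟩
  have hfi : Function.Injective f := by
    by_contra hcon
    rw [det_submatrix_eq_zero _ f hcon] at hf; simp at hf; linarith
  refine le_trans ?_ (abs_det_le_mn _ f)
  rw [Hm, Matrix.mul_assoc, det_diag_mul, abs_mul]
  have hP : 1 ≤ ∏ i, bw n T S (f i) := by
    unfold bw
    rw [prod_wt _ _ _ (by positivity) f hfi, if_pos hf0]
    have h1 : 1 ≤ (if ∃ i, f i = 1 then S^(bE n)/T/(1/(T*S^(dE n))) else 1) := by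
      split_ifs
      · have : S^(bE n)/T/(1/(T*S^(dE n))) = S^(bE n) * S^(dE n) := by field_simp
        rw [this, ← pow_add]; exact one_le_pow₀ hS
      · exact le_rfl
    have h2 : 1 ≤ (1/(T*S^(dE n)))^r * (T^(n+1)/(1/(T*S^(dE n)))) := by
      obtain ⟨r', rfl⟩ : ∃ r', r = r' + 1 := ⟨r-1, by omega⟩
      have : (1/(T*S^(dE n)))^(r'+1) * (T^(n+1)/(1/(T*S^(dE n)))) = T^(n+1) / (T*S^(dE n))^r' := by
        have hp : 0 < S^dE n := by positivity
        generalize S^dE n = p at hp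
        rw [div_pow, one_pow]
        field_simp
        ring
      rw [this, one_le_div (by positivity)]
      have hts : 1 ≤ T*S^(dE n) := by
        have : 1 ≤ S^(dE n) := one_le_pow₀ hS
        nlinarith
      calc (T*S^(dE n))^r' ≤ (T*S^(dE n))^n := pow_le_pow_right₀ hts (by omega)
        _ = T^n * S^(dE n * n) := by rw [mul_pow, pow_mul]
        _ ≤ T^n * T := by gcongr
        _ = T^(n+1) := by ring
    nlinarith
  have h3 := le_abs_self (∏ i, bw n T S (f i))
  nlinarith

lemma pw {z K : ℝ} {a b : ℕ} (hz : 1 ≤ z) (h : z^a ≤ K * z^b) (hab : b + 1 ≤ a) : z ≤ K := by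
  have hz0 : 0 < z := by linarith
  have h1 : z * z^b ≤ K * z^b := by
    refine le_trans ?_ h
    rw [← pow_succ']
    exact pow_le_pow_right₀ hz hab
  exact le_of_mul_le_mul_right h1 (by positivity)

end BB

namespace BB

lemma bw_mul (n : ℕ) {T τ S : ℝ} (k : Fin (n+2)) :
    bw n (T*τ) S k = bw n τ S k * bw n T 1 k := by
  unfold bw wt
  split_ifs
  · rw [mul_pow, mul_comm]
  · simp; ring
  · simp; ring

lemma diag_bw_mul (n : ℕ) {r : ℕ} {T τ S : ℝ} (W : Matrix (Fin (n+2)) (Fin r) ℝ) :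
    Matrix.diagonal (bw n (T*τ) S) * W =
      Matrix.diagonal (bw n τ S) * (Matrix.diagonal (bw n T 1) * W) := by
  rw [← Matrix.mul_assoc, Matrix.diagonal_mul_diagonal]
  congr 2
  ext k; exact bw_mul n k

lemma minor0 {n r' q : ℕ} (hn : n = r' + q) {τ S z : ℝ} (hτ : 0 < τ) (hS : 1 ≤ S)
    (hz0 : 0 < z) (hz : S^(dE n*(n+1)) ≤ z) (Y : Matrix (Fin (n+2)) (Fin (r'+1)) ℝ)
    (h : mn (Matrix.diagonal (bw n τ S) * Y) < 1) (f : Fin (r'+1) → Fin (n+2))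
    (hf0 : ∃ i, f i = 0) : |(Y.submatrix f id).det| ≤ z/τ^(q+1) := by
  have hS0 : 0 < S := by linarith
  by_cases hf : Function.Injective f
  swap
  · rw [det_submatrix_eq_zero Y f hf]; simp only [abs_zero]; positivity
  have h1 := (abs_det_le_mn (Matrix.diagonal (bw n τ S) * Y) f).trans h.le
  rw [det_diag_mul, abs_mul] at h1
  have hP : τ^(q+1)/z ≤ ∏ i, bw n τ S (f i) := by
    unfold bw
    rw [prod_wt _ _ _ (by positivity) f hf, if_pos hf0]
    have h1 : 1 ≤ (if ∃ i, f i = 1 then S^(bE n)/τ/(1/(τ*S^(dE n))) else 1) := by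
      split_ifs
      · have : S^(bE n)/τ/(1/(τ*S^(dE n))) = S^(bE n) * S^(dE n) := by field_simp
        rw [this, ← pow_add]; exact one_le_pow₀ hS
      · exact le_rfl
    have h2 : τ^(q+1)/z ≤ (1/(τ*S^(dE n)))^(r'+1) * (τ^(n+1)/(1/(τ*S^(dE n)))) := by
      have : (1/(τ*S^(dE n)))^(r'+1) * (τ^(n+1)/(1/(τ*S^(dE n)))) = τ^(q+1) / S^(dE n*r') := by
        rw [pow_mul]
        have hp : 0 < S^dE n := by positivity
        generalize S^dE n = p at hp
        rw [div_pow, one_pow, mul_pow]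
        subst hn
        field_simp
        ring
      rw [this]
      gcongr
      refine le_trans ?_ hz
      exact pow_le_pow_right₀ hS (Nat.mul_le_mul_left _ (by omega))
    have : 0 < τ^(q+1)/z := by positivity
    nlinarith
  have h3 := le_abs_self (∏ i, bw n τ S (f i))
  rw [le_div_iff₀ (by positivity)]
  have h4 : τ^(q+1)/z * |(Y.submatrix f id).det| ≤ 1 := by
    refine le_trans ?_ h1
    gcongr; linarith
  rw [div_mul_eq_mul_div, div_le_one hz0] at h4
  linarith

lemma minorN {n r : ℕ} (hr : r ≤ n+1) {τ S z : ℝ} (hτ : 0 < τ) (hS : 1 ≤ S)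
    (hz0 : 0 < z) (hz : S^(dE n*(n+1)) ≤ z) (Y : Matrix (Fin (n+2)) (Fin r) ℝ)
    (h : mn (Matrix.diagonal (bw n τ S) * Y) < 1) (f : Fin r → Fin (n+2))
    (hf0 : ∀ i, f i ≠ 0 ∧ f i ≠ 1) : |(Y.submatrix f id).det| ≤ τ^r * z := by
  have hS0 : 0 < S := by linarith
  by_cases hf : Function.Injective f
  swap
  · rw [det_submatrix_eq_zero Y f hf]; simp only [abs_zero]; positivity
  have h1 := (abs_det_le_mn (Matrix.diagonal (bw n τ S) * Y) f).trans h.le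
  rw [det_diag_mul, abs_mul] at h1
  have hP : 1/(τ^r*z) ≤ ∏ i, bw n τ S (f i) := by
    unfold bw
    rw [prod_wt _ _ _ (by positivity) f hf, if_neg (by push Not; exact fun i => (hf0 i).1),
      if_neg (by push Not; exact fun i => (hf0 i).2), mul_one, mul_one, div_pow, one_pow, mul_pow,
      ← pow_mul]
    gcongr
    refine le_trans ?_ hz
    exact pow_le_pow_right₀ hS (Nat.mul_le_mul_left _ hr)
  have h3 := le_abs_self (∏ i, bw n τ S (f i))
  have h4 : 1/(τ^r*z) * |(Y.submatrix f id).det| ≤ 1 := by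
    refine le_trans ?_ h1
    gcongr; linarith
  rw [div_mul_eq_mul_div, div_le_one (by positivity)] at h4
  linarith

lemma cs {z A : ℝ} {r p u w y : ℕ} (hz : 0 < z) (hr : 1 ≤ r)
    (h : (1/z/r)^r ≤ z^p/z^u * (A*z^w/z^y)) : z^(u+y) ≤ (r^r*A) * z^(r+p+w) := by
  have hr0 : (0:ℝ) < r := by exact_mod_cast hr
  rw [div_pow, div_pow, one_pow, div_div, div_mul_div_comm, div_le_div_iff₀ (by positivity) (by positivity)] at h
  calc z^(u+y) = 1 * (z^u*z^y) := by ring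
    _ ≤ _ := h
    _ = _ := by ring

set_option maxHeartbeats 1000000 in
lemma core {n r' q : ℕ} (hn : n = r' + q) {c z C1 : ℝ} (hc : 0 < c) (hc1 : c ≤ 1) (hz : 1 ≤ z)
    (hC1 : 1 ≤ C1) (Y : Matrix (Fin (n+2)) (Fin (r'+1)) ℝ)
    (h0 : ∀ f : Fin (r'+1) → Fin (n+2), (∃ i, f i = 0) →
      |(Y.submatrix f id).det| ≤ z/(z^mE n)^(q+1))
    (h1 : ∀ f : Fin (r'+1) → Fin (n+2), (∃ i, f i = 1) → (∀ i, f i ≠ 0) →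
      |(Y.submatrix f id).det| ≤ C1*(z/(z^mE n)^(q+1)))
    (hN : ∀ f : Fin (r'+1) → Fin (n+2), (∀ i, f i ≠ 0 ∧ f i ≠ 1) →
      |(Y.submatrix f id).det| ≤ (z^mE n)^(r'+1)*z)
    (hmc : (c/(r'+1:ℕ))^(r'+1) ≤ mn Y)
    (hmz : (1/z/(r'+1:ℕ))^(r'+1) ≤ mn (Matrix.diagonal (bw n 1 z) * Y)) :
    z ≤ (n+2:ℕ)^(n+2) * ((n+2).factorial * C1^2 * ((n+2:ℕ)/c)^(n+2)) := by
  have hz0 : 0 < z := by linarith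
  set N : ℝ := ((n+2:ℕ):ℝ) with hNdef
  have hN1 : 1 ≤ N := by rw [hNdef]; exact_mod_cast (by omega)
  set Q : ℝ := (N/c)^(n+2) with hQdef
  have hNc : 1 ≤ N/c := by rw [one_le_div hc]; linarith
  have hQ : 1 ≤ Q := one_le_pow₀ hNc
  set F : ℝ := ((n+2).factorial : ℝ) with hF
  have hF1 : 1 ≤ F := by rw [hF]; exact_mod_cast Nat.factorial_pos _
  have hr0 : (0:ℝ) < (r'+1:ℕ) := by positivity
  have hrN : ((r'+1:ℕ):ℝ) ≤ N := by rw [hNdef]; exact_mod_cast (by omega)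
  have hmcQ : 1/Q ≤ mn Y := by
    refine le_trans ?_ hmc
    rw [div_pow, hQdef, one_div, ← inv_pow, inv_div, ← div_pow]
    calc (c/N)^(n+2) ≤ (c/N)^(r'+1) := by
          refine pow_le_pow_of_le_one (by positivity) ?_ (by omega)
          rw [div_le_one (by linarith)]; linarith
      _ ≤ _ := by gcongr
  have hrr : ((r'+1:ℕ):ℝ)^(r'+1) ≤ N^(n+2) := by
    calc ((r'+1:ℕ):ℝ)^(r'+1) ≤ N^(r'+1) := by gcongr
      _ ≤ _ := pow_le_pow_right₀ hN1 (by omega)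
  have hNN : 1 ≤ N^(n+2) := one_le_pow₀ hN1
  have hC2 : C1 ≤ C1^2 := by nlinarith
  have hFC : C1 ≤ F * C1^2 := by nlinarith
  have hFCQ : C1*Q ≤ F * C1^2 * Q := by gcongr
  have hFC1 : C1 ≤ F * C1^2 * Q := by nlinarith
  have hpos : 0 < mn Y := lt_of_lt_of_le (by positivity) hmcQ
  have hm23 : 23 ≤ mE n := by unfold mE; omega
  have hmuz : z/(z^mE n)^(q+1) ≤ 1/z := by
    rw [← pow_mul, div_le_div_iff₀ (by positivity) hz0, one_mul, ← pow_two]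
    refine pow_le_pow_right₀ hz ?_
    nlinarith
  obtain ⟨fs, hfs⟩ := exists_mn_eq Y hpos
  by_cases hav : ∀ i, fs i ≠ 0 ∧ fs i ≠ 1
  swap
  · have hb : mn Y ≤ C1 * (1/z) := by
      rw [← hfs]
      by_cases h00 : ∃ i, fs i = 0
      · have := h0 fs h00
        have h2 : 0 < 1/z := by positivity
        nlinarith
      · push Not at h00
        have : ∃ i, fs i = 1 := by
          by_contra hcon
          push Not at hcon
          exact hav fun i => ⟨h00 i, hcon i⟩
        refine (h1 fs this h00).trans ?_
        gcongr
    have h2 := hmcQ.trans hb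
    rw [mul_one_div, div_le_div_iff₀ (by positivity) hz0] at h2
    nlinarith
  have hboth : ∀ f : Fin (r'+1) → Fin (n+2), (∃ i, f i = 0) → (∃ i, f i = 1) →
      |(Y.submatrix f id).det| ≤ (F*C1^2*Q)*(z/(z^mE n)^(q+1))^2 := by
    intro f hf0 hf1
    have hmu : 0 ≤ z/(z^mE n)^(q+1) := by positivity
    refine (plucker Y fs (C1*(z/(z^mE n)^(q+1))) hpos hfs hav (by positivity)
      (fun f hf _ => (h0 f hf).trans (by nlinarith)) h1 f hf0 hf1).trans ?_
    have hfac : ((r'+1).factorial : ℝ) ≤ F := by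
      rw [hF]; exact_mod_cast Nat.factorial_le (by omega)
    have hinv : 1 / mn Y ≤ Q := by
      rw [div_le_iff₀ hpos]; rw [div_le_iff₀ (by positivity)] at hmcQ; linarith
    calc _ = ((r'+1).factorial : ℝ) * (C1*(z/(z^mE n)^(q+1)))^2 * (1/mn Y) := by ring
      _ ≤ F * (C1*(z/(z^mE n)^(q+1)))^2 * Q := by gcongr
      _ = _ := by ring
  have hp2 : 0 < mn (Matrix.diagonal (bw n 1 z) * Y) := lt_of_lt_of_le (by positivity) hmz
  obtain ⟨g, hg⟩ := exists_mn_eq _ hp2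
  have hgi : Function.Injective g := by
    by_contra hcon
    rw [det_submatrix_eq_zero _ g hcon] at hg; simp at hg; linarith
  rw [← hg, det_diag_mul, abs_mul, abs_of_pos (Finset.prod_pos fun i _ => bw_pos one_pos hz0 _)] at hmz
  unfold bw at hmz
  have hdn : dE n = mE n + 3 := rfl
  rw [prod_wt _ _ _ (by positivity) g hgi] at hmz
  simp only [one_pow, one_mul, div_one, one_div_one_div] at hmz
  have hfin : ∀ (A : ℝ), A ≤ F*C1^2*Q → ∀ p u w y : ℕ, 
      (1/z/(r'+1:ℕ))^(r'+1) ≤ z^p/z^u * (A*z^w/z^y) → r'+1+p+w+1 ≤ u+y → 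
      z ≤ N^(n+2) * (F*C1^2*Q) := by
    intro A hA p u w y h hle
    refine (pw hz (cs hz0 (by omega) h) hle).trans ?_
    have : (0:ℝ) ≤ F*C1^2*Q := by positivity
    exact mul_le_mul hrr hA (by
      by_contra hneg
      push Not at hneg
      have : z^p/z^u * (A*z^w/z^y) ≤ 0 := by
        apply mul_nonpos_of_nonneg_of_nonpos (by positivity)
        apply div_nonpos_of_nonpos_of_nonneg _ (by positivity)
        exact mul_nonpos_of_nonpos_of_nonneg hneg.le (by positivity)
      have h5 : 0 < (1/z/(r'+1:ℕ))^(r'+1) := by positivity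
      linarith) (by positivity)
  by_cases g0 : ∃ i, g i = 0 <;> by_cases g1 : ∃ i, g i = 1
  · have hr1 : 1 ≤ r' := by
      obtain ⟨i, hi⟩ := g0
      obtain ⟨j, hj⟩ := g1
      by_contra hcon
      have : r' = 0 := by omega
      subst this
      have : i = j := Fin.ext (by omega)
      subst this
      rw [hi] at hj; simp at hj
    obtain ⟨r'', rfl⟩ : ∃ r'', r' = r''+1 := ⟨r'-1, by omega⟩
    rw [if_pos g0, if_pos g1] at hmz
    refine hfin (F*C1^2*Q) le_rfl (bE n) (dE n*r'') 2 (mE n*(q+1)*2) ?_ ?_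
    · refine hmz.trans ?_
      refine le_trans (mul_le_mul_of_nonneg_left (hboth g g0 g1) (by positivity)) (le_of_eq ?_)
      rw [pow_mul z (dE n), pow_mul z, pow_mul z (mE n)]
      have hp : 0 < z^dE n := by positivity
      have hp' : 0 < z^mE n := by positivity
      generalize z^dE n = p at hp
      generalize z^mE n = p' at hp'
      rw [div_pow, one_pow]
      field_simp
      ring
    · subst hn; unfold bE mE dE; nlinarith
  · rw [if_pos g0, if_neg g1] at hmz
    refine hfin 1 (by linarith) 0 (dE n*r') 1 (mE n*(q+1)) ?_ ?_
    · refine hmz.trans ?_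
      refine le_trans (mul_le_mul_of_nonneg_left (h0 g g0) (by positivity)) (le_of_eq ?_)
      rw [pow_mul z (dE n), pow_mul z (mE n)]
      have hp : 0 < z^dE n := by positivity
      have hp' : 0 < z^mE n := by positivity
      generalize z^dE n = p at hp
      generalize z^mE n = p' at hp'
      rw [div_pow, one_pow]
      field_simp
      try ring
    · have e1 : 1 * r' ≤ dE n * r' := Nat.mul_le_mul_right _ (by rw [hdn]; omega)
      have e2 : 23 * 1 ≤ mE n * (q+1) := Nat.mul_le_mul hm23 (by omega)
      omega
  · rw [if_neg g0, if_pos g1] at hmz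
    push Not at g0
    refine hfin C1 hFC1 (bE n) (dE n*r') 1 (mE n*(q+1)) ?_ ?_
    · refine hmz.trans ?_
      refine le_trans (mul_le_mul_of_nonneg_left (h1 g g1 g0) (by positivity)) (le_of_eq ?_)
      rw [pow_mul z (dE n), pow_mul z (mE n)]
      have hp : 0 < z^dE n := by positivity
      have hp' : 0 < z^mE n := by positivity
      generalize z^dE n = p at hp
      generalize z^mE n = p' at hp'
      rw [div_pow, one_pow]
      field_simp
      try ring
    · subst hn; unfold bE mE dE; nlinarith
  · rw [if_neg g0, if_neg g1] at hmz
    push Not at g0 g1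
    refine hfin 1 (by linarith) 0 (dE n*(r'+1)) (mE n*(r'+1)+1) 0 ?_ ?_
    · refine hmz.trans ?_
      refine le_trans (mul_le_mul_of_nonneg_left (hN g fun i => ⟨g0 i, g1 i⟩) (by positivity)) (le_of_eq ?_)
      rw [pow_succ z, pow_mul z (dE n), pow_mul z (mE n)]
      have hp : 0 < z^dE n := by positivity
      have hp' : 0 < z^mE n := by positivity
      generalize z^dE n = p at hp
      generalize z^mE n = p' at hp'
      rw [div_pow, one_pow]
      field_simp
      try ring
    · rw [hdn]; nlinarith

end BB

namespace BB

noncomputable def Gm (n : ℕ) (T y : ℝ) : Matrix (Fin (n+2)) (Fin (n+2)) ℝ :=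
  Matrix.of fun k j => bw n T 1 k * U (n+2) y k j / bw n T 1 j

lemma Gm_mul {n r : ℕ} {T : ℝ} (hT : 0 < T) (x y : ℝ) (E : Matrix (Fin (n+2)) (Fin r) ℝ) :
    Hm n T 1 (x+y) * E = Gm n T y * (Hm n T 1 x * E) := by
  unfold Hm
  rw [U_add, ← Matrix.mul_assoc, ← Matrix.mul_assoc, ← Matrix.mul_assoc]
  congr 2
  ext k j
  rw [Matrix.mul_diagonal, Matrix.diagonal_mul, Gm, Matrix.of_apply,
    div_mul_cancel₀ _ (bw_pos hT one_pos j).ne']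

lemma bw_zero (n : ℕ) (T S : ℝ) : bw n T S 0 = T^(n+1) := by simp [bw, wt]

lemma bw_one (n : ℕ) (T : ℝ) {k : Fin (n+2)} (hk : k ≠ 0) : bw n T 1 k = 1/T := by
  simp [bw, wt, hk]

lemma fin_ge2 {n : ℕ} {k : Fin (n+2)} (h0 : k ≠ 0) (h1 : k ≠ 1) : 2 ≤ (k:ℕ) := by
  have a : (k:ℕ) ≠ 0 := fun h => h0 (Fin.ext (by simpa using h))
  have b : (k:ℕ) ≠ 1 := fun h => h1 (Fin.ext (by simpa using h))
  omega

lemma Gm_b {n : ℕ} {T y : ℝ} (hT : 0 < T) (hy : |y| ≤ 1) {k j : Fin (n+2)} (h0 : k ≠ 0)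
    (h1 : k ≠ 1) : |Gm n T y k j| ≤ 2^(n+1) := by
  have hk := fin_ge2 h0 h1
  rw [Gm, Matrix.of_apply]
  by_cases hj : (j:ℕ) < k
  · have : U (n+2) y k j = 0 := by
      simp [U, Nat.choose_eq_zero_of_lt hj]
    rw [this]; simp
  · have hj0 : j ≠ 0 := by
      intro h; subst h; simp at hj; omega
    rw [bw_one n T h0, bw_one n T hj0, mul_comm, mul_div_assoc, div_self (by positivity), mul_one]
    rw [U, Matrix.of_apply, abs_mul, abs_pow, Nat.abs_cast]
    have e1 : (((j:ℕ).choose (k:ℕ) : ℕ):ℝ) ≤ 2^(n+1) := by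
      have := Nat.choose_le_two_pow (j:ℕ) (k:ℕ)
      have h2 : (2:ℕ)^(j:ℕ) ≤ 2^(n+1) := Nat.pow_le_pow_right (by norm_num) (by omega)
      exact_mod_cast this.trans h2
    have e2 : |y|^((j:ℕ)-(k:ℕ)) ≤ 1 := pow_le_one₀ (abs_nonneg _) hy
    have : (0:ℝ) ≤ |y|^((j:ℕ)-(k:ℕ)) := by positivity
    nlinarith [pow_pos (show (0:ℝ) < 2 by norm_num) (n+1)]

lemma Gm_0 {n : ℕ} {T y : ℝ} (_hT : 0 < T) (k : Fin (n+2)) (hk : k ≠ 0) :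
    Gm n T y 0 k = T^(n+2) * y^(k:ℕ) := by
  rw [Gm, Matrix.of_apply, bw_zero, bw_one n T hk, U, Matrix.of_apply]
  simp
  ring

lemma Gm_00 {n : ℕ} {T y : ℝ} (hT : 0 < T) : Gm n T y 0 0 = 1 := by
  rw [Gm, Matrix.of_apply, U, Matrix.of_apply]
  simp
  exact (bw_pos hT one_pos 0).ne'

lemma local_sup (n : ℕ) (c s : ℝ) (hc : 0 < c) (hc1 : c ≤ 1) (hs : 0 < s) (hs1 : s ≤ 1) :
    ∃ z0 : ℝ, 1 ≤ z0 ∧ ∀ z, z0 ≤ z → ∀ T2, z^(mE n) ≤ T2 → ∀ S, 1 ≤ S → S^(dE n*(n+1)) ≤ z → ∀ x0,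
      (∀ v : Fin (n+2) → ℤ, v ≠ 0 → c ≤ ‖(Hm n T2 1 x0).mulVec (vr v)‖) →
      (∀ v : Fin (n+2) → ℤ, v ≠ 0 → 1/z ≤ ‖(Hm n T2 z x0).mulVec (vr v)‖) →
      ∀ r, 1 ≤ r → ∀ E : Matrix (Fin (n+2)) (Fin r) ℤ, Function.Injective (rl E).mulVec →
      1 ≤ mn (Hm n (T2*z^(mE n)) S x0 * rl E) ∨
      1 ≤ mn (Hm n (T2*z^(mE n)) S (x0+s/T2^(n+2)) * rl E) := by
  set C1 : ℝ := (((n+2:ℕ)*(2:ℝ)^(n+1))^(n+2) + 1 + (n+2:ℕ))/s with hC1d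
  have hN1 : (1:ℝ) ≤ (n+2:ℕ) := by exact_mod_cast (by omega)
  have hb1 : (1:ℝ) ≤ 2^(n+1) := one_le_pow₀ (by norm_num)
  have hNb : (1:ℝ) ≤ (n+2:ℕ)*(2:ℝ)^(n+1) := by nlinarith
  have hC1 : 1 ≤ C1 := by
    rw [hC1d, one_le_div hs]
    have : (1:ℝ) ≤ ((n+2:ℕ)*(2:ℝ)^(n+1))^(n+2) := one_le_pow₀ hNb
    linarith
  refine ⟨1 + (n+2:ℕ)^(n+2) * ((n+2).factorial * C1^2 * ((n+2:ℕ)/c)^(n+2)), ?_, ?_⟩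
  · have : 0 ≤ ((n+2:ℕ):ℝ)^(n+2) * ((n+2).factorial * C1^2 * ((n+2:ℕ)/c)^(n+2)) := by positivity
    linarith
  intro z hz T2 hT2 S hS hSz x0 hA hB r hr E hE
  have hz1 : 1 ≤ z := by
    have : 0 ≤ ((n+2:ℕ):ℝ)^(n+2) * ((n+2).factorial * C1^2 * ((n+2:ℕ)/c)^(n+2)) := by positivity
    linarith
  have hz0 : 0 < z := by linarith
  have hτ1 : 1 ≤ z^mE n := one_le_pow₀ hz1
  have hT1 : 1 ≤ T2 := hτ1.trans hT2
  have hT0 : 0 < T2 := by linarith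
  rcases (rank_le_of_inj _ hE).eq_or_lt with hrN | hrN
  · subst hrN
    exact Or.inl (full_sup n (by positivity) hS E hE)
  by_contra hcon
  push Not at hcon
  obtain ⟨hc0, hcy⟩ := hcon
  obtain ⟨r', rfl⟩ : ∃ r', r = r'+1 := ⟨r-1, by omega⟩
  obtain ⟨q, hq⟩ : ∃ q, n = r'+q := ⟨n-r', by omega⟩
  set y := s/T2^(n+2) with hy
  have hy0 : 0 < y := by positivity
  have hy1 : y ≤ 1 := by
    rw [hy, div_le_one (by positivity)]
    exact hs1.trans (one_le_pow₀ hT1)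
  set Y := Hm n T2 1 x0 * rl E with hY
  set Y' := Hm n T2 1 (x0+y) * rl E with hY'
  have e0 : mn (Matrix.diagonal (bw n (z^mE n) S) * Y) < 1 := by
    have := diag_bw_mul n (T := T2) (τ := z^mE n) (S := S) (U (n+2) x0 * rl E)
    rw [hY, Hm, Matrix.mul_assoc, ← this, ← Matrix.mul_assoc]; exact hc0
  have ey : mn (Matrix.diagonal (bw n (z^mE n) S) * Y') < 1 := by
    have := diag_bw_mul n (T := T2) (τ := z^mE n) (S := S) (U (n+2) (x0+y) * rl E)
    rw [hY', Hm, Matrix.mul_assoc, ← this, ← Matrix.mul_assoc]; exact hcy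
  have hYinj : Function.Injective Y.mulVec := inj_mul _ _ (Hm_inj hT0 one_pos) hE
  have hτ0 : 0 < z^mE n := by positivity
  have m0 := minor0 hq hτ0 hS hz0 hSz Y e0
  have m0' := minor0 hq hτ0 hS hz0 hSz Y' ey
  have mN := minorN (by omega) hτ0 hS hz0 hSz Y e0
  set μ := z/(z^mE n)^(q+1) with hμ
  have hμ0 : 0 < μ := by positivity
  have hyα : y * ((z^mE n)^(r'+1)*z) ≤ μ := by
    rw [hμ, le_div_iff₀ (by positivity), hy]
    calc _ = s * ((z^mE n)^(n+2) * z) / T2^(n+2) := by rw [hq]; field_simp; ring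
      _ ≤ 1 * (T2^(n+2)*z) / T2^(n+2) := by gcongr
      _ = z := by field_simp
  have h1 : ∀ f : Fin (r'+1) → Fin (n+2), (∃ i, f i = 1) → (∀ i, f i ≠ 0) →
      |(Y.submatrix f id).det| ≤ C1*μ := by
    intro f hf1 hf0
    have hGi : Y = Gm n T2 (-y) * Y' := by
      have := Gm_mul hT0 (x0+y) (-y) (rl E)
      rw [← this]; simp [hY]
    have hG0 : Y' 0 = ∑ k, Gm n T2 y 0 k • Y k := by
      have := Gm_mul hT0 x0 y (rl E)
      rw [hY', this]
      ext j
      simp [Matrix.mul_apply, hY]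
    have hk1 : (1 : Fin (n+2)) ≠ 0 := by simp
    have := class1_bound Y Y' (Gm n T2 (-y)) (Gm n T2 y 0) s y (2^(n+1)) μ ((z^mE n)^(r'+1)*z)
      hGi hG0 (Gm_00 hT0) (by rw [Gm_0 hT0 _ hk1, hy]; simp; field_simp) hs hy0.le hb1 hμ0.le
      (by positivity) (by
        intro k h0 h1
        have hk2 := fin_ge2 h0 h1
        rw [Gm_0 hT0 _ h0, abs_of_pos (by positivity)]
        obtain ⟨k', hk'⟩ : ∃ k', (k:ℕ) = k'+2 := ⟨k-2, by omega⟩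
        have hTy : T2^(n+2)*y = s := by rw [hy]; field_simp
        have : y^k' ≤ 1 := pow_le_one₀ hy0.le hy1
        calc T2^(n+2)*y^(k:ℕ) = (T2^(n+2)*y)*y*y^k' := by rw [hk']; ring
          _ = s*y*y^k' := by rw [hTy]
          _ ≤ s*y*1 := by gcongr
          _ = s*y := by ring)
      (fun k j h0 h1 => Gm_b hT0 (by rw [abs_neg, abs_of_pos hy0]; exact hy1) h0 h1)
      m0 m0' mN f hf1 hf0
    refine this.trans ?_
    have hpw : ((n+2:ℕ)*(2:ℝ)^(n+1))^(r'+1) ≤ ((n+2:ℕ)*(2:ℝ)^(n+1))^(n+2) :=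
      pow_le_pow_right₀ hNb (by omega)
    have e3 : ((n+2:ℕ):ℝ) * (y*((z^mE n)^(r'+1)*z)) ≤ (n+2:ℕ)*μ/s := by
      rw [le_div_iff₀ hs]
      have : 0 ≤ ((n+2:ℕ):ℝ) * (y*((z^mE n)^(r'+1)*z)) := by positivity
      nlinarith
    calc _ ≤ (((n+2:ℕ)*(2:ℝ)^(n+1))^(n+2)*μ + μ)/s + (n+2:ℕ)*μ/s := by gcongr
      _ = C1*μ := by rw [hC1d]; ring
  have hmc : (c/(r'+1:ℕ))^(r'+1) ≤ mn Y := by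
    refine minkowski_mn hr Y hYinj c hc fun v hv => ?_
    have hEv : (rl E).mulVec (vr v) = vr (E.mulVec v) := by
      ext i; simp [rl, vr, Matrix.mulVec, dotProduct]
    rw [hY, ← Matrix.mulVec_mulVec, hEv]
    apply hA
    intro h0
    rw [h0] at hEv
    have : vr v = 0 := hE (by rw [hEv]; ext i; simp [vr])
    exact hv (by ext i; have := congrFun this i; simpa [vr] using this)
  have hmz : (1/z/(r'+1:ℕ))^(r'+1) ≤ mn (Matrix.diagonal (bw n 1 z) * Y) := by
    have hd : Matrix.diagonal (bw n 1 z) * Y = Hm n T2 z x0 * rl E := by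
      have := diag_bw_mul n (T := T2) (τ := 1) (S := z) (U (n+2) x0 * rl E)
      rw [mul_one] at this
      rw [hY, Hm, Matrix.mul_assoc, ← this, ← Matrix.mul_assoc]; rfl
    rw [hd]
    refine minkowski_mn hr _ (inj_mul _ _ (Hm_inj hT0 hz0) hE) (1/z) (by positivity) fun v hv => ?_
    have hEv : (rl E).mulVec (vr v) = vr (E.mulVec v) := by
      ext i; simp [rl, vr, Matrix.mulVec, dotProduct]
    rw [← Matrix.mulVec_mulVec, hEv]
    apply hB
    intro h0
    rw [h0] at hEv
    have : vr v = 0 := hE (by rw [hEv]; ext i; simp [vr])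
    exact hv (by ext i; have := congrFun this i; simpa [vr] using this)
  have := core hq hc hc1 hz1 hC1 Y m0 h1 mN hmc hmz
  linarith

end BB

namespace BB

lemma pert_entry {n : ℕ} {T S h : ℝ} (hT : 1 ≤ T) (hS : 1 ≤ S) (hST : S^(bE n+dE n) ≤ T^(n+2))
    (hh : |h| ≤ 1/T^(n+2)) (k j : Fin (n+2)) :
    |bw n T S k * U (n+2) h k j / bw n T S j| ≤ 2^(n+1) := by
  have hT0 : 0 < T := by linarith
  have hS0 : 0 < S := by linarith
  have hTn : 1 ≤ T^(n+2) := one_le_pow₀ hT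
  have hh1 : |h| ≤ 1 := hh.trans (by rw [div_le_one (by positivity)]; exact hTn)
  have hbk := bw_pos (n := n) hT0 hS0 k
  have hbj := bw_pos (n := n) hT0 hS0 j
  by_cases hj : (j:ℕ) < k
  · have : U (n+2) h k j = 0 := by
      simp [U, Nat.choose_eq_zero_of_lt hj]
    rw [this]; simp
  push Not at hj
  have e1 : (((j:ℕ).choose (k:ℕ) : ℕ):ℝ) ≤ 2^(n+1) := by
    have := Nat.choose_le_two_pow (j:ℕ) (k:ℕ)
    have h2 : (2:ℕ)^(j:ℕ) ≤ 2^(n+1) := Nat.pow_le_pow_right (by norm_num) (by omega)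
    exact_mod_cast this.trans h2
  have key : bw n T S k * |h|^((j:ℕ)-(k:ℕ)) ≤ bw n T S j := by
    rcases hj.eq_or_lt with hkj | hkj
    · have : k = j := Fin.ext hkj
      subst this; simp
    have hp1 : |h|^((j:ℕ)-(k:ℕ)) ≤ 1/T^(n+2) := by
      refine le_trans ?_ hh
      calc |h|^((j:ℕ)-(k:ℕ)) ≤ |h|^1 := pow_le_pow_of_le_one (abs_nonneg _) hh1 (by omega)
        _ = |h| := pow_one _
    have hj0 : j ≠ 0 := by intro h; subst h; simp at hkj
    have hSB : 1 ≤ S^bE n := one_le_pow₀ hS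
    have hSD : 1 ≤ S^dE n := one_le_pow₀ hS
    rw [pow_add] at hST
    by_cases hk0 : k = 0
    · subst hk0
      rw [bw_zero]
      by_cases hj1 : j = 1
      · subst hj1
        have : bw n T S 1 = S^bE n/T := by simp [bw, wt]
        rw [this]
        calc T^(n+1) * _ ≤ T^(n+1) * (1/T^(n+2)) := by gcongr
          _ = 1/T := by field_simp; ring
          _ ≤ _ := by gcongr
      · have hj2 := fin_ge2 hj0 hj1
        have : bw n T S j = 1/(T*S^dE n) := by simp [bw, wt, hj0, hj1]
        rw [this]
        have hp2 : |h|^((j:ℕ)-((0:Fin (n+2)):ℕ)) ≤ (1/T^(n+2))^2 := by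
          calc _ ≤ |h|^2 := pow_le_pow_of_le_one (abs_nonneg _) hh1 (by simpa using hj2)
            _ ≤ _ := by gcongr
        have hSDT : S^dE n ≤ T^(n+2) := by nlinarith
        calc T^(n+1) * _ ≤ T^(n+1) * (1/T^(n+2))^2 := by gcongr
          _ = 1/(T*T^(n+2)) := by field_simp; ring
          _ ≤ _ := by gcongr
    · have hj1 : j ≠ 1 := by
        intro h; subst h
        have : (k:ℕ) = 0 := by simpa using hkj
        exact hk0 (Fin.ext (by simpa using this))
      have hbj' : bw n T S j = 1/(T*S^dE n) := by simp [bw, wt, hj0, hj1]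
      by_cases hk1 : k = 1
      · have : bw n T S k = S^bE n/T := by simp [bw, wt, hk1]
        rw [this, hbj']
        calc S^bE n/T * _ ≤ S^bE n/T * (1/T^(n+2)) := by gcongr
          _ ≤ S^bE n/T * (1/(S^bE n*S^dE n)) := by gcongr
          _ = _ := by field_simp
      · have : bw n T S k = 1/(T*S^dE n) := by simp [bw, wt, hk0, hk1]
        rw [this, hbj']
        have : |h|^((j:ℕ)-(k:ℕ)) ≤ 1 := pow_le_one₀ (abs_nonneg _) hh1
        have h5 : 0 < 1/(T*S^dE n) := by positivity
        nlinarith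
  rw [abs_div, abs_mul, abs_of_pos hbk, abs_of_pos hbj, div_le_iff₀ hbj, U, Matrix.of_apply, abs_mul,
    abs_pow, Nat.abs_cast]
  calc bw n T S k * (((j:ℕ).choose (k:ℕ) : ℕ) * |h|^((j:ℕ)-(k:ℕ)))
      = ((j:ℕ).choose (k:ℕ) : ℕ) * (bw n T S k * |h|^((j:ℕ)-(k:ℕ))) := by ring
    _ ≤ 2^(n+1) * bw n T S j := by gcongr

lemma pert {n : ℕ} {T S : ℝ} (hT : 1 ≤ T) (hS : 1 ≤ S) (hST : S^(bE n+dE n) ≤ T^(n+2))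
    (x y : ℝ) (hh : |x - y| ≤ 1/T^(n+2)) (w : Fin (n+2) → ℝ) :
    ‖(Hm n T S x).mulVec w‖ ≤ ((n+2:ℕ) * 2^(n+1)) * ‖(Hm n T S y).mulVec w‖ := by
  have hT0 : 0 < T := by linarith
  have hS0 : 0 < S := by linarith
  obtain ⟨h, rfl⟩ : ∃ h, x = y + h := ⟨x - y, by ring⟩
  rw [add_sub_cancel_left] at hh
  set u := (Hm n T S y).mulVec w with hu
  have hG : (Hm n T S (y+h)).mulVec w =
      (Matrix.of fun k j => bw n T S k * U (n+2) h k j / bw n T S j).mulVec u := by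
    rw [hu, Matrix.mulVec_mulVec]
    congr 1
    unfold Hm
    rw [U_add, ← Matrix.mul_assoc, ← Matrix.mul_assoc]
    congr 1
    ext k j
    rw [Matrix.mul_diagonal, Matrix.diagonal_mul, Matrix.of_apply,
      div_mul_cancel₀ _ (bw_pos hT0 hS0 j).ne']
  rw [hG, pi_norm_le_iff_of_nonneg (by positivity)]
  intro k
  rw [Matrix.mulVec, dotProduct, Real.norm_eq_abs]
  refine (Finset.abs_sum_le_sum_abs _ _).trans ?_
  calc _ ≤ ∑ j : Fin (n+2), 2^(n+1) * ‖u‖ := by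
        refine Finset.sum_le_sum fun j _ => ?_
        rw [abs_mul]
        have h1 := pert_entry hT hS hST hh k j
        have h2 : |u j| ≤ ‖u‖ := norm_le_pi_norm u j
        rw [Matrix.of_apply]
        gcongr
    _ = _ := by simp; ring

lemma Hm_poly (n : ℕ) (T S : ℝ) : ∃ Hp : Matrix (Fin (n+2)) (Fin (n+2)) (Polynomial ℝ),
    (∀ i j, (Hp i j).natDegree ≤ n+1) ∧ ∀ x, ev Hp x = Hm n T S x := by
  refine ⟨Matrix.of fun i j => Polynomial.C (bw n T S i * ((j:ℕ).choose (i:ℕ) : ℝ)) *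
    Polynomial.X^((j:ℕ)-(i:ℕ)), ?_, ?_⟩
  · intro i j
    rw [Matrix.of_apply]
    refine (Polynomial.natDegree_C_mul_X_pow_le _ _).trans ?_
    omega
  · intro x
    ext i j
    simp [ev, Hm, U, Matrix.diagonal_mul]
    ring

lemma count_meas (x0 ℓ w : ℝ) (hℓ : 0 < ℓ) (hw : 0 ≤ w) (M p k a : ℕ) (hM : 1 ≤ M) (G : Set ℝ)
    (hG : volume {x ∈ Set.Ico (x0+ℓ*a/M^p) (x0+ℓ*(a+1)/M^p) | x ∈ G} ≤
      ENNReal.ofReal (w * (x0+ℓ*(a+1)/M^p - (x0+ℓ*a/M^p))))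
    (s : Finset ℕ) (hs : s ⊆ Finset.Ico (a*M^k) ((a+1)*M^k))
    (hsG : ∀ b ∈ s, Set.Icc (x0+ℓ*b/M^(p+k)) (x0+ℓ*(b+1)/M^(p+k)) ⊆ G) :
    (s.card : ℝ) ≤ w * M^k := by
  have hM0 : (0:ℝ) < M := by exact_mod_cast hM
  set A : ℕ → Set ℝ := fun b => Set.Ico (x0+ℓ*b/M^(p+k)) (x0+ℓ*(b+1)/M^(p+k)) with hA
  have hdisj : Set.PairwiseDisjoint (s : Set ℕ) A := by
    intro b _ b' _ hbb
    have : ∀ b b' : ℕ, b < b' → Disjoint (A b) (A b') := by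
      intro b b' h
      rw [Set.disjoint_left]
      intro x hx hx'
      have h1 := hx.2
      have h2 := hx'.1
      have h3 : (b:ℝ)+1 ≤ b' := by exact_mod_cast h
      have : ℓ*((b:ℝ)+1)/M^(p+k) ≤ ℓ*b'/M^(p+k) := by gcongr
      linarith
    rcases lt_or_gt_of_ne hbb with h | h
    · exact this _ _ h
    · exact (this _ _ h).symm
  have hv : volume (⋃ b ∈ s, A b) = ∑ b ∈ s, volume (A b) :=
    measure_biUnion_finset hdisj fun b _ => measurableSet_Ico
  have hsub : (⋃ b ∈ s, A b) ⊆ {x ∈ Set.Ico (x0+ℓ*a/M^p) (x0+ℓ*(a+1)/M^p) | x ∈ G} := by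
    intro x hx
    simp only [Set.mem_iUnion] at hx
    obtain ⟨b, hb, hxb⟩ := hx
    have hbI := Finset.mem_Ico.1 (hs hb)
    refine ⟨⟨?_, ?_⟩, hsG b hb ⟨hxb.1, hxb.2.le⟩⟩
    · refine le_trans ?_ hxb.1
      have : (a:ℝ)*M^k ≤ b := by exact_mod_cast hbI.1
      have h2 : ℓ*a/M^p = ℓ*(a*M^k)/M^(p+k) := by rw [pow_add]; field_simp
      rw [h2]; gcongr
    · refine lt_of_lt_of_le hxb.2 ?_
      have : (b:ℝ)+1 ≤ (a+1)*M^k := by exact_mod_cast hbI.2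
      have h2 : ℓ*((a:ℝ)+1)/M^p = ℓ*((a+1)*M^k)/M^(p+k) := by rw [pow_add]; field_simp
      rw [h2]; gcongr
  have h1 := (measure_mono hsub).trans hG
  rw [hv] at h1
  have h2 : ∀ b ∈ s, volume (A b) = ENNReal.ofReal (ℓ/M^(p+k)) := by
    intro b _
    rw [hA, Real.volume_Ico]
    congr 1; ring
  rw [Finset.sum_congr rfl h2, Finset.sum_const, nsmul_eq_mul, ← ENNReal.ofReal_natCast,
    ← ENNReal.ofReal_mul (by positivity)] at h1
  have h3 : 0 ≤ w * (x0+ℓ*(a+1)/M^p - (x0+ℓ*a/M^p)) := by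
    apply mul_nonneg hw
    have : x0+ℓ*(a+1)/M^p - (x0+ℓ*a/M^p) = ℓ/M^p := by ring
    rw [this]; positivity
  have h4 := (ENNReal.ofReal_le_ofReal_iff h3).1 h1
  have h5 : w * (x0+ℓ*(a+1)/M^p - (x0+ℓ*a/M^p)) = w*M^k*(ℓ/M^(p+k)) := by
    rw [pow_add]; field_simp; ring
  rw [h5] at h4
  exact le_of_mul_le_mul_right h4 (by positivity)

end BB

namespace BB

lemma num {K Λ δ ρ κ : ℝ} {d e J j k : ℕ} (hK : 1 ≤ K) (hΛ : 1 ≤ Λ) (hδ : 0 < δ) (hδ1 : δ ≤ 1)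
    (hρ : 0 < ρ) (hρ1 : ρ ≤ 1) (hJ : 1 ≤ J) (hj : j ≤ J) (hk : k ≤ e*J)
    (hκ : κ ≤ (ρ*((δ/K)/(4*8^e))^d/(2*K*Λ))^J) :
    K*(Λ*κ) < ρ*(δ/2^(j+1)/8^k/K)^d := by
  have hK0 : 0 < K := by linarith
  have hΛ0 : 0 < Λ := by linarith
  have hdK : δ/K ≤ 1 := by rw [div_le_one hK0]; linarith
  set x := (δ/K)/(4*8^e) with hx
  have hx0 : 0 < x := by positivity
  set θ := ρ*x^d with hθ
  have hθ0 : 0 < θ := by positivity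
  have hKL : 1 ≤ K*Λ := by nlinarith
  have h1 : K*(Λ*κ) ≤ θ^J/2 := by
    have : (2*K*Λ) ≤ (2*K*Λ)^J := by
      calc 2*K*Λ = (2*K*Λ)^1 := (pow_one _).symm
        _ ≤ _ := pow_le_pow_right₀ (by nlinarith) hJ
    calc K*(Λ*κ) ≤ K*(Λ*(θ^J/(2*K*Λ)^J)) := by rw [div_pow] at hκ; gcongr
      _ ≤ K*(Λ*(θ^J/(2*K*Λ))) := by gcongr
      _ = θ^J/2 := by field_simp
  have h2 : θ^J ≤ ρ*(δ/2^(j+1)/8^k/K)^d := by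
    rw [hθ, mul_pow, ← pow_mul, mul_comm d J, pow_mul]
    have e1 : ρ^J ≤ ρ := by
      calc ρ^J ≤ ρ^1 := pow_le_pow_of_le_one hρ.le hρ1 hJ
        _ = ρ := pow_one _
    have e2 : x^J ≤ δ/2^(j+1)/8^k/K := by
      have e3 : (δ/K)^J ≤ δ/K := by
        calc (δ/K)^J ≤ (δ/K)^1 := pow_le_pow_of_le_one (by positivity) hdK hJ
          _ = _ := pow_one _
      have e4 : (2:ℝ)^(j+1)*8^k ≤ (4*8^e)^J := by
        rw [mul_pow, ← pow_mul, show (4:ℝ) = 2^2 by norm_num, ← pow_mul]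
        gcongr
        · norm_num
        · omega
        · norm_num
      calc x^J = (δ/K)^J/(4*8^e)^J := by rw [hx, div_pow]
        _ ≤ (δ/K)/(2^(j+1)*8^k) := by gcongr
        _ = _ := by field_simp
    gcongr
  have : 0 < θ^J := by positivity
  linarith

lemma geo (t : ℕ) : ∑ j ∈ Finset.range t, (1:ℝ)/2^(j+1) ≤ 1 := by
  have : ∑ j ∈ Finset.range t, (1:ℝ)/2^(j+1) = 1 - 1/2^t := by
    induction t with
    | zero => simp
    | succ t ih => rw [Finset.sum_range_succ, ih]; field_simp; ring
  rw [this]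
  have : (0:ℝ) < 1/2^t := by positivity
  linarith

lemma exists_root (M : ℝ) (k : ℕ) (hk : k ≠ 0) (y : ℝ) (hy : 0 ≤ y) (h : y^k ≤ M) :
    ∃ r, y ≤ r ∧ r^k = M := by
  have hM : 0 ≤ M := le_trans (by positivity) h
  refine ⟨M^((k:ℝ)⁻¹), ?_, Real.rpow_inv_natCast_pow hM hk⟩
  rw [← pow_le_pow_iff_left₀ hy (by positivity) hk, Real.rpow_inv_natCast_pow hM hk]
  exact h

def iiE (n j : ℕ) : ℕ := if j = 0 then 1 else dE n*(n+1)*j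
def ancE (n q j : ℕ) : ℕ := if (2*(n+1)+1)*iiE n j ≤ q then q - iiE n j else 0

lemma iiE_pos (n j : ℕ) : 1 ≤ iiE n j := by
  unfold iiE; split_ifs with h
  · exact le_rfl
  · have : 1 ≤ j := by omega
    have h2 : 1 ≤ dE n := by unfold dE; omega
    exact Nat.mul_pos (Nat.mul_pos h2 (by omega)) this

lemma iiE_le (n j : ℕ) : iiE n j ≤ dE n*(n+1)*(max 1 j) := by
  unfold iiE; split_ifs with h
  · subst h
    have h2 : 1 ≤ dE n := by unfold dE; omega
    exact Nat.mul_pos (Nat.mul_pos h2 (by omega)) (by simp)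
  · exact Nat.mul_le_mul_left _ (le_max_right _ _)

lemma iiE_ge (n j : ℕ) : dE n*(n+1)*j ≤ iiE n j := by
  unfold iiE; split_ifs with h
  · subst h; simp
  · exact le_rfl

lemma ancE_lt (n q j : ℕ) (hq : 1 ≤ q) : ancE n q j < q := by
  have := iiE_pos n j
  unfold ancE; split_ifs <;> omega

noncomputable def kap (c ϱ : ℝ) (j : ℕ) : ℝ := if j = 0 then c else 1/ϱ^j

def Cnd (n : ℕ) (c ϱ : ℝ) (q j : ℕ) (x : ℝ) : Prop :=
  ∀ v : Fin (n+2) → ℤ, v ≠ 0 → kap c ϱ j ≤ ‖(Hm n (ϱ^(mE n*q)) (ϱ^j) x).mulVec (vr v)‖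

def Fb (n : ℕ) (c ϱ x0 ℓ : ℝ) (M q p b : ℕ) : Prop :=
  ∃ j, 2*(n+1)*j ≤ q ∧ ancE n q j = p ∧
    ∃ y ∈ Set.Icc (x0+ℓ*b/M^q) (x0+ℓ*(b+1)/M^q), ¬ Cnd n c ϱ q j y

set_option maxHeartbeats 1000000 in
lemma degree_scheme (n : ℕ) (x0 ℓ δ : ℝ) (hℓ : 0 < ℓ) (hℓ1 : ℓ ≤ 1) (hδ : 0 < δ) (hδ1 : δ ≤ 1) :
    ∃ M0 : ℕ, ∀ M : ℕ, M0 ≤ M → ∃ F : ℕ → ℕ → ℕ → Prop,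
      (∀ p a, a < M^p → (∀ p' < p, ¬ F p p' a) → ∀ k, 1 ≤ k → ∀ s : Finset ℕ,
        s ⊆ Finset.Ico (a*M^k) ((a+1)*M^k) → (∀ b ∈ s, F (p+k) p b) →
        (s.card : ℝ) ≤ δ*(M/8)^k) ∧
      ∃ R c : ℝ, 0 < c ∧ 1 < R ∧ R^(n+2) = M ∧
        ∀ (q b : ℕ) (x : ℝ), 1 ≤ q → x ∈ Set.Icc (x0+ℓ*b/M^q) (x0+ℓ*(b+1)/M^q) → (∀ p < q, ¬ F q p b) →
          ∀ v : Fin (n+2) → ℤ, v ≠ 0 → c ≤ ‖(Hm n (R^q) 1 x).mulVec (vr v)‖ := by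
  obtain ⟨K, hK, hqnd⟩ := qnd (n+2) (n+1) (by omega) (by omega)
  obtain ⟨cI, hcI, hcI1, hglob⟩ := global_sup n x0 (x0+ℓ) (by linarith) (by linarith)
  have hK0 : 0 < K := by linarith
  set d := (n+2)*(n+1) with hd
  set e := (2*(n+1)+1)*(dE n*(n+1)) with he
  set Λ : ℝ := (n+2:ℕ)*2^(n+1) with hΛd
  have hΛ : 1 ≤ Λ := by
    have h1 : (1:ℝ) ≤ (n+2:ℕ) := by exact_mod_cast (by omega)
    have h2 : (1:ℝ) ≤ 2^(n+1) := one_le_pow₀ (by norm_num)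
    rw [hΛd]; nlinarith
  have hΛ0 : 0 < Λ := by linarith
  set c : ℝ := cI*((δ/K)/(4*8^e))^d/(2*K*Λ) with hc
  have hc0 : 0 < c := by positivity
  have hc1 : c ≤ 1 := by
    rw [hc, div_le_one (by positivity)]
    have h1 : ((δ/K)/(4*8^e))^d ≤ 1 := by
      refine pow_le_one₀ (by positivity) ?_
      rw [div_div, div_le_one (by positivity)]
      have : (1:ℝ) ≤ 8^e := one_le_pow₀ (by norm_num)
      nlinarith
    have h2 : 0 < ((δ/K)/(4*8^e))^d := by positivity
    have h3 : 1 ≤ K*Λ := by nlinarith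
    nlinarith
  obtain ⟨z0, hz0, hloc⟩ := local_sup n c (ℓ/2) hc0 hc1 (by linarith) (by linarith)
  set ϱ0 := max z0 (1/c) + 1 with hϱ0
  have hzrho : z0 ≤ ϱ0 := (le_max_left _ _).trans (by linarith)
  have hcrho : 1/c ≤ ϱ0 := (le_max_right _ _).trans (by linarith)
  have hϱ01 : 1 < ϱ0 := by
    have := le_max_left z0 (1/c)
    linarith
  obtain ⟨M0, hM0⟩ := exists_nat_ge (ϱ0^(mE n*(n+2)))
  refine ⟨M0, fun M hM => ?_⟩
  have hm1 : 1 ≤ mE n := by unfold mE; omega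
  obtain ⟨ϱ, hϱ, hϱM⟩ := exists_root (M:ℝ) (mE n*(n+2)) (by positivity) ϱ0 (by linarith)
    (hM0.trans (by exact_mod_cast hM))
  have hϱ1 : 1 < ϱ := by linarith
  have hϱ10 : 0 < ϱ := by linarith
  have hMpos : (0:ℝ) < M := by rw [← hϱM]; positivity
  have hM1 : 1 ≤ M := by exact_mod_cast hMpos
  have hkap : ∀ j, kap c ϱ j ≤ c^(max 1 j) := by
    intro j
    unfold kap
    split_ifs with h
    · subst h; simp
    · rw [max_eq_right (by omega), one_div, ← inv_pow]
      gcongr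
      rw [inv_le_comm₀ hϱ10 hc0, ← one_div]
      linarith
  have hkap0 : ∀ j, 0 < kap c ϱ j := by
    intro j; unfold kap; split_ifs <;> positivity
  have hTM : ∀ q, (ϱ^(mE n*q))^(n+2) = (M:ℝ)^q := by
    intro q
    rw [← pow_mul, ← hϱM, ← pow_mul]; congr 1; ring
  refine ⟨Fb n c ϱ x0 ℓ M, ?_, ϱ^mE n, c, hc0, one_lt_pow₀ hϱ1 (by omega), ?_, ?_⟩
  rotate_left
  · rw [← pow_mul, hϱM]
  · intro q b x hq hx hF v hv
    by_contra hcon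
    refine hF (ancE n q 0) (ancE_lt n q 0 hq) ⟨0, by simp, rfl, x, hx, ?_⟩
    intro hC
    apply hcon
    have := hC v hv
    simpa [kap, pow_mul] using this
  intro p a ha hnF k hk s hs hsF
  classical
  set P : ℕ → ℕ → Prop := fun j b => 2*(n+1)*j ≤ p+k ∧ ancE n (p+k) j = p ∧
    ∃ y ∈ Set.Icc (x0+ℓ*b/M^(p+k)) (x0+ℓ*(b+1)/M^(p+k)), ¬ Cnd n c ϱ (p+k) j y with hP
  have hcover : s ⊆ (Finset.range (p+k+1)).biUnion fun j => s.filter (P j) := by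
    intro b hb
    obtain ⟨j, h1, h2, h3⟩ := hsF b hb
    rw [Finset.mem_biUnion]
    refine ⟨j, ?_, Finset.mem_filter.2 ⟨hb, h1, h2, h3⟩⟩
    rw [Finset.mem_range]
    nlinarith
  have hj : ∀ j, ((s.filter (P j)).card : ℝ) ≤ (1/2^(j+1))*(δ*(M/8)^k) := by
    intro j
    rcases (s.filter (P j)).eq_empty_or_nonempty with h0 | ⟨b0, hb0⟩
    · rw [h0]; simp; positivity
    obtain ⟨h2g, hanc, _⟩ := (Finset.mem_filter.1 hb0).2
    set ω := δ/2^(j+1)/8^k/K with hω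
    have hω0 : 0 < ω := by positivity
    set T := ϱ^(mE n*(p+k)) with hT
    have hT1 : 1 ≤ T := one_le_pow₀ hϱ1.le
    have hS1 : 1 ≤ ϱ^j := one_le_pow₀ hϱ1.le
    have hST : (ϱ^j)^(bE n+dE n) ≤ T^(n+2) := by
      rw [hT, ← pow_mul, ← pow_mul]
      refine pow_le_pow_right₀ hϱ1.le ?_
      have e1 : mE n*(2*(n+1)*j)*(n+2) ≤ mE n*(p+k)*(n+2) := by gcongr
      refine le_trans ?_ e1
      have e2 : bE n + dE n ≤ mE n*(2*(n+1))*(n+2) := by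
        unfold bE dE mE; nlinarith [sq_nonneg n, Nat.zero_le (n^3)]
      calc j*(bE n+dE n) ≤ j*(mE n*(2*(n+1))*(n+2)) := by gcongr
        _ = _ := by ring
    set G : Set ℝ := {x | ∃ v : Fin (n+2) → ℤ, v ≠ 0 ∧
      ‖(Hm n T (ϱ^j) x).mulVec (vr v)‖ < Λ*kap c ϱ j} with hG
    have hwM : K*ω*M^k = (1/2^(j+1))*(δ*(M/8)^k) := by
      rw [hω, div_pow]; field_simp
    rw [← hwM]
    refine count_meas x0 ℓ (K*ω) hℓ (by positivity) M p k a hM1 G ?_ _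
      ((Finset.filter_subset _ _).trans hs) ?_
    · -- measure estimate
      obtain ⟨Hp, hHp, hHe⟩ := Hm_poly n T (ϱ^j)
      have hkJ : k ≤ e*(max 1 j) := by
        have h1 := iiE_le n j
        have h2 : 1 ≤ max 1 j := le_max_left _ _
        have h3 : (2*(n+1)+1)*iiE n j ≤ e*(max 1 j) := by
          rw [he, mul_assoc]; gcongr
        unfold ancE at hanc
        split_ifs at hanc with hc
        · have : k = iiE n j := by
            have := iiE_pos n j
            nlinarith [Nat.sub_add_cancel (show iiE n j ≤ p+k by nlinarith)]
          rw [this]; nlinarith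
        · omega
      have hnum := num (κ := kap c ϱ j) hK hΛ hδ hδ1 hcI hcI1 (le_max_left 1 j) (le_max_right 1 j) hkJ
        (by rw [← hc]; exact hkap j)
      rw [← hω] at hnum
      have hMp : (0:ℝ) < M^p := by positivity
      have hlt : x0+ℓ*a/M^p < x0+ℓ*(a+1)/M^p := by
        have : ℓ*a/M^p < ℓ*(a+1)/M^p := by gcongr; linarith
        linarith
      have hmain : ∃ ρ : ℝ, 0 < ρ ∧ ρ ≤ 1 ∧ cI ≤ ρ ∧ ∀ r, 1 ≤ r → 
          ∀ E : Matrix (Fin (n+2)) (Fin r) ℤ, Function.Injective (rl E).mulVec →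
          ∃ x ∈ Set.Ico (x0+ℓ*a/M^p) (x0+ℓ*(a+1)/M^p), ρ ≤ mn (ev Hp x * rl E) := by
        by_cases hcase : (2*(n+1)+1)*iiE n j ≤ p+k
        · refine ⟨1, one_pos, le_rfl, hcI1, ?_⟩
          have hik : iiE n j = k := by
            rw [ancE, if_pos hcase] at hanc
            have := Nat.sub_add_cancel (show iiE n j ≤ p+k by nlinarith [iiE_pos n j])
            omega
          rw [hik] at hcase
          have hpk : 2*(n+1)*k ≤ p := by nlinarith
          have hp1 : 1 ≤ p := by nlinarith
          have hkp : k ≤ p := by nlinarith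
          intro r hr E hE
          set xl := x0+ℓ*a/M^p with hxl
          have hxl_mem : xl ∈ Set.Icc (x0+ℓ*a/M^p) (x0+ℓ*(a+1)/M^p) := ⟨le_rfl, hlt.le⟩
          have hC : ∀ i, 2*(n+1)*i ≤ p → Cnd n c ϱ p i xl := by
            intro i hi
            by_contra hcon
            exact hnF (ancE n p i) (ancE_lt n p i hp1) ⟨i, hi, rfl, xl, hxl_mem, hcon⟩
          have hTe : T = ϱ^(mE n*p) * (ϱ^k)^mE n := by
            rw [hT, ← pow_mul, ← pow_add]; congr 1; ring
          have := hloc (ϱ^k) (by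
              calc z0 ≤ ϱ^1 := by rw [pow_one]; linarith
                _ ≤ ϱ^k := pow_le_pow_right₀ hϱ1.le hk) (ϱ^(mE n*p)) (by
              rw [← pow_mul]; exact pow_le_pow_right₀ hϱ1.le (by rw [mul_comm]; gcongr)) (ϱ^j) hS1
              (by
                rw [← pow_mul]; refine pow_le_pow_right₀ hϱ1.le ?_
                have := iiE_ge n j
                rw [hik] at this
                linarith) xl
              (by
                intro v hv
                have := hC 0 (by simp) v hv
                simpa [kap] using this)
              (by
                intro v hv
                have := hC k hpk v hv
                rwa [kap, if_neg (by omega)] at this) r hr E hE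
          rw [← hTe, hTM] at this
          rcases this with h | h
          · exact ⟨xl, ⟨le_rfl, hlt⟩, by rw [hHe]; exact h⟩
          · refine ⟨xl+ℓ/2/M^p, ⟨?_, ?_⟩, by rw [hHe]; exact h⟩
            · have : 0 < ℓ/2/M^p := by positivity
              linarith
            · rw [hxl]
              have : ℓ*(a+1)/M^p = ℓ*a/M^p + ℓ/2/M^p + ℓ/2/M^p := by field_simp; ring
              have h3 : 0 < ℓ/2/M^p := by positivity
              linarith
        · refine ⟨cI, hcI, hcI1, le_rfl, ?_⟩
          rw [ancE, if_neg hcase] at hanc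
          subst hanc
          have ha0 : a = 0 := by simpa using ha
          subst ha0
          intro r hr E hE
          obtain ⟨x, hx, hx2⟩ := hglob T (ϱ^j) hT1 hS1 (by
            rw [hT, ← pow_mul]
            refine pow_le_pow_right₀ hϱ1.le ?_
            have e1 : mE n*(2*(n+1)*j) ≤ mE n*(0+k) := by gcongr
            refine le_trans ?_ e1
            have e2 : dE n*n ≤ mE n*(2*(n+1)) := by unfold dE mE; nlinarith
            calc j*(dE n*n) ≤ j*(mE n*(2*(n+1))) := by gcongr
              _ = _ := by ring) r hr E hE
          refine ⟨x, ?_, by rw [hHe]; exact hx2⟩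
          simpa using hx
      obtain ⟨ρ, hρ0, hρ1, hρc, hsup⟩ := hmain
      have := hqnd Hp hHp _ _ ρ (Λ*kap c ϱ j) ω hlt hρ0 hρ1 (mul_pos hΛ0 (hkap0 j)) hω0 hsup
        (hnum.trans_le (by gcongr))
      refine le_trans (le_of_eq ?_) this
      congr 1
      ext x
      simp only [hG, hHe, Set.mem_ofPred_eq]
    · intro b hb x hx
      obtain ⟨_, _, y, hy, hC⟩ := (Finset.mem_filter.1 hb).2
      unfold Cnd at hC
      push Not at hC
      obtain ⟨v, hv, hlt⟩ := hC
      refine ⟨v, hv, ?_⟩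
      have hxy : |x - y| ≤ 1/T^(n+2) := by
        rw [hT, hTM, abs_le]
        have h1 := hx.1
        have h2 := hx.2
        have h3 := hy.1
        have h4 := hy.2
        have h5 : ℓ*((b:ℝ)+1)/M^(p+k) = ℓ*b/M^(p+k) + ℓ/M^(p+k) := by ring
        have h6 : ℓ/M^(p+k) ≤ 1/(M:ℝ)^(p+k) := by gcongr
        constructor <;> linarith
      refine (pert hT1 hS1 hST x y hxy (vr v)).trans_lt ?_
      exact mul_lt_mul_of_pos_left hlt hΛ0
  calc (s.card:ℝ) ≤ (((Finset.range (p+k+1)).biUnion fun j => s.filter (P j)).card : ℝ) := by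
        exact_mod_cast Finset.card_le_card hcover
    _ ≤ ((∑ j ∈ Finset.range (p+k+1), (s.filter (P j)).card : ℕ) : ℝ) := by
        exact_mod_cast Finset.card_biUnion_le
    _ = ∑ j ∈ Finset.range (p+k+1), ((s.filter (P j)).card : ℝ) := by push_cast; rfl
    _ ≤ ∑ j ∈ Finset.range (p+k+1), (1/2^(j+1))*(δ*(M/8)^k) := Finset.sum_le_sum fun j _ => hj j
    _ = (∑ j ∈ Finset.range (p+k+1), (1:ℝ)/2^(j+1))*(δ*(M/8)^k) := by rw [Finset.sum_mul]
    _ ≤ 1*(δ*(M/8)^k) := by gcongr; exact geo _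
    _ = _ := one_mul _

end BB

namespace BB

open Classical in
noncomputable def cb (G : ℕ → Prop) (x y : ℕ) : ℕ := ((Finset.Ico x y).filter G).card

lemma cb_blocks (G : ℕ → Prop) (B K m : ℕ) :
    ∑ d ∈ Finset.range m, cb G ((B+d)*K) ((B+d+1)*K) = cb G (B*K) ((B+m)*K) := by
  classical
  induction m with
  | zero => simp [cb]
  | succ m ih =>
    rw [Finset.sum_range_succ, ih]
    unfold cb
    rw [Finset.card_filter, Finset.card_filter, Finset.card_filter, Finset.sum_Ico_consecutive]
    · rfl
    · gcongr; omega
    · exact Nat.mul_le_mul_right _ (by omega)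

noncomputable def cn (F : ℕ → ℕ → ℕ → Prop) (M p k a : ℕ) : ℕ :=
  ∑ p' ∈ Finset.range p, cb (F (p+k) p') (a*M^k) ((a+1)*M^k)

noncomputable def Psi (F : ℕ → ℕ → ℕ → Prop) (L p a : ℕ) : ENNReal :=
  ∑' k, ENNReal.ofReal ((cn F (4*L) p k a : ℝ) * (1/(L:ℝ))^k)

lemma cn_kids (F : ℕ → ℕ → ℕ → Prop) (M p k a : ℕ) :
    ∑ d ∈ Finset.range M, cn F M (p+1) k (M*a+d) =
      cn F M p (k+1) a + cb (F (p+(k+1)) p) (a*M^(k+1)) ((a+1)*M^(k+1)) := by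
  unfold cn
  rw [Finset.sum_comm, Finset.sum_range_succ]
  have h : ∀ p', ∑ d ∈ Finset.range M, cb (F (p+1+k) p') ((M*a+d)*M^k) ((M*a+d+1)*M^k) =
      cb (F (p+(k+1)) p') (a*M^(k+1)) ((a+1)*M^(k+1)) := by
    intro p'
    rw [cb_blocks]
    have e1 : p+1+k = p+(k+1) := by ring
    have e2 : M*a*M^k = a*M^(k+1) := by ring
    have e3 : (M*a+M)*M^k = (a+1)*M^(k+1) := by ring
    rw [e1, e2, e3]
  rw [h, Finset.sum_congr rfl fun p' _ => h p']

lemma good_not (F : ℕ → ℕ → ℕ → Prop) (L p a : ℕ) (h : Psi F L p a ≤ ENNReal.ofReal (1/4)) :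
    ∀ p' < p, ¬ F p p' a := by
  intro p' hp' hF
  have h0 : ENNReal.ofReal ((cn F (4*L) p 0 a : ℝ) * (1/(L:ℝ))^0) ≤ Psi F L p a :=
    ENNReal.le_tsum 0
  have h1 := h0.trans h
  rw [ENNReal.ofReal_le_ofReal_iff (by norm_num), pow_zero, mul_one] at h1
  have h2 : 1 ≤ cn F (4*L) p 0 a := by
    unfold cn
    refine le_trans ?_ (Finset.single_le_sum (f := fun p' => cb (F (p+0) p') (a*(4*L)^0) ((a+1)*(4*L)^0)) (fun _ _ => Nat.zero_le _)
      (Finset.mem_range.2 hp'))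
    unfold cb
    rw [Nat.one_le_iff_ne_zero, ← Nat.pos_iff_ne_zero, Finset.card_pos]
    exact ⟨a, by simp [hF]⟩
  have h3 : (1:ℝ) ≤ cn F (4*L) p 0 a := by exact_mod_cast h2
  linarith

open Classical in
lemma good_kids (F : ℕ → ℕ → ℕ → Prop) (L : ℕ) (hL : 1 ≤ L)
    (hcount : ∀ p a, a < (4*L)^p → (∀ p' < p, ¬ F p p' a) → ∀ k, 1 ≤ k → ∀ s : Finset ℕ,
        s ⊆ Finset.Ico (a*(4*L)^k) ((a+1)*(4*L)^k) → (∀ b ∈ s, F (p+k) p b) →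
        (s.card : ℝ) ≤ (1/4)*((4*L:ℕ)/8)^k) (p a : ℕ) (ha : a < (4*L)^p)
    (h : Psi F L p a ≤ ENNReal.ofReal (1/4)) :
    2*L ≤ ((Finset.range (4*L)).filter fun d => 
      Psi F L (p+1) ((4*L)*a+d) ≤ ENNReal.ofReal (1/4)).card := by
  have hL0 : (0:ℝ) < L := by exact_mod_cast hL
  have hsum : ∑ d ∈ Finset.range (4*L), Psi F L (p+1) ((4*L)*a+d) ≤ ENNReal.ofReal (L/2) := by
    unfold Psi
    rw [← Summable.tsum_finsetSum (fun _ _ => ENNReal.summable)]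
    have hk : ∀ k, ∑ d ∈ Finset.range (4*L), 
        ENNReal.ofReal ((cn F (4*L) (p+1) k ((4*L)*a+d) : ℝ) * (1/(L:ℝ))^k) ≤
        ENNReal.ofReal L * ENNReal.ofReal ((cn F (4*L) p (k+1) a : ℝ) * (1/(L:ℝ))^(k+1)) +
        ENNReal.ofReal ((L/8)*(1/2)^k) := by
      intro k
      rw [← ENNReal.ofReal_sum_of_nonneg (fun _ _ => by positivity), ← Finset.sum_mul,
        ← Nat.cast_sum, cn_kids, ← ENNReal.ofReal_mul hL0.le, ← ENNReal.ofReal_add (by positivity)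
        (by positivity)]
      apply ENNReal.ofReal_le_ofReal
      have hnew := hcount p a ha (good_not F L p a h) (k+1) (by omega)
        ((Finset.Ico (a*(4*L)^(k+1)) ((a+1)*(4*L)^(k+1))).filter (F (p+(k+1)) p))
        (Finset.filter_subset _ _) (fun b hb => (Finset.mem_filter.1 hb).2)
      have hcb : ((cb (F (p+(k+1)) p) (a*(4*L)^(k+1)) ((a+1)*(4*L)^(k+1)) : ℕ) : ℝ) ≤
          (1/4)*((4*L:ℕ)/8)^(k+1) := hnew
      push_cast at hcb ⊢
      rw [add_mul]
      have e1 : (L:ℝ)*((cn F (4*L) p (k+1) a : ℝ) * (1/(L:ℝ))^(k+1)) =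
        (cn F (4*L) p (k+1) a : ℝ) * (1/(L:ℝ))^k := by
        rw [pow_succ]; field_simp
      rw [e1]
      have e2 : (1/4)*((4*(L:ℝ))/8)^(k+1) * (1/(L:ℝ))^k = (L/8)*(1/2)^k := by
        rw [show (4*(L:ℝ))/8 = L/2 by ring, div_pow, div_pow, div_pow]
        field_simp
        ring
      rw [← e2]
      gcongr
    refine (ENNReal.tsum_le_tsum hk).trans ?_
    rw [ENNReal.tsum_add, ENNReal.tsum_mul_left, ← ENNReal.ofReal_tsum_of_nonneg
      (fun _ => by positivity) (summable_geometric_two.mul_left _), tsum_mul_left, tsum_geometric_two]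
    have h1 : ∑' k, ENNReal.ofReal ((cn F (4*L) p (k+1) a : ℝ) * (1/(L:ℝ))^(k+1)) ≤
        ENNReal.ofReal (1/4) := by
      refine le_trans ?_ h
      exact ENNReal.tsum_comp_le_tsum_of_injective (f := fun k : ℕ => k+1) (add_left_injective 1)
        (fun k => ENNReal.ofReal ((cn F (4*L) p k a : ℝ) * (1/(L:ℝ))^k))
    calc _ ≤ ENNReal.ofReal L * ENNReal.ofReal (1/4) + ENNReal.ofReal (L/8*2) := by gcongr
      _ = ENNReal.ofReal (L/2) := by
        rw [← ENNReal.ofReal_mul hL0.le, ← ENNReal.ofReal_add (by positivity) (by positivity)]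
        congr 1; ring
  set B := (Finset.range (4*L)).filter fun d => 
      ¬ Psi F L (p+1) ((4*L)*a+d) ≤ ENNReal.ofReal (1/4) with hB
  have hBc : (B.card : ENNReal) * ENNReal.ofReal (1/4) ≤ ENNReal.ofReal (L/2) := by
    refine le_trans ?_ hsum
    calc (B.card : ENNReal) * ENNReal.ofReal (1/4) = ∑ d ∈ B, ENNReal.ofReal (1/4) := by
          rw [Finset.sum_const, nsmul_eq_mul]
      _ ≤ ∑ d ∈ B, Psi F L (p+1) ((4*L)*a+d) := by
          refine Finset.sum_le_sum fun d hd => ?_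
          exact (not_le.1 (Finset.mem_filter.1 hd).2).le
      _ ≤ _ := Finset.sum_le_sum_of_subset (Finset.filter_subset _ _)
  rw [← ENNReal.ofReal_natCast, ← ENNReal.ofReal_mul (by positivity),
    ENNReal.ofReal_le_ofReal_iff (by positivity)] at hBc
  have hB2 : B.card ≤ 2*L := by
    have : (B.card:ℝ) ≤ 2*L := by linarith
    exact_mod_cast this
  have := Finset.card_filter_add_card_filter_not (s := Finset.range (4*L)) 
    (fun d => Psi F L (p+1) ((4*L)*a+d) ≤ ENNReal.ofReal (1/4))
  rw [Finset.card_range] at this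
  have h5 : ((Finset.range (4*L)).filter fun d => 
      Psi F L (p+1) ((4*L)*a+d) ≤ ENNReal.ofReal (1/4)).card + B.card = 4*L := by
    rw [hB]
    convert this using 2
  omega

lemma spread_choice (L : ℕ) (G : Finset ℕ) (hG : 2*L ≤ G.card) :
    ∃ e : Fin L → ℕ, (∀ i, e i ∈ G) ∧ ∀ i j, i < j → e i + 2 ≤ e j := by
  let o := G.orderEmbOfFin rfl
  refine ⟨fun i => o ⟨2*i, by omega⟩, fun i => Finset.orderEmbOfFin_mem _ _ _, ?_⟩
  intro i j hij
  have hij' : (i:ℕ) < j := hij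
  have h1 : o ⟨2*i, by omega⟩ < o ⟨2*i+1, by omega⟩ := o.strictMono (by simp)
  have h2 : o ⟨2*i+1, by omega⟩ < o ⟨2*j, by omega⟩ := o.strictMono (by simp; omega)
  show o ⟨2*i, by omega⟩ + 2 ≤ o ⟨2*j, by omega⟩
  omega

end BB

namespace BB

def nodeA (M : ℕ) {L : ℕ} (ch : ℕ → ℕ → Fin L → ℕ) (ω : ℕ → Fin L) : ℕ → ℕ
  | 0 => 0
  | q+1 => M * nodeA M ch ω q + ch q (nodeA M ch ω q) (ω q)

lemma nodeA_congr (M : ℕ) {L : ℕ} (ch : ℕ → ℕ → Fin L → ℕ) (ω ω' : ℕ → Fin L) (q : ℕ)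
    (h : ∀ i < q, ω i = ω' i) : nodeA M ch ω q = nodeA M ch ω' q := by
  induction q with
  | zero => rfl
  | succ q ih => 
    have h1 := ih (fun i hi => h i (by omega))
    simp only [nodeA]
    rw [h1, h q (by omega)]

lemma cantor (L : ℕ) (hL : 2 ≤ L) (F : ℕ → ℕ → ℕ → Prop)
    (hcount : ∀ p a, a < (4*L)^p → (∀ p' < p, ¬ F p p' a) → ∀ k, 1 ≤ k → ∀ s : Finset ℕ,
        s ⊆ Finset.Ico (a*(4*L)^k) ((a+1)*(4*L)^k) → (∀ b ∈ s, F (p+k) p b) →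
        (s.card : ℝ) ≤ (1/4)*((4*L:ℕ)/8)^k) :
    ∃ Ks : Set ℝ, ENNReal.ofReal (Real.log L / Real.log (4*L)) ≤ dimH Ks ∧ Ks ⊆ Set.Icc 0 1 ∧
      ∀ t ∈ Ks, ∀ q, ∃ b : ℕ, t ∈ Set.Icc ((b:ℝ)/((4*L:ℕ):ℝ)^q) (((b:ℝ)+1)/((4*L:ℕ):ℝ)^q) ∧
        ∀ p < q, ¬ F q p b := by
  classical
  have hch : ∀ p a, ∃ e : Fin L → ℕ, a < (4*L)^p → Psi F L p a ≤ ENNReal.ofReal (1/4) →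
      (∀ i, e i < 4*L ∧ Psi F L (p+1) ((4*L)*a + e i) ≤ ENNReal.ofReal (1/4)) ∧ 
      ∀ i j, i < j → e i + 2 ≤ e j := by
    intro p a
    by_cases h : a < (4*L)^p ∧ Psi F L p a ≤ ENNReal.ofReal (1/4)
    · obtain ⟨e, he, he2⟩ := spread_choice L _ (good_kids F L (by omega) hcount p a h.1 h.2)
      refine ⟨e, fun _ _ => ⟨fun i => ?_, he2⟩⟩
      have := he i
      simpa using this
    · exact ⟨fun _ => 0, fun h1 h2 => absurd ⟨h1, h2⟩ h⟩
  choose ch hch using hch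
  set M := 4*L with hM
  let A := nodeA M ch
  have hM0 : (0:ℝ) < (M:ℝ) := by
    have : 0 < M := by omega
    exact_mod_cast this
  have hA : ∀ ω q, A ω q < M^q ∧ Psi F L q (A ω q) ≤ ENNReal.ofReal (1/4) := by
    intro ω q
    induction q with
    | zero => 
      refine ⟨by simp [A, nodeA], ?_⟩
      simp [A, nodeA, Psi, cn]
    | succ q ih =>
      have h1 := (hch q _ ih.1 ih.2).1 (ω q)
      refine ⟨?_, h1.2⟩
      show M * A ω q + ch q (A ω q) (ω q) < M^(q+1)
      calc M * A ω q + ch q (A ω q) (ω q) < M * A ω q + M := by omega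
        _ = M * (A ω q + 1) := by ring
        _ ≤ M * M^q := Nat.mul_le_mul_left _ ih.1
        _ = M^(q+1) := by ring
  have hstep : ∀ ω q, A ω (q+1) = M * A ω q + ch q (A ω q) (ω q) := fun _ _ => rfl
  have hlt : ∀ ω q, ch q (A ω q) (ω q) + 1 ≤ M := fun ω q => 
    ((hch q _ (hA ω q).1 (hA ω q).2).1 (ω q)).1
  let u : (ℕ → Fin L) → ℕ → ℝ := fun ω q => (A ω q : ℝ)/(M:ℝ)^q
  let w : (ℕ → Fin L) → ℕ → ℝ := fun ω q => ((A ω q : ℝ)+1)/(M:ℝ)^q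
  have hu : ∀ ω, Monotone (u ω) := by
    intro ω
    refine monotone_nat_of_le_succ fun q => ?_
    simp only [u, hstep]
    rw [div_le_div_iff₀ (by positivity) (by positivity)]
    push_cast
    rw [pow_succ]
    have : (0:ℝ) ≤ (ch q (A ω q) (ω q) : ℝ) * (M:ℝ)^q := by positivity
    nlinarith
  have hw : ∀ ω, Antitone (w ω) := by
    intro ω
    refine antitone_nat_of_succ_le fun q => ?_
    simp only [w, hstep]
    rw [div_le_div_iff₀ (by positivity) (by positivity)]
    push_cast
    rw [pow_succ]
    have h1 : (ch q (A ω q) (ω q) : ℝ) + 1 ≤ M := by exact_mod_cast hlt ω q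
    have : ((ch q (A ω q) (ω q) : ℝ) + 1) * (M:ℝ)^q ≤ M * (M:ℝ)^q := by gcongr
    nlinarith
  have huw : ∀ ω q, u ω q ≤ w ω q := by
    intro ω q
    simp only [u, w]
    gcongr
    linarith
  let π : (ℕ → Fin L) → ℝ := fun ω => ⨆ q, u ω q
  have hπ : ∀ ω q, π ω ∈ Set.Icc (u ω q) (w ω q) := by
    intro ω q
    have := (hu ω).ciSup_mem_iInter_Icc_of_antitone (hw ω) (huw ω)
    exact Set.mem_iInter.1 this q
  -- separation
  have hsep0 : ∀ ω ω' q, (∀ i < q, ω i = ω' i) → ω q < ω' q → 1/(M:ℝ)^(q+1) ≤ π ω' - π ω := by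
    intro ω ω' q h1 h2
    have e := nodeA_congr M ch ω ω' q h1
    have h3 := (hch q _ (hA ω q).1 (hA ω q).2).2 _ _ h2
    have h4 : A ω (q+1) + 2 ≤ A ω' (q+1) := by
      rw [hstep, hstep, show A ω' q = A ω q from e.symm]
      omega
    have h5 : ((A ω (q+1) : ℝ)) + 2 ≤ A ω' (q+1) := by exact_mod_cast h4
    have h6 := (hπ ω (q+1)).2
    have h7 := (hπ ω' (q+1)).1
    have h8 : 1/(M:ℝ)^(q+1) ≤ u ω' (q+1) - w ω (q+1) := by
      simp only [u, w]
      rw [← sub_div]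
      gcongr
      linarith
    linarith
  have hsep : ∀ ω ω', ω ≠ ω' → ∃ q, (∀ i < q, ω i = ω' i) ∧ 1/(M:ℝ)^(q+1) ≤ |π ω - π ω'| := by
    intro ω ω' hne
    have hex : ∃ q, ω q ≠ ω' q := by
      by_contra h
      push Not at h
      exact hne (funext h)
    refine ⟨Nat.find hex, fun i hi => not_not.1 (Nat.find_min hex hi), ?_⟩
    have hq := Nat.find_spec hex
    have heq : ∀ i < Nat.find hex, ω i = ω' i := fun i hi => not_not.1 (Nat.find_min hex hi)
    rcases lt_or_gt_of_ne hq with h | h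
    · have := hsep0 ω ω' _ heq h
      rw [abs_sub_comm]
      exact this.trans (le_abs_self _)
    · have := hsep0 ω' ω _ (fun i hi => (heq i hi).symm) h
      exact this.trans (le_abs_self _)
  have hinj : Function.Injective π := by
    intro ω ω' h
    by_contra hne
    obtain ⟨q, -, h2⟩ := hsep ω ω' hne
    rw [h, sub_self, abs_zero] at h2
    have : 0 < 1/(M:ℝ)^(q+1) := by positivity
    linarith
  refine ⟨Set.range π, ?_, ?_, ?_⟩
  rotate_left
  · rintro t ⟨ω, rfl⟩
    have := hπ ω 0
    simpa [u, w, A, nodeA] using this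
  · rintro t ⟨ω, rfl⟩ q
    exact ⟨A ω q, hπ ω q, good_not F L q _ (hA ω q).2⟩
  -- dimension
  have hL1 : (1:ℝ) < L := by
    have : 1 < L := by omega
    exact_mod_cast this
  have hMe : (M:ℝ) = 4*L := by rw [hM]; push_cast; ring
  have hlogL : 0 < Real.log L := Real.log_pos hL1
  have hlogM : 0 < Real.log (4*L) := Real.log_pos (by linarith)
  set r := Real.log L / Real.log (4*L) with hr
  have hr0 : 0 < r := by positivity
  have hMr : (M:ℝ)^r = L := by
    rw [hMe, hr, Real.rpow_def_of_pos (by linarith), mul_div_cancel₀ _ hlogM.ne', Real.exp_log (by linarith)]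
  have : Nonempty (ℕ → Fin L) := ⟨fun _ => ⟨0, by omega⟩⟩
  let f : ℝ → ℝ := fun t => Real.ofDigits (Function.invFun π t)
  have hfπ : ∀ ω, f (π ω) = Real.ofDigits ω := by
    intro ω
    simp only [f]
    rw [Function.leftInverse_invFun hinj ω]
  have hold : HolderOnWith (L:NNReal) r.toNNReal f (Set.range π) := by
    rintro _ ⟨ω, rfl⟩ _ ⟨ω', rfl⟩
    rw [hfπ, hfπ, edist_dist, edist_dist, Real.dist_eq, Real.dist_eq]
    have e : ((L:NNReal):ENNReal) = ENNReal.ofReal (L:ℝ) := by simp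
    rw [Real.coe_toNNReal r hr0.le, e, ENNReal.ofReal_rpow_of_nonneg (abs_nonneg _) hr0.le, ← ENNReal.ofReal_mul (by positivity)]
    apply ENNReal.ofReal_le_ofReal
    by_cases hne : ω = ω'
    · subst hne
      simp only [sub_self, abs_zero]
      positivity
    obtain ⟨q, h1, h2⟩ := hsep ω ω' hne
    refine (Real.abs_ofDigits_sub_ofDigits_le h1).trans ?_
    have h3 : (1/(M:ℝ)^(q+1))^r ≤ |π ω - π ω'|^r := Real.rpow_le_rpow (by positivity) h2 hr0.le
    have h4 : (1/(M:ℝ)^(q+1))^r = 1/(L:ℝ)^(q+1) := by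
      rw [Real.div_rpow (by positivity) (by positivity), Real.one_rpow, ← Real.rpow_natCast,
        ← Real.rpow_mul hM0.le, mul_comm, Real.rpow_mul hM0.le, hMr, Real.rpow_natCast]
    rw [h4] at h3
    calc ((L:ℝ)^q)⁻¹ = L * (1/(L:ℝ)^(q+1)) := by rw [pow_succ]; field_simp
      _ ≤ _ := by
        show _ ≤ (L:ℝ) * |π ω - π ω'|^r
        gcongr
  have hd := hold.dimH_image_le (Real.toNNReal_pos.2 hr0)
  have hsub : Set.Icc (0:ℝ) 1 ⊆ f '' Set.range π := by
    intro y hy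
    obtain ⟨ω, -, hω⟩ := Real.ofDigits_SurjOn (b := L) (by omega) hy
    exact ⟨π ω, ⟨ω, rfl⟩, by rw [hfπ, hω]⟩
  have hone : (1:ENNReal) ≤ dimH (f '' Set.range π) := by
    refine le_trans ?_ (dimH_mono hsub)
    rw [Real.dimH_of_nonempty_interior ⟨1/2, by rw [interior_Icc]; norm_num⟩]
    simp
  have hfin := hone.trans hd
  have er : (r.toNNReal : ENNReal) = ENNReal.ofReal r := rfl
  rw [er, ENNReal.le_div_iff_mul_le (Or.inl (by simpa using hr0)) (Or.inl ENNReal.ofReal_ne_top),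
    one_mul] at hfin
  exact hfin
end BB

namespace BB

lemma coeff_le_height (P : Polynomial ℤ) (i : ℕ) : |(P.coeff i : ℝ)| ≤ polyHeight P := by
  by_cases h : P.coeff i = 0
  · simp [h]
  have h1 : (P.coeff i).natAbs ≤ polyHeight P :=
    Finset.le_sup (f := fun i => (P.coeff i).natAbs) (Polynomial.mem_support_iff.2 h)
  rw [← Int.cast_abs, Int.abs_eq_natAbs]
  exact_mod_cast h1

lemma height_le (P : Polynomial ℤ) (B : ℝ) (hB : 0 ≤ B) (h : ∀ i, |(P.coeff i : ℝ)| ≤ B) : 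
    (polyHeight P : ℝ) ≤ B := by
  have : polyHeight P ≤ ⌊B⌋₊ := by
    refine Finset.sup_le fun i _ => ?_
    rw [Nat.le_floor_iff hB]
    refine le_trans (le_of_eq ?_) (h i)
    rw [← Int.cast_abs, Int.abs_eq_natAbs]
    simp
  exact (Nat.le_floor_iff hB).1 this

lemma height_pos (P : Polynomial ℤ) (h : P ≠ 0) : 1 ≤ polyHeight P := by
  have h1 : (P.coeff P.natDegree).natAbs ≤ polyHeight P :=
    Finset.le_sup (f := fun i => (P.coeff i).natAbs) (Polynomial.natDegree_mem_support_of_nonzero h)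
  have h2 : P.coeff P.natDegree ≠ 0 := by simpa using h
  omega

def cv (N : ℕ) (P : Polynomial ℤ) : Fin N → ℤ := fun k => P.coeff k

lemma cv_ne (N : ℕ) (P : Polynomial ℤ) (hN : P.natDegree < N) (h : P ≠ 0) : cv N P ≠ 0 := by
  intro h0
  have := congrFun h0 ⟨P.natDegree, hN⟩
  simp [cv] at this
  exact h this

lemma U_cv (N : ℕ) (P : Polynomial ℤ) (hN : P.natDegree < N) (x : ℝ) (i : Fin N) :
    (U N x).mulVec (vr (cv N P)) i = 
      (Polynomial.taylor x (P.map (Int.castRingHom ℝ))).coeff i := by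
  rw [taylor_coeff_eq x (P.map (Int.castRingHom ℝ)) (lt_of_le_of_lt (Polynomial.natDegree_map_le) hN)]
  simp [Matrix.mulVec, dotProduct, vr, cv]

lemma U_cv_zero (N : ℕ) (P : Polynomial ℤ) (hN : P.natDegree < N+1) (x : ℝ) :
    (U (N+1) x).mulVec (vr (cv (N+1) P)) 0 = Polynomial.aeval x P := by
  rw [U_cv _ _ hN, Fin.val_zero, Polynomial.taylor_coeff_zero, Polynomial.eval_map, Polynomial.aeval_def]
  rfl

noncomputable def Un (N : ℕ) (x : ℝ) : ℝ := ∑ i, ∑ k, |U N x i k|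

lemma Un_nonneg (N : ℕ) (x : ℝ) : 0 ≤ Un N x := by unfold Un; positivity

lemma U_cv_le (N : ℕ) (P : Polynomial ℤ) (x : ℝ) (i : Fin N) :
    |(U N x).mulVec (vr (cv N P)) i| ≤ Un N x * polyHeight P := by
  unfold Matrix.mulVec dotProduct
  refine (Finset.abs_sum_le_sum_abs _ _).trans ?_
  calc ∑ k, |U N x i k * vr (cv N P) k| ≤ ∑ k, |U N x i k| * polyHeight P := by
        refine Finset.sum_le_sum fun k _ => ?_
        rw [abs_mul]
        gcongr
        exact coeff_le_height P k
    _ = (∑ k, |U N x i k|) * polyHeight P := by rw [Finset.sum_mul]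
    _ ≤ _ := by
        gcongr
        unfold Un
        exact Finset.single_le_sum (f := fun i => ∑ k, |U N x i k|) 
          (fun _ _ => by positivity) (Finset.mem_univ i)

lemma bad_of_Hm (m : ℕ) (x c R : ℝ) (hc : 0 < c) (hR : 1 < R) 
    (h : ∀ q : ℕ, 1 ≤ q → ∀ v : Fin (m+2) → ℤ, v ≠ 0 → c ≤ ‖(Hm m (R^q) 1 x).mulVec (vr v)‖) :
    x ∈ BsetB (m+1) := by
  set D := c + Un (m+2) x with hD
  have hU := Un_nonneg (m+2) x
  have hD0 : 0 < D := by linarith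
  refine ⟨c/(R*D/c)^(m+1), by positivity, fun P hP hdeg => ?_⟩
  have hH : (1:ℝ) ≤ polyHeight P := by exact_mod_cast height_pos P hP
  have hX : 1 ≤ D*polyHeight P/c := by
    rw [one_le_div hc]
    nlinarith
  obtain ⟨k, hk1, hk2⟩ := exists_nat_pow_near hX hR
  set v := cv (m+2) P with hv
  have h1 := h (k+1) (by omega) v (cv_ne _ _ (by omega) hP)
  set T := R^(k+1) with hT
  have hT0 : 0 < T := by positivity
  have hTle : T ≤ R*D/c*polyHeight P := by
    calc T = R * R^k := by rw [hT]; ring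
      _ ≤ R * (D*polyHeight P/c) := by gcongr
      _ = _ := by ring
  have hi : ∃ i, c ≤ |(Hm m T 1 x).mulVec (vr v) i| := by
    by_contra hcon
    push Not at hcon
    have := (pi_norm_lt_iff (x := (Hm m T 1 x).mulVec (vr v)) hc).2 hcon
    linarith
  obtain ⟨i, hi⟩ := hi
  have e : (Hm m T 1 x).mulVec (vr v) i = bw m T 1 i * (U (m+2) x).mulVec (vr v) i := by
    unfold Hm
    rw [← Matrix.mulVec_mulVec, Matrix.mulVec_diagonal]
  rw [e, abs_mul, abs_of_pos (bw_pos hT0 one_pos i)] at hi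
  by_cases hi0 : i = 0
  · subst hi0
    rw [bw_zero, hv, U_cv_zero _ _ (by omega)] at hi
    rw [div_div, ← mul_pow, div_le_iff₀ (by positivity), mul_comm]
    refine hi.trans ?_
    gcongr
  · exfalso
    rw [bw_one _ _ hi0] at hi
    have h2 := U_cv_le (m+2) P x i
    rw [div_lt_iff₀ hc] at hk2
    rw [one_div, inv_mul_eq_div, le_div_iff₀ hT0] at hi
    nlinarith

lemma many_degrees (n : ℕ) (x0 ℓ : ℝ) (hℓ : 0 < ℓ) (hℓ1 : ℓ ≤ 1) :
    ∃ L0 : ℕ, ∀ L, L0 ≤ L → ∃ S : Set ℝ, S ⊆ Set.Icc x0 (x0+ℓ) ∧ 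
      ENNReal.ofReal (Real.log L / Real.log (4*L)) ≤ dimH S ∧ 
      ∀ x ∈ S, ∀ m < n, x ∈ BsetB (m+1) := by
  have hδ : (0:ℝ) < 1/(4*(n+1:ℕ)) := by positivity
  have hδ1 : (1:ℝ)/(4*(n+1:ℕ)) ≤ 1 := by
    rw [div_le_one (by positivity)]
    push_cast
    have : (0:ℝ) ≤ n := by positivity
    linarith
  choose M0 hM0 using fun m => degree_scheme m x0 ℓ _ hℓ hℓ1 hδ hδ1
  refine ⟨2 + ∑ m ∈ Finset.range n, M0 m, fun L hL => ?_⟩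
  have hLm : ∀ m < n, M0 m ≤ 4*L := by
    intro m hm
    have := Finset.single_le_sum (f := M0) (fun _ _ => Nat.zero_le _) (Finset.mem_range.2 hm)
    omega
  have hex : ∀ m : Fin n, _ := fun m => hM0 m (4*L) (hLm m m.2)
  choose F hF R c hc hR hRM hx using hex
  classical
  obtain ⟨Ks, hK1, hK01, hK2⟩ := cantor L (by omega) (fun q p b => ∃ m, F m q p b) (by
    intro p a ha hno k hk s hs hsF
    have hno' : ∀ m, ∀ p' < p, ¬ F m p p' a := fun m p' hp' hF => hno p' hp' ⟨m, hF⟩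
    have hsub : s ⊆ Finset.univ.biUnion (fun m => s.filter (fun b => F m (p+k) p b)) := by
      intro b hb
      obtain ⟨m, hm⟩ := hsF b hb
      simp only [Finset.mem_biUnion, Finset.mem_univ, true_and, Finset.mem_filter]
      exact ⟨m, hb, hm⟩
    have h1 := (Finset.card_le_card hsub).trans Finset.card_biUnion_le
    have h2 : (s.card:ℝ) ≤ ∑ m : Fin n, ((s.filter (fun b => F m (p+k) p b)).card : ℝ) := by
      exact_mod_cast h1
    refine h2.trans ?_
    have h3 : ∀ m : Fin n, ((s.filter (fun b => F m (p+k) p b)).card : ℝ) ≤ 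
        1/(4*(n+1:ℕ)) * ((4*L:ℕ)/8)^k := by
      intro m
      exact hF m p a ha (hno' m) k hk _ ((Finset.filter_subset _ _).trans hs) 
        (fun b hb => (Finset.mem_filter.1 hb).2)
    refine (Finset.sum_le_sum fun m _ => h3 m).trans ?_
    rw [Finset.sum_const, nsmul_eq_mul, Finset.card_univ, Fintype.card_fin, ← mul_assoc]
    gcongr
    rw [mul_one_div, div_le_div_iff₀ (by positivity) (by norm_num)]
    push_cast
    linarith)
  refine ⟨(fun t => x0 + ℓ*t) '' Ks, ?_, ?_, ?_⟩
  · rintro _ ⟨t, ht, rfl⟩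
    obtain ⟨h0, h1⟩ := hK01 ht
    constructor
    · show x0 ≤ x0 + ℓ*t
      nlinarith
    · show x0 + ℓ*t ≤ x0 + ℓ
      nlinarith
  · refine hK1.trans ?_
    have hlip : LipschitzWith (1/ℓ).toNNReal (fun y => (1/ℓ)*(y - x0)) := by
      refine LipschitzWith.of_dist_le' fun y z => ?_
      rw [Real.dist_eq, Real.dist_eq, ← mul_sub, abs_mul, abs_of_pos (by positivity)]
      rw [sub_sub_sub_cancel_right]
    have h := hlip.dimH_image_le ((fun t => x0 + ℓ*t) '' Ks)
    rw [Set.image_image] at h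
    have : (fun t => 1/ℓ*(x0+ℓ*t - x0)) = id := by
      funext t
      simp
      field_simp
    rw [this, Set.image_id] at h
    exact h
  · rintro _ ⟨t, ht, rfl⟩ m hm
    refine bad_of_Hm m _ (c ⟨m, hm⟩) (R ⟨m, hm⟩) (hc _) (hR _) fun q hq v hv => ?_
    obtain ⟨b, hb, hnb⟩ := hK2 t ht q
    refine hx ⟨m, hm⟩ q b _ hq ?_ (fun p hp hF => hnb p hp ⟨_, hF⟩) v hv
    have e1 := mul_le_mul_of_nonneg_left hb.1 hℓ.le
    have e2 := mul_le_mul_of_nonneg_left hb.2 hℓ.le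
    rw [← mul_div_assoc] at e1 e2
    exact ⟨by simpa using e1, by simpa using e2⟩
end BB

namespace BB

lemma log_ratio : Filter.Tendsto (fun L : ℕ => Real.log L / Real.log (4*L)) Filter.atTop (nhds 1) := by
  have h1 : Filter.Tendsto (fun L : ℕ => Real.log (4*(L:ℝ))) Filter.atTop Filter.atTop :=
    Real.tendsto_log_atTop.comp (Filter.Tendsto.const_mul_atTop (by norm_num) tendsto_natCast_atTop_atTop)
  have h2 : Filter.Tendsto (fun L : ℕ => 1 - Real.log 4 / Real.log (4*(L:ℝ))) Filter.atTop (nhds (1-0)) :=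
    tendsto_const_nhds.sub (h1.const_div_atTop _)
  rw [sub_zero] at h2
  refine h2.congr' ?_
  filter_upwards [Filter.eventually_ge_atTop 1] with L hL
  have hL' : (1:ℝ) ≤ L := by exact_mod_cast hL
  have h3 : 0 < Real.log (4*(L:ℝ)) := Real.log_pos (by linarith)
  have h4 : Real.log (4*(L:ℝ)) = Real.log 4 + Real.log L := Real.log_mul (by norm_num) (by linarith)
  rw [eq_div_iff h3.ne', sub_mul, div_mul_cancel₀ _ h3.ne', h4]
  ring

lemma dim_ge (n : ℕ) (a b : ℝ) (hab : a < b) :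
    1 ≤ dimH {x | x ∈ Set.Ioo a b ∧ ∀ m < n, x ∈ BsetB (m+1)} := by
  set ℓ := min 1 ((b-a)/3) with hℓ
  have h0 : 0 < ℓ := by rw [hℓ, lt_min_iff]; constructor <;> linarith
  have h1 : ℓ ≤ 1 := min_le_left _ _
  have h2 : ℓ ≤ (b-a)/3 := min_le_right _ _
  obtain ⟨L0, hL0⟩ := many_degrees n (a+(b-a)/3) ℓ h0 h1
  have ht := (ENNReal.continuous_ofReal.tendsto 1).comp log_ratio
  rw [ENNReal.ofReal_one] at ht
  refine le_of_tendsto ht ?_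
  filter_upwards [Filter.eventually_ge_atTop L0] with L hL
  obtain ⟨S, hS1, hS2, hS3⟩ := hL0 L hL
  refine hS2.trans (dimH_mono fun x hx => ⟨?_, hS3 x hx⟩)
  obtain ⟨h3, h4⟩ := hS1 hx
  constructor <;> linarith

end BB

namespace BB
open Polynomial in
lemma exists_minimal (k : ℕ) (α : ℝ) (h : IsAlgDegLe k α) : ∃ P : ℤ[X], P ≠ 0 ∧ P.natDegree ≤ k ∧
    aeval α P = 0 ∧ ∀ F : ℤ[X], F ≠ 0 → aeval α F = 0 → P ∣ F := by
  obtain ⟨P0, hP0, hr, hd⟩ := h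
  obtain ⟨f, hf1, hf2⟩ := UniqueFactorizationMonoid.exists_prime_factors P0 hP0
  have hz : aeval α f.prod = 0 := by
    obtain ⟨u, hu⟩ := hf2.symm
    rw [← hu, map_mul, hr, zero_mul]
  rw [map_multiset_prod, Multiset.prod_eq_zero_iff, Multiset.mem_map] at hz
  obtain ⟨P, hPf, hPz⟩ := hz
  have hPp := hf1 P hPf
  have hPdvd : P ∣ P0 := (Multiset.dvd_prod hPf).trans hf2.dvd
  have hdeg0 : P.natDegree ≠ 0 := by
    intro h0
    rw [eq_C_of_natDegree_eq_zero h0, aeval_C] at hPz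
    simp at hPz
    apply hPp.ne_zero
    rw [eq_C_of_natDegree_eq_zero h0, hPz, C_0]
  have hprim : P.IsPrimitive := hPp.irreducible.isPrimitive hdeg0
  have hirr : Irreducible (P.map (Int.castRingHom ℚ)) := 
    (IsPrimitive.Int.irreducible_iff_irreducible_map_cast hprim).1 hPp.irreducible
  have hmap : ∀ G : ℤ[X], aeval α (G.map (Int.castRingHom ℚ)) = aeval α G := by
    intro G
    exact aeval_map_algebraMap ℚ α G
  have hmin := minpoly.eq_of_irreducible hirr (by rw [hmap, hPz])
  refine ⟨P, hPp.ne_zero, (natDegree_le_of_dvd hPdvd hP0).trans hd, hPz, ?_⟩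
  intro F hF hFz
  have hcon : (F.content : ℝ) ≠ 0 := by
    have : F.content ≠ 0 := by rwa [Ne, content_eq_zero_iff]
    exact_mod_cast this
  have hFp : aeval α F.primPart = 0 := by
    rw [F.eq_C_content_mul_primPart, map_mul, aeval_C] at hFz
    simpa [hcon, hF] using hFz
  have hdvd : minpoly ℚ α ∣ F.primPart.map (Int.castRingHom ℚ) := 
    minpoly.dvd ℚ α (by rw [hmap, hFp])
  rw [← hmin] at hdvd
  have h1 : P.map (Int.castRingHom ℚ) ∣ F.primPart.map (Int.castRingHom ℚ) := 
    (Dvd.intro _ rfl).trans hdvd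
  have h2 := (IsPrimitive.Int.dvd_iff_map_cast_dvd_map_cast P F.primPart hprim).2 h1
  exact h2.trans F.primPart_dvd

open Polynomial in
noncomputable def sc (F : ℤ[X]) : ℂ[X] := (F.reverse.map (Int.castRingHom ℂ)).comp (C (1/2) * X)

open Polynomial in
lemma sc_coeff (F : ℤ[X]) (i : ℕ) : (sc F).coeff i = (F.reverse.coeff i : ℂ) * (1/2)^i := by
  unfold sc
  rw [comp_C_mul_X_coeff, coeff_map]
  simp

open Polynomial in
lemma rev_le (F : ℤ[X]) (i : ℕ) : |(F.reverse.coeff i : ℝ)| ≤ polyHeight F := by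
  rw [coeff_reverse]
  exact coeff_le_height F _

open Polynomial in
lemma sc_le (F : ℤ[X]) : (sc F).mahlerMeasure ≤ 2 * polyHeight F := by
  refine (mahlerMeasure_le_sum_norm_coeff _).trans ?_
  rw [Polynomial.sum_def]
  calc ∑ i ∈ (sc F).support, ‖(sc F).coeff i‖ ≤ ∑ i ∈ (sc F).support, polyHeight F * (1/2:ℝ)^i := by
        refine Finset.sum_le_sum fun i _ => ?_
        rw [sc_coeff, norm_mul, norm_pow]
        have := rev_le F i
        have h1 : ‖((F.reverse.coeff i : ℤ):ℂ)‖ = |(F.reverse.coeff i : ℝ)| := by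
          rw [Complex.norm_intCast]
        rw [h1]
        have h2 : ‖(1/2:ℂ)‖ = 1/2 := by norm_num
        rw [h2]
        gcongr
    _ = polyHeight F * ∑ i ∈ (sc F).support, (1/2:ℝ)^i := by rw [Finset.mul_sum]
    _ ≤ polyHeight F * 2 := by
        gcongr
        exact (summable_geometric_two.sum_le_tsum _ (fun _ _ => by positivity)).trans_eq tsum_geometric_two
    _ = _ := by ring

open Polynomial in
lemma height_factor (P Q : ℤ[X]) (hQ : Q ≠ 0) (k : ℕ) (hk : P.natDegree ≤ k) :
    (polyHeight P : ℝ) ≤ 2*4^k*polyHeight (P*Q) := by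
  have hmul : sc (P*Q) = sc P * sc Q := by
    unfold sc
    rw [reverse_mul_of_domain, Polynomial.map_mul, mul_comp]
  have h1 : 1 ≤ (sc Q).mahlerMeasure := by
    have h2 := norm_coeff_le_choose_mul_mahlerMeasure 0 (sc Q)
    rw [Nat.choose_zero_right, Nat.cast_one, one_mul, sc_coeff, pow_zero, mul_one] at h2
    refine le_trans ?_ h2
    rw [Complex.norm_intCast, coeff_zero_reverse]
    have h3 : Q.leadingCoeff ≠ 0 := by simpa using hQ
    rw [← Int.cast_abs]
    exact_mod_cast Int.one_le_abs h3
  have h4 : (sc P).mahlerMeasure ≤ 2 * polyHeight (P*Q) := by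
    refine le_trans ?_ (sc_le (P*Q))
    rw [hmul, mahlerMeasure_mul]
    exact le_mul_of_one_le_right (mahlerMeasure_nonneg _) h1
  have hdeg : (sc P).natDegree ≤ k := by
    unfold sc
    refine natDegree_comp_le.trans ?_
    have e1 : (C (1/2:ℂ) * X).natDegree ≤ 1 := (natDegree_C_mul_le _ _).trans natDegree_X_le
    have e2 : (P.reverse.map (Int.castRingHom ℂ)).natDegree ≤ k := 
      natDegree_map_le.trans ((reverse_natDegree_le P).trans hk)
    nlinarith
  have h5 : ∀ i, i ≤ k → |(P.reverse.coeff i : ℝ)| ≤ 2*4^k*polyHeight (P*Q) := by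
    intro i hi
    have h6 := norm_coeff_le_choose_mul_mahlerMeasure i (sc P)
    rw [sc_coeff, norm_mul, norm_pow, Complex.norm_intCast] at h6
    have e3 : ‖(1/2:ℂ)‖ = 1/2 := by norm_num
    have h7 : ((sc P).natDegree.choose i : ℝ) ≤ 2^k := by
      have e1 : (sc P).natDegree.choose i ≤ 2^k := 
        (Nat.choose_le_two_pow _ _).trans (Nat.pow_le_pow_right (by norm_num) hdeg)
      exact_mod_cast e1
    rw [e3, one_div, inv_pow, ← div_eq_mul_inv, div_le_iff₀ (by positivity)] at h6
    have h8 : (2:ℝ)^i ≤ 2^k := pow_le_pow_right₀ (by norm_num) hi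
    have h9 := mahlerMeasure_nonneg (sc P)
    calc _ ≤ _ := h6
      _ ≤ 2^k * (2*polyHeight (P*Q)) * 2^k := by gcongr
      _ = _ := by rw [show (4:ℝ) = 2*2 by norm_num, mul_pow]; ring
  apply height_le _ _ (by positivity)
  intro i
  by_cases hi : i ≤ P.natDegree
  · have h6 := h5 (revAt P.natDegree i) (by rw [revAt_le hi]; omega)
    rwa [coeff_reverse, revAt_invol] at h6
  · rw [coeff_eq_zero_of_natDegree_lt (by omega)]
    simp

lemma taylor_exp (N : ℕ) (P : Polynomial ℤ) (hN : P.natDegree < N+1) (ξ y : ℝ) :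
    Polynomial.aeval (ξ+y) P = ∑ j : Fin (N+1), y^(j:ℕ) * (U (N+1) ξ).mulVec (vr (cv (N+1) P)) j := by
  rw [← U_cv_zero N P hN, U_add, ← Matrix.mulVec_mulVec]
  generalize (U (N+1) ξ).mulVec (vr (cv (N+1) P)) = t
  simp [Matrix.mulVec, dotProduct, U]

lemma algHeight_spec (k : ℕ) (α : ℝ) (h : IsAlgDegLe k α) : 
    ∃ P : Polynomial ℤ, P ≠ 0 ∧ Polynomial.aeval α P = 0 ∧ polyHeight P = algHeight α := by
  obtain ⟨P, h1, h2, -⟩ := h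
  exact Nat.sInf_mem (s := {h | ∃ P : Polynomial ℤ, P ≠ 0 ∧ Polynomial.aeval α P = 0 ∧ polyHeight P = h})
    ⟨_, P, h1, h2, rfl⟩

lemma B_sub_Bstar (k : ℕ) : BsetB k ⊆ BstarSet k := by
  rintro ξ ⟨c, hc, h⟩
  have hU := Un_nonneg (k+1) ξ
  set W : ℝ := ((k+1:ℕ):ℝ)*(Un (k+1) ξ+1) with hW
  have hW0 : 0 < W := by positivity
  set K : ℝ := 2*4^k with hK
  have hK0 : 0 < K := by positivity
  refine ⟨min 1 (c/(W*K^(k+1))), by positivity, fun α hα => ?_⟩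
  obtain ⟨F, hF0, hFz, hFH⟩ := algHeight_spec k α hα
  obtain ⟨P, hP0, hPd, hPz, hPdvd⟩ := exists_minimal k α hα
  obtain ⟨Q, rfl⟩ := hPdvd F hF0 hFz
  have hQ : Q ≠ 0 := right_ne_zero_of_mul hF0
  have hh := height_factor P Q hQ k hPd
  have hA1 : (1:ℝ) ≤ algHeight α := by
    rw [← hFH]; exact_mod_cast height_pos _ hF0
  have hH1 : (1:ℝ) ≤ polyHeight P := by exact_mod_cast height_pos _ hP0
  rw [hFH] at hh
  rcases le_total 1 |ξ - α| with h1 | h1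
  · refine le_trans ?_ h1
    rw [div_le_one (by positivity)]
    exact (min_le_left _ _).trans (one_le_pow₀ hA1)
  have h2 := h P hP0 hPd
  obtain ⟨y, rfl⟩ : ∃ y, α = ξ + y := ⟨α - ξ, by ring⟩
  rw [sub_add_cancel_left, abs_neg] at h1 ⊢
  rw [taylor_exp k P (by omega), Fin.sum_univ_succ, Fin.val_zero, pow_zero, one_mul, U_cv_zero _ _ (by omega)] at hPz
  have h3 : |Polynomial.aeval ξ P| ≤ W * polyHeight P * |y| := by
    rw [eq_neg_of_add_eq_zero_left hPz, abs_neg]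
    refine (Finset.abs_sum_le_sum_abs _ _).trans ?_
    have h4 : ∀ j : Fin k, |y ^ ((j.succ : Fin (k+1)):ℕ) * (U (k+1) ξ).mulVec (vr (cv (k+1) P)) j.succ| ≤ 
        (Un (k+1) ξ+1)*polyHeight P*|y| := by
      intro j
      rw [abs_mul, abs_pow, Fin.val_succ, pow_succ]
      have h5 := U_cv_le (k+1) P ξ j.succ
      have h6 : |y|^(j:ℕ) ≤ 1 := pow_le_one₀ (abs_nonneg _) h1
      calc _ ≤ 1 * |y| * (Un (k+1) ξ * polyHeight P) := by gcongr
        _ ≤ 1 * |y| * ((Un (k+1) ξ+1) * polyHeight P) := by gcongr; linarith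
        _ = _ := by ring
    refine (Finset.sum_le_sum fun j _ => h4 j).trans ?_
    rw [Finset.sum_const, nsmul_eq_mul, Finset.card_univ, Fintype.card_fin, hW]
    push_cast
    have : 0 ≤ (Un (k+1) ξ+1)*polyHeight P*|y| := by positivity
    nlinarith
  have h5 := h2.trans h3
  rw [div_le_iff₀ (by positivity)] at h5
  rw [div_le_iff₀ (by positivity)]
  refine (min_le_right _ _).trans ?_
  rw [div_le_iff₀ (by positivity)]
  calc c ≤ _ := h5
    _ = W * |y| * (polyHeight P:ℝ)^(k+1) := by ring
    _ ≤ W * |y| * (K * algHeight (ξ+y))^(k+1) := by gcongr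
    _ = _ := by rw [mul_pow]; ring
end BB

namespace BB

lemma vr_bound (N : ℕ) (ξ : ℝ) (v : Fin N → ℤ) (B : ℝ) (hB : ∀ j, |(U N ξ).mulVec (vr v) j| ≤ B) (i : Fin N) :
    |(v i : ℝ)| ≤ Un N (-ξ) * B := by
  have e : vr v = (U N (-ξ)).mulVec ((U N ξ).mulVec (vr v)) := by
    rw [Matrix.mulVec_mulVec, ← U_add, add_neg_cancel, U_zero, Matrix.one_mulVec]
  have hB0 : 0 ≤ B := (abs_nonneg _).trans (hB i)
  have e2 := congrFun e i
  rw [show (v i : ℝ) = vr v i from rfl, e2]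
  generalize (U N ξ).mulVec (vr v) = t at *
  unfold Matrix.mulVec dotProduct
  refine (Finset.abs_sum_le_sum_abs _ _).trans ?_
  calc ∑ k, |U N (-ξ) i k * t k| ≤ ∑ k, |U N (-ξ) i k| * B := by
        refine Finset.sum_le_sum fun k _ => ?_
        rw [abs_mul]
        gcongr
        exact hB k
    _ = (∑ k, |U N (-ξ) i k|) * B := by rw [Finset.sum_mul]
    _ ≤ _ := by
        gcongr
        unfold Un
        exact Finset.single_le_sum (f := fun i => ∑ k, |U N (-ξ) i k|) 
          (fun _ _ => by positivity) (Finset.mem_univ i)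

noncomputable def vp {N : ℕ} (v : Fin N → ℤ) : Polynomial ℤ := ∑ i : Fin N, Polynomial.monomial (i:ℕ) (v i)

lemma vp_coeff {N : ℕ} (v : Fin N → ℤ) (i : Fin N) : (vp v).coeff i = v i := by
  unfold vp
  rw [Polynomial.finsetSum_coeff, Finset.sum_eq_single i]
  · simp
  · intro j _ hj
    rw [Polynomial.coeff_monomial, if_neg (fun h => hj (Fin.ext h))]
  · simp

lemma vp_coeff_ge {N : ℕ} (v : Fin N → ℤ) (i : ℕ) (hi : N ≤ i) : (vp v).coeff i = 0 := by
  unfold vp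
  rw [Polynomial.finsetSum_coeff, Finset.sum_eq_zero]
  intro j _
  rw [Polynomial.coeff_monomial, if_neg (by omega)]

lemma vp_cv {N : ℕ} (v : Fin N → ℤ) : cv N (vp v) = v := by
  funext i; exact vp_coeff v i

lemma vp_ne {N : ℕ} (v : Fin N → ℤ) (h : v ≠ 0) : vp v ≠ 0 := by
  intro h0
  apply h
  rw [← vp_cv v, h0]
  funext i
  simp [cv]

lemma vp_deg {N : ℕ} (v : Fin (N+1) → ℤ) : (vp v).natDegree ≤ N := by
  rw [Polynomial.natDegree_le_iff_coeff_eq_zero]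
  intro i hi
  exact vp_coeff_ge v i hi

lemma vp_height {N : ℕ} (ξ : ℝ) (v : Fin (N+1) → ℤ) (B : ℝ) (hB : ∀ j, |(U (N+1) ξ).mulVec (vr v) j| ≤ B) :
    (polyHeight (vp v) : ℝ) ≤ Un (N+1) (-ξ) * B := by
  have hB0 : 0 ≤ B := (abs_nonneg _).trans (hB 0)
  refine height_le _ _ (mul_nonneg (Un_nonneg _ _) hB0) fun i => ?_
  by_cases hi : i < N+1
  · have := vr_bound (N+1) ξ v B hB ⟨i, hi⟩
    rw [← vp_coeff v ⟨i, hi⟩] at this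
    exact this
  · rw [vp_coeff_ge v i (by omega)]
    simpa using mul_nonneg (Un_nonneg _ _) hB0

lemma root_near (m : ℕ) (P : Polynomial ℤ) (hd : P.natDegree < m+2) (ξ ε T : ℝ) (hε : 0 < ε) 
    (hT : 4*(m+1:ℕ) ≤ T) 
    (h0 : |(U (m+2) ξ).mulVec (vr (cv (m+2) P)) 0| < ε/T^(m+1))
    (h1 : ε*T < |(U (m+2) ξ).mulVec (vr (cv (m+2) P)) 1|)
    (h2 : ∀ j, j ≠ 0 → j ≠ 1 → |(U (m+2) ξ).mulVec (vr (cv (m+2) P)) j| ≤ ε*T) :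
    ∃ α, |ξ - α| ≤ 2/T^(m+2) ∧ Polynomial.aeval α P = 0 := by
  set t := (U (m+2) ξ).mulVec (vr (cv (m+2) P)) with ht
  have hm : (1:ℝ) ≤ (m+1:ℕ) := by exact_mod_cast (by omega)
  have hT1 : 4 ≤ T := by linarith
  have hT0 : 0 < T := by linarith
  set y0 := 2/T^(m+2) with hy0
  have hy0p : 0 < y0 := by positivity
  have hy0s : (m+1:ℕ)*y0 ≤ 1/2 := by
    rw [hy0, mul_div_assoc', div_le_iff₀ (by positivity)]
    have : T ≤ T^(m+2) := le_self_pow₀ (by linarith) (by omega)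
    linarith
  have hy01 : y0 ≤ 1 := by nlinarith
  have key : ∀ y, |y| = y0 → |Polynomial.aeval (ξ+y) P - y * t 1| < |t 1| * y0 := by
    intro y hy
    rw [taylor_exp (m+1) P hd, ← ht, Fin.sum_univ_succ, Fin.sum_univ_succ]
    have e1 : ((0:Fin (m+1)).succ : Fin (m+2)) = 1 := rfl
    rw [e1]
    simp only [Fin.val_zero, pow_zero, one_mul, Fin.val_one, pow_one]
    have e2 : ∀ S : ℝ, t 0 + (y * t 1 + S) - y * t 1 = t 0 + S := fun S => by ring
    rw [e2]
    have h3 : |∑ i : Fin m, y^((i.succ.succ : Fin (m+2)):ℕ) * t i.succ.succ| ≤ ε*T*y0/2 := by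
      refine (Finset.abs_sum_le_sum_abs _ _).trans ?_
      have h4 : ∀ i : Fin m, |y^((i.succ.succ : Fin (m+2)):ℕ) * t i.succ.succ| ≤ y0*y0*(ε*T) := by
        intro i
        rw [abs_mul, abs_pow, hy, Fin.val_succ, Fin.val_succ, pow_succ, pow_succ]
        have h5 := h2 i.succ.succ (Fin.succ_ne_zero _) (by
          intro h; have := congrArg Fin.val h; simp at this)
        have h6 : y0^(i:ℕ) ≤ 1 := pow_le_one₀ hy0p.le hy01
        calc _ ≤ 1 * y0 * y0 * (ε*T) := by gcongr
          _ = _ := by ring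
      refine (Finset.sum_le_sum fun i _ => h4 i).trans ?_
      rw [Finset.sum_const, nsmul_eq_mul, Finset.card_univ, Fintype.card_fin]
      push_cast at hy0s
      have h7 : (m:ℝ)*y0 ≤ 1/2 := by nlinarith
      calc (m:ℝ)*(y0*y0*(ε*T)) = (m*y0)*(y0*(ε*T)) := by ring
        _ ≤ (1/2)*(y0*(ε*T)) := by gcongr
        _ = _ := by ring
    have h8 : |t 0| < ε*T*y0/2 := by
      refine h0.trans_eq ?_
      rw [hy0, pow_succ T (m+1)]
      field_simp
    calc _ ≤ |t 0| + _ := abs_add_le _ _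
      _ < ε*T*y0/2 + ε*T*y0/2 := by linarith
      _ = ε*T*y0 := by ring
      _ ≤ _ := by gcongr
  have hcont : Continuous (fun y : ℝ => Polynomial.aeval (ξ+y) P) := by
    have := Polynomial.continuous_aeval (R := ℤ) (A := ℝ) P
    exact this.comp (continuous_const.add continuous_id)
  have k1 := abs_lt.1 (key y0 (abs_of_pos hy0p))
  have k2 := abs_lt.1 (key (-y0) (by rw [abs_neg, abs_of_pos hy0p]))
  have hz : ∃ y ∈ Set.Icc (-y0) y0, Polynomial.aeval (ξ+y) P = 0 := by
    rcases le_total 0 (t 1) with hs | hs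
    · rw [abs_of_nonneg hs] at k1 k2
      have := intermediate_value_Icc (show -y0 ≤ y0 by linarith) hcont.continuousOn
      obtain ⟨y, hy, hy2⟩ := this (show (0:ℝ) ∈ _ from ⟨by nlinarith, by nlinarith⟩)
      exact ⟨y, hy, hy2⟩
    · rw [abs_of_nonpos hs] at k1 k2
      have := intermediate_value_Icc' (show -y0 ≤ y0 by linarith) hcont.continuousOn
      obtain ⟨y, hy, hy2⟩ := this (show (0:ℝ) ∈ _ from ⟨by nlinarith, by nlinarith⟩)
      exact ⟨y, hy, hy2⟩
  obtain ⟨y, hy, hy2⟩ := hz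
  refine ⟨ξ+y, ?_, hy2⟩
  rw [sub_add_cancel_left, abs_neg]
  exact abs_le.2 hy

lemma B_sub_Wstar (m : ℕ) : BsetB (m+1) ⊆ WstarSet (m+1) := by
  rintro ξ ⟨c, hc, h⟩
  have hU := Un_nonneg (m+2) (-ξ)
  set V := Un (m+2) (-ξ) + 1 with hV
  have hV1 : 1 ≤ V := by linarith
  set ε := min 1 (c/(2*V^(m+1))) with hε
  have hε0 : 0 < ε := by positivity
  have hε1 : ε ≤ 1 := min_le_left _ _
  have hεc : ε * V^(m+1) < c := by
    have : ε ≤ c/(2*V^(m+1)) := min_le_right _ _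
    rw [le_div_iff₀ (by positivity)] at this
    nlinarith
  set B := 2/ε^(m+1) with hB
  have hB0 : 0 < B := by positivity
  have hBε : ε ≤ B := by
    rw [hB, le_div_iff₀ (by positivity)]
    have : ε^(m+1) ≤ 1 := pow_le_one₀ hε0.le hε1
    nlinarith
  have hmain : ∀ T : ℝ, 4*(m+1:ℕ) ≤ T → ∃ P : Polynomial ℤ, P ≠ 0 ∧ P.natDegree ≤ m+1 ∧ 
      (polyHeight P : ℝ) ≤ V*B*T ∧ ∃ α, |ξ - α| ≤ 2/T^(m+2) ∧ Polynomial.aeval α P = 0 := by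
    intro T hT
    have hm : (1:ℝ) ≤ (m+1:ℕ) := by exact_mod_cast (by omega)
    have hT1 : 1 ≤ T := by linarith
    have hT0 : 0 < T := by linarith
    set w : Fin (m+2) → ℝ := wt (T^(m+1)/ε) (1/(B*T)) (1/(ε*T)) with hw
    have hdet : (Matrix.diagonal w * U (m+2) ξ).det = 1/2 := by
      rw [Matrix.det_mul, U_det, mul_one, Matrix.det_diagonal, Fin.prod_univ_succ, Fin.prod_univ_succ]
      have e1 : w 0 = T^(m+1)/ε := by simp [hw, wt]
      have e2 : w (Fin.succ 0) = 1/(B*T) := by simp [hw, wt]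
      have e3 : ∀ i : Fin m, w i.succ.succ = 1/(ε*T) := by
        intro i
        have a1 : (i.succ.succ : Fin (m+2)) ≠ 0 := Fin.succ_ne_zero _
        have a2 : (i.succ.succ : Fin (m+2)) ≠ 1 := by
          intro h; have := congrArg Fin.val h; simp at this
        simp only [hw, wt, if_neg a1, if_neg a2]
      rw [e1, e2, Finset.prod_congr rfl fun i _ => e3 i, Finset.prod_const, Finset.card_univ, Fintype.card_fin, hB]
      rw [div_pow, mul_pow, one_pow, pow_succ, pow_succ]
      field_simp
    obtain ⟨v, hv0, hv⟩ := minkowski_base (Matrix.diagonal w * U (m+2) ξ) (by rw [hdet]; norm_num)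
      (by rw [hdet]; norm_num [abs_of_pos])
    set t := (U (m+2) ξ).mulVec (vr v) with ht
    have hwt : ∀ j, |w j * t j| < 1 := by
      intro j
      have := (pi_norm_lt_iff one_pos).1 hv j
      rwa [← Matrix.mulVec_mulVec, Matrix.mulVec_diagonal, Real.norm_eq_abs] at this
    have h0 : |t 0| < ε/T^(m+1) := by
      have := hwt 0
      rw [show w 0 = T^(m+1)/ε by simp [hw, wt], abs_mul, abs_of_pos (by positivity)] at this
      rw [lt_div_iff₀ (by positivity)]
      rw [div_mul_eq_mul_div, div_lt_one hε0] at this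
      linarith
    have h1 : |t 1| ≤ B*T := by
      have := hwt 1
      rw [show w 1 = 1/(B*T) by simp [hw, wt], abs_mul, abs_of_pos (by positivity)] at this
      rw [one_div, inv_mul_eq_div, div_lt_one (by positivity)] at this
      exact this.le
    have h2 : ∀ j, j ≠ 0 → j ≠ 1 → |t j| ≤ ε*T := by
      intro j hj0 hj1
      have := hwt j
      rw [show w j = 1/(ε*T) by simp [hw, wt, hj0, hj1], abs_mul, abs_of_pos (by positivity)] at this
      rw [one_div, inv_mul_eq_div, div_lt_one (by positivity)] at this
      exact this.le
    have h0' : |t 0| ≤ ε*T := by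
      refine h0.le.trans ((div_le_self hε0.le (one_le_pow₀ hT1)).trans ?_)
      nlinarith
    have hεT : 0 < ε*T := by positivity
    have hεBT : ε*T ≤ B*T := by gcongr
    have hall : ∀ j, |t j| ≤ B*T := by
      intro j
      by_cases hj0 : j = 0
      · rw [hj0]; linarith
      by_cases hj1 : j = 1
      · rw [hj1]; exact h1
      exact (h2 j hj0 hj1).trans hεBT
    have hP0 := vp_ne v hv0
    have hPd := vp_deg v
    have hH1 : (1:ℝ) ≤ polyHeight (vp v) := by exact_mod_cast height_pos _ hP0
    have ht1 : ε*T < |t 1| := by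
      by_contra hcon
      push Not at hcon
      have hall2 : ∀ j, |t j| ≤ ε*T := by
        intro j
        by_cases hj0 : j = 0
        · rw [hj0]; linarith
        by_cases hj1 : j = 1
        · rw [hj1]; exact hcon
        exact h2 j hj0 hj1
      have h3 := vp_height ξ v _ hall2
      have h4 := h (vp v) hP0 hPd
      rw [← U_cv_zero (m+1) (vp v) (by omega) ξ, vp_cv] at h4
      have h5 := lt_of_le_of_lt h4 h0
      rw [div_lt_div_iff₀ (by positivity) (by positivity)] at h5
      have h6 : (polyHeight (vp v):ℝ)^(m+1) ≤ (V*(ε*T))^(m+1) := by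
        gcongr
        refine h3.trans ?_
        gcongr
        linarith
      have h7 : c * T^(m+1) < ε * V^(m+1) * T^(m+1) := by
        calc _ < _ := h5
          _ ≤ ε * (V*(ε*T))^(m+1) := by gcongr
          _ = ε^(m+1) * (ε * V^(m+1) * T^(m+1)) := by ring
          _ ≤ 1 * (ε * V^(m+1) * T^(m+1)) := by
            gcongr
            exact pow_le_one₀ hε0.le hε1
          _ = _ := one_mul _
      have h8 : 0 < T^(m+1) := by positivity
      nlinarith
    refine ⟨vp v, hP0, hPd, ?_, ?_⟩
    · refine (vp_height ξ v _ hall).trans ?_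
      rw [mul_assoc]
      gcongr
      linarith
    · refine root_near m (vp v) (by omega) ξ ε T hε0 hT ?_ ?_ ?_ <;> rw [vp_cv] <;> assumption
  refine ⟨3*(V*B)^(m+2), by positivity, fun hfin => ?_⟩
  set S := {α : ℝ | IsAlgDegLe (m+1) α ∧ |ξ - α| < 3*(V*B)^(m+2) / (algHeight α : ℝ) ^ (m+1 + 1)} with hS
  have hξ : ξ ∉ S := by
    rintro ⟨⟨P, hP0, hPz, hPd⟩, -⟩
    have h1 := h P hP0 hPd
    have hH1 : (1:ℝ) ≤ polyHeight P := by exact_mod_cast height_pos _ hP0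
    rw [hPz, abs_zero] at h1
    have : 0 < c / (polyHeight P:ℝ)^(m+1) := by positivity
    linarith
  have hopen : Sᶜ ∈ nhds ξ := hfin.isClosed.isOpen_compl.mem_nhds hξ
  obtain ⟨δ, hδ, hball⟩ := Metric.mem_nhds_iff.1 hopen
  set T := 4*(m+1:ℕ) + 2/δ with hT
  have hm : (1:ℝ) ≤ (m+1:ℕ) := by exact_mod_cast (by omega)
  have hδ2 : 0 < 2/δ := by positivity
  have hT1 : 1 ≤ T := by linarith
  have hT0 : 0 < T := by linarith
  obtain ⟨P, hP0, hPd, hPH, α, hα, hαz⟩ := hmain T (by linarith)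
  have hTp : T ≤ T^(m+2) := le_self_pow₀ hT1 (by omega)
  have hin : α ∈ Metric.ball ξ δ := by
    rw [Metric.mem_ball, dist_comm, Real.dist_eq]
    refine lt_of_le_of_lt hα ?_
    rw [div_lt_iff₀ (by positivity)]
    have : 2/δ < T := by linarith
    rw [div_lt_iff₀ hδ] at this
    nlinarith
  refine hball hin ⟨⟨P, hP0, hαz, hPd⟩, lt_of_le_of_lt hα ?_⟩
  obtain ⟨F, hF0, hFz, hFH⟩ := algHeight_spec (m+1) α ⟨P, hP0, hαz, hPd⟩
  have hA1 : (1:ℝ) ≤ algHeight α := by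
    rw [← hFH]; exact_mod_cast height_pos _ hF0
  have hAle : (algHeight α : ℝ) ≤ V*B*T := by
    refine le_trans ?_ hPH
    have : algHeight α ≤ polyHeight P := Nat.sInf_le ⟨P, hP0, hαz, rfl⟩
    exact_mod_cast this
  rw [div_lt_div_iff₀ (by positivity) (by positivity)]
  have h9 : (algHeight α : ℝ)^(m+1+1) ≤ (V*B*T)^(m+2) := by gcongr
  rw [mul_pow] at h9
  have h10 : 0 < (V*B)^(m+2) * T^(m+2) := by positivity
  nlinarith
end BB

theorem stmt5 (n : ℕ) (hn : 1 ≤ n) (I : Set ℝ) (a b : ℝ) (hab : a < b)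
    (hI1 : Set.Ioo a b ⊆ I) (hI2 : I ⊆ Set.Icc a b) :
    dimH (⋂ k ∈ Finset.Icc 1 n, (BsetB k ∩ I)) = 1 ∧
    dimH (⋂ k ∈ Finset.Icc 1 n, (WstarSet k ∩ BstarSet k ∩ I)) = 1 ∧
    (∃ ξ ∈ BsetB n, Transcendental ℚ ξ) ∧
    (∃ ξ ∈ WstarSet n ∩ BstarSet n, Transcendental ℚ ξ) := by
  have hge := BB.dim_ge n a b hab
  have hle : ∀ S : Set ℝ, dimH S ≤ 1 := fun S =>
    (dimH_mono (Set.subset_univ S)).trans_eq Real.dimH_univ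
  have hmem : ∀ x, (∀ m < n, x ∈ BsetB (m+1)) → ∀ k ∈ Finset.Icc 1 n,
      x ∈ BsetB k ∧ x ∈ WstarSet k ∧ x ∈ BstarSet k := by
    intro x hx k hk
    rw [Finset.mem_Icc] at hk
    obtain ⟨m, rfl⟩ : ∃ m, k = m+1 := ⟨k-1, by omega⟩
    have := hx m (by omega)
    exact ⟨this, BB.B_sub_Wstar m this, BB.B_sub_Bstar _ this⟩
  have htr : ∃ ξ, (∀ m < n, ξ ∈ BsetB (m+1)) ∧ Transcendental ℚ ξ := by
    by_contra hcon
    push Not at hcon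
    have hsub : {x | x ∈ Set.Ioo a b ∧ ∀ m < n, x ∈ BsetB (m+1)} ⊆ {x : ℝ | IsAlgebraic ℚ x} := by
      intro x hx
      exact not_not.1 (hcon x hx.2)
    have hc : {x : ℝ | IsAlgebraic ℚ x}.Countable := Algebraic.countable ℚ ℝ
    have h0 := (hc.mono hsub).dimH_zero
    rw [h0] at hge
    exact absurd hge (by norm_num)
  obtain ⟨ξ, hξ, hξt⟩ := htr
  have hξn := hmem ξ hξ n (Finset.mem_Icc.2 ⟨hn, le_rfl⟩)
  refine ⟨le_antisymm (hle _) (hge.trans (dimH_mono ?_)),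
    le_antisymm (hle _) (hge.trans (dimH_mono ?_)), ⟨ξ, hξn.1, hξt⟩, ⟨ξ, hξn.2, hξt⟩⟩
  · intro x hx
    refine Set.mem_iInter₂.2 fun k hk => ⟨(hmem x hx.2 k hk).1, hI1 hx.1⟩
  · intro x hx
    refine Set.mem_iInter₂.2 fun k hk => ⟨(hmem x hx.2 k hk).2, hI1 hx.1⟩
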